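/- Let 0 < δ < 1, let λ₁, λ₂ be non-zero real numbers with λ₁/λ₂ irrational, let 0 < u ≤ 1/14 and let ε > 0 be sufficiently small. There exist C > 0 and q₀ such that the following holds: let q ≥ q₀ be the denominator of a convergent of the continued fraction expansion of λ₁/λ₂ and set X = q^{1/(1−8u)}. Let Z₁, Z₂ be real numbers with X^{1/2−u+ε} ≤ Z_i ≤ X^{1/2} for i = 1,2, let y ≥ X^{−2/3}, and let 𝒜 = { α ∈ ℝ : y < |α| ≤ 2y and Z_i < |S̃_2(λ_i α)| ≤ 2Z_i for i = 1,2 }. Then the Lebesgue measure of 𝒜 satisfies μ(𝒜) ≤ C y X^{2+8u+3ε} Z₁^{−4} Z₂^{−4}. -/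

import Mathlib

open scoped Classical
open MeasureTheory

noncomputable section

/-- `e x = exp(2πix)` -/
def e (x : ℝ) : ℂ := Complex.exp (2 * Real.pi * Complex.I * x)

/-- The exponential sum `S_k(α)` over primes `p` with `δX ≤ p^k ≤ X`. -/
def S (k δ X α : ℝ) : ℂ :=
  ∑ p ∈ (Finset.range (⌈X⌉₊ + 1)).filter
      (fun p : ℕ => p.Prime ∧ δ * X ≤ (p : ℝ) ^ k ∧ (p : ℝ) ^ k ≤ X),
    (Real.log p : ℂ) * e ((p : ℝ) ^ k * α)

/-- The exponential sum `U_k(α)` over naturals `n` with `δX ≤ n^k ≤ X`. -/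
def U (k δ X α : ℝ) : ℂ :=
  ∑ n ∈ (Finset.range (⌈X⌉₊ + 1)).filter
      (fun n : ℕ => δ * X ≤ (n : ℝ) ^ k ∧ (n : ℝ) ^ k ≤ X),
    e ((n : ℝ) ^ k * α)

/-- The exponential integral `T_k(α)`. -/
def T (k δ X α : ℝ) : ℂ :=
  ∫ t in (δ * X) ^ (1 / k)..(X ^ (1 / k)), e (α * t ^ k)

/-- Chebyshev theta function. -/
def theta (x : ℝ) : ℝ :=
  ∑ p ∈ (Finset.range (⌊x⌋₊ + 1)).filter Nat.Prime, Real.log p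

/-- The generalized Selberg integral `𝒥_k(X,h)`. -/
def selbergJ (k X h : ℝ) : ℝ :=
  ∫ x in X..(2 * X),
    (theta ((x + h) ^ (1 / k)) - theta (x ^ (1 / k)) -
      ((x + h) ^ (1 / k) - x ^ (1 / k))) ^ 2

/-- `ψ(m,z) = 1` iff every prime factor of `m` is at least `z`. -/
def psi (m : ℕ) (z : ℝ) : ℝ :=
  if ∀ p : ℕ, p.Prime → p ∣ m → z ≤ (p : ℝ) then 1 else 0

/-- The function `z(p)` of Harman–Kumchev. -/
def zfun (X : ℝ) (p : ℕ) : ℝ :=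
  if (p : ℝ) < X ^ ((1 : ℝ) / 7) then X ^ ((5 : ℝ) / 28) * (p : ℝ) ^ (-(1 : ℝ) / 2)
  else if (p : ℝ) ≤ X ^ ((3 : ℝ) / 14) then (p : ℝ)
  else X ^ ((5 : ℝ) / 14) * (p : ℝ)⁻¹

/-- The Harman–Kumchev sieve weight `ρ(m)`. -/
def rho (X : ℝ) (m : ℕ) : ℝ :=
  psi m (X ^ ((5 : ℝ) / 42)) -
    ∑ p ∈ (Finset.range (⌈X ^ ((1 : ℝ) / 4)⌉₊ + 1)).filter
        (fun p : ℕ => p.Prime ∧ X ^ ((5 : ℝ) / 42) ≤ (p : ℝ) ∧ (p : ℝ) < X ^ ((1 : ℝ) / 4) ∧ p ∣ m),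
      psi (m / p) (zfun X p)

/-- The sieved exponential sum `S̃_2(α)`. -/
def Stilde (δ X α : ℝ) : ℂ :=
  ∑ m ∈ (Finset.range (⌈X⌉₊ + 1)).filter
      (fun m : ℕ => δ * X ≤ (m : ℝ) ^ 2 ∧ (m : ℝ) ^ 2 ≤ X),
    (rho X m : ℂ) * e ((m : ℝ) ^ 2 * α)

/-- The Fejér-type kernel `K_η(α)`. -/
def Kf (η α : ℝ) : ℝ :=
  if α = 0 then η ^ 2 else (Real.sin (Real.pi * α * η) / (Real.pi * α)) ^ 2


theorem card_near_integers_le (α Δ Y : ℝ) (S : Finset ℕ) (Q : ℕ) (hQ : 0 < Q) (hΔ : 0 < Δ) (hY0 : 0 ≤ Y)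
    (hS : ∀ l ∈ S, (l : ℝ) ≤ Y ∧ ∃ c : ℤ, |l * α - c| ≤ Δ) :
    ∃ q : ℕ, ∃ a : ℤ, 1 ≤ q ∧ q ≤ Q ∧ |q * α - a| ≤ 1 / (Q + 1) ∧
      (S.card : ℝ) ≤ (Y / q + 1) * (2 * (q * Δ) + 3) := by
  obtain ⟨r, hr1, hr2⟩ := Real.exists_rat_abs_sub_le_and_den_le α hQ
  have hq0 : 0 < (r.den : ℝ) := by exact_mod_cast r.pos
  have hqQ : (r.den : ℝ) ≤ Q := by exact_mod_cast hr2
  have hQ0 : (0 : ℝ) < Q := by exact_mod_cast hQ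
  set θ : ℝ := r.den * α - r.num with hθ
  have hθ1 : |θ| ≤ 1 / (Q + 1) := by
    have h1 : θ = r.den * (α - r) := by
      rw [hθ, mul_sub]
      congr 1
      rw [Rat.cast_def]; field_simp
    rw [h1, abs_mul, abs_of_pos hq0]
    calc (r.den : ℝ) * |α - r| ≤ r.den * (1 / ((Q + 1) * r.den)) := by gcongr
      _ = _ := by field_simp
  refine ⟨r.den, r.num, r.pos, hr2, hθ1, ?_⟩
  choose! c hc using fun l hl => (hS l hl).2
  have hfib : ∀ b ∈ S.image (fun l => l / r.den),
      (S.filter (fun l => l / r.den = b)).card ≤ ⌊2 * (r.den * Δ) + 3⌋₊ := by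
    intro b _
    set w : ℝ := -(b * θ)  * r.den - r.den * Δ - 1 with hw
    have key : ∀ l ∈ S.filter (fun l => l / r.den = b),
        l * r.num - c l * r.den ∈ Finset.Icc ⌈w⌉ ⌊w + (2 * (r.den * Δ) + 2)⌋ := by
      intro l hl
      rw [Finset.mem_filter] at hl
      obtain ⟨hl, hb⟩ := hl
      have h1 := abs_le.1 (hc l hl)
      have h2 : (l : ℝ) = b * r.den + (l % r.den : ℕ) := by
        have := Nat.div_add_mod l r.den
        rw [hb] at this
        exact_mod_cast (by rw [mul_comm]; exact this.symm)
      have h3 : ((l % r.den : ℕ) : ℝ) * |θ| ≤ 1 := by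
        have : ((l % r.den : ℕ) : ℝ) ≤ Q := by
          exact_mod_cast (Nat.mod_lt l r.pos).le.trans hr2
        calc _ ≤ (Q : ℝ) * (1 / (Q + 1)) := by gcongr
          _ ≤ 1 := by rw [mul_one_div, div_le_one (by positivity)]; linarith
      have h4 : |((l % r.den : ℕ) : ℝ) * θ| ≤ 1 := by
        rw [abs_mul, abs_of_nonneg (Nat.cast_nonneg _)]; exact h3
      have h4 := abs_le.1 h4
      have h5 : (l : ℝ) * r.num - c l * r.den = r.den * (l * α - c l) - l * θ := by
        rw [hθ]; ring
      have h6 : (l : ℝ) * θ = b * θ * r.den + ((l % r.den : ℕ) : ℝ) * θ := by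
        nth_rw 1 [h2]; ring
      have h7 : (r.den : ℝ) * (l * α - c l) ≤ r.den * Δ := by gcongr; exact h1.2
      have h8 : -(r.den * Δ) ≤ (r.den : ℝ) * (l * α - c l) := by nlinarith [h1.1]
      rw [Finset.mem_Icc, Int.ceil_le, Int.le_floor]
      push_cast
      rw [h5, h6]
      constructor <;> rw [hw] <;> linarith
    have inj : Set.InjOn (fun l : ℕ => (l : ℤ) * r.num - c l * r.den)
        (S.filter (fun l => l / r.den = b)) := by
      intro l hl l' hl' h
      simp only [Finset.coe_filter, Set.mem_ofPred_eq] at hl hl'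
      simp only at h
      have h1 : ((l : ℤ) - l') * r.num = (c l - c l') * r.den := by linarith
      have h2 : (r.den : ℤ) ∣ ((l : ℤ) - l') * r.num := ⟨c l - c l', by rw [h1]; ring⟩
      have h3 : IsCoprime (r.den : ℤ) r.num := by
        rw [Int.isCoprime_iff_gcd_eq_one, Int.gcd_comm]
        exact r.reduced
      have h4 := h3.dvd_of_dvd_mul_right h2
      have h5 : l % r.den = l' % r.den := by
        exact ((Nat.modEq_iff_dvd.2 h4).symm)
      rw [← Nat.div_add_mod l r.den, ← Nat.div_add_mod l' r.den, hl.2, hl'.2, h5]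
    have := Finset.card_le_card_of_injOn _ key inj
    refine this.trans ?_
    rw [Int.card_Icc]
    apply Nat.le_floor
    by_cases h : 0 ≤ ⌊w + (2 * (r.den * Δ) + 2)⌋ + 1 - ⌈w⌉
    · rw [show (((⌊w + (2 * (r.den * Δ) + 2)⌋ + 1 - ⌈w⌉).toNat : ℕ) : ℝ) = (((⌊w + (2 * (r.den * Δ) + 2)⌋ + 1 - ⌈w⌉).toNat : ℤ) : ℝ) by norm_cast, Int.toNat_of_nonneg h]
      push_cast
      have := Int.floor_le (w + (2 * (r.den * Δ) + 2))
      have := Int.le_ceil w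
      linarith
    · rw [Int.toNat_of_nonpos (by omega), Nat.cast_zero]; positivity
  have h1 := Finset.card_le_mul_card_image S _ hfib
  have h2 : (S.image (fun l => l / r.den)).card ≤ ⌊Y / r.den⌋₊ + 1 := by
    rw [← Finset.card_range (⌊Y / r.den⌋₊ + 1)]
    apply Finset.card_le_card
    intro b hb
    simp only [Finset.mem_image] at hb
    obtain ⟨l, hl, rfl⟩ := hb
    rw [Finset.mem_range, Nat.lt_succ_iff]
    apply Nat.le_floor
    refine (Nat.cast_div_le).trans ?_
    gcongr
    exact (hS l hl).1
  have h3 : ((S.image (fun l => l / r.den)).card : ℝ) ≤ Y / r.den + 1 := by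
    have : ((S.image (fun l => l / r.den)).card : ℝ) ≤ ⌊Y / r.den⌋₊ + 1 := by exact_mod_cast h2
    linarith [Nat.floor_le (show 0 ≤ Y / r.den by positivity)]
  have h4 : (⌊2 * (r.den * Δ) + 3⌋₊ : ℝ) ≤ 2 * (r.den * Δ) + 3 := Nat.floor_le (by positivity)
  calc (S.card : ℝ) ≤ (⌊2 * (r.den * Δ) + 3⌋₊ * (S.image (fun l => l / r.den)).card : ℕ) := by
        exact_mod_cast h1
    _ ≤ (2 * (r.den * Δ) + 3) * (Y / r.den + 1) := by push_cast; gcongr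
    _ = _ := by ring

theorem exists_approx_of_card (α Δ Y : ℝ) (S : Finset ℕ) (hΔ : 0 < Δ) (hne : S.Nonempty)
    (hS : ∀ l ∈ S, 1 ≤ l ∧ (l : ℝ) ≤ Y ∧ ∃ c : ℤ, |l * α - c| ≤ Δ)
    (hC : 32 * (Y * Δ) ≤ S.card) :
    ∃ q : ℕ, ∃ a : ℤ, 1 ≤ q ∧ q * S.card ≤ 32 * Y ∧ |q * α - a| * S.card ≤ 32 * Δ := by
  have hY0 : 0 ≤ Y := by
    obtain ⟨l, hl⟩ := hne
    exact le_trans (Nat.cast_nonneg l) (hS l hl).2.1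
  have hc0 : (1 : ℝ) ≤ S.card := by exact_mod_cast hne.card_pos
  by_cases h32 : (S.card : ℝ) < 32
  · obtain ⟨l, hl⟩ := hne
    obtain ⟨h1, h2, c, h3⟩ := hS l hl
    refine ⟨l, c, h1, ?_, ?_⟩
    · rw [mul_comm]; gcongr
    · rw [mul_comm]; gcongr
  push Not at h32
  have hSY : (S.card : ℝ) ≤ Y := by
    have h1 : S ⊆ Finset.Icc 1 ⌊Y⌋₊ := fun l hl => by
      rw [Finset.mem_Icc]
      exact ⟨(hS l hl).1, Nat.le_floor (hS l hl).2.1⟩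
    have h2 := Finset.card_le_card h1
    rw [Nat.card_Icc, Nat.add_sub_cancel] at h2
    exact le_trans (by exact_mod_cast h2) (Nat.floor_le hY0)
  set C : ℝ := (S.card : ℝ) with hCdef
  have hΔ1 : Δ ≤ 1 / 32 := by
    by_contra h
    push Not at h
    nlinarith
  have hx : 1 ≤ C / (4 * Δ) := by
    rw [le_div_iff₀ (by positivity)]; linarith
  set Q := ⌊C / (4 * Δ)⌋₊ with hQdef
  have hQ : 0 < Q := Nat.floor_pos.2 hx
  obtain ⟨q, a, hq1, hqQ, ha, hcard⟩ := card_near_integers_le α Δ Y S Q hQ hΔ hY0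
    (fun l hl => (hS l hl).2)
  have hq0 : (0 : ℝ) < q := by exact_mod_cast hq1
  have hqr : (q : ℝ) ≤ C / (4 * Δ) :=
    le_trans (by exact_mod_cast hqQ) (Nat.floor_le (by positivity))
  rw [le_div_iff₀ (by positivity)] at hqr
  have hQ2 : C / (4 * Δ) < Q + 1 := Nat.lt_floor_add_one _
  rw [div_lt_iff₀ (by positivity)] at hQ2
  refine ⟨q, a, hq1, ?_, ?_⟩
  · have e1 : (Y / q + 1) * (2 * (q * Δ) + 3) = 2 * (Y * Δ) + 3 * (Y / q) + 2 * (q * Δ) + 3 := by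
      field_simp
      ring
    rw [e1, ← hCdef] at hcard
    have : C * (5 / 16) ≤ 3 * (Y / q) := by nlinarith
    have h2 : Y / q * q = Y := by field_simp
    nlinarith
  · rw [le_div_iff₀ (by positivity)] at ha
    nlinarith [abs_nonneg (q * α - a)]

/-- Many indices producing integers `k i` for which `k i * α` is close to an integer force a good
rational approximation to `α`, if no integer is produced too often. -/
theorem exists_approx_of_index {ι : Type*} (s : Finset ι) (k : ι → ℕ) (α Δ Y τ : ℝ) (hΔ : 0 < Δ)
    (hne : s.Nonempty) (hτ : 0 < τ)
    (hs : ∀ i ∈ s, 1 ≤ k i ∧ (k i : ℝ) ≤ Y ∧ ∃ c : ℤ, |k i * α - c| ≤ Δ)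
    (hfib : ∀ i ∈ s, ((s.filter (fun j => k j = k i)).card : ℝ) ≤ τ)
    (hC : 32 * τ * (Y * Δ) ≤ s.card) :
    ∃ q : ℕ, ∃ a : ℤ, 1 ≤ q ∧ q * s.card ≤ 32 * τ * Y ∧ |q * α - a| * s.card ≤ 32 * τ * Δ := by
  have h1 : (s.card : ℝ) ≤ τ * (s.image k).card := by
    have := Finset.card_le_mul_card_image (f := k) s ⌊τ⌋₊ (fun b hb => by
      obtain ⟨i, hi, rfl⟩ := Finset.mem_image.1 hb
      exact Nat.le_floor (hfib i hi))
    calc (s.card : ℝ) ≤ (⌊τ⌋₊ * (s.image k).card : ℕ) := by exact_mod_cast this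
      _ ≤ _ := by push_cast; gcongr; exact Nat.floor_le hτ.le
  obtain ⟨q, a, hq, h2, h3⟩ := exists_approx_of_card α Δ Y (s.image k) hΔ (hne.image k)
    (fun l hl => by
      obtain ⟨i, hi, rfl⟩ := Finset.mem_image.1 hl
      exact hs i hi)
    (by
      have : τ * (32 * (Y * Δ)) ≤ τ * (s.image k).card := by linarith
      exact le_of_mul_le_mul_left this hτ)
  refine ⟨q, a, hq, ?_, ?_⟩
  · calc (q : ℝ) * s.card ≤ q * (τ * (s.image k).card) := by gcongr
      _ = τ * (q * (s.image k).card) := by ring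
      _ ≤ τ * (32 * Y) := by gcongr
      _ = _ := by ring
  · calc |q * α - a| * s.card ≤ |q * α - a| * (τ * (s.image k).card) := by gcongr
      _ = τ * (|q * α - a| * (s.image k).card) := by ring
      _ ≤ τ * (32 * Δ) := by gcongr
      _ = _ := by ring

/-- Pigeonhole over dyadic scales. -/
theorem exists_level {ι : Type*} (s : Finset ι) (t : ι → ℝ) (V : ℝ) (J : ℕ) (hV : 0 < V)
    (ht : ∀ i ∈ s, t i ≤ V) (hsum : 2 * (s.card * (V / 2 ^ J)) ≤ ∑ i ∈ s, t i) (hJ : 0 < J) :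
    ∃ H : ℝ, V / 2 ^ J ≤ H ∧ H ≤ V ∧
      ∑ i ∈ s, t i ≤ 4 * J * (H * (s.filter (fun i => H ≤ t i)).card) := by
  have h1 : ∀ i ∈ s, t i ≤ ∑ j ∈ Finset.range J,
      (if V / 2 ^ (j + 1) ≤ t i then V / 2 ^ j else 0) + V / 2 ^ J := by
    intro i hi
    have key : ∀ n : ℕ, t i ≤ ∑ j ∈ Finset.range n,
        (if V / 2 ^ (j + 1) ≤ t i then V / 2 ^ j else 0) + V / 2 ^ n := by
      intro n
      induction n with
      | zero => simpa using ht i hi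
      | succ n ih =>
        rw [Finset.sum_range_succ]
        by_cases h : V / 2 ^ (n + 1) ≤ t i
        · rw [if_pos h]
          have : 0 < V / 2 ^ (n + 1) := by positivity
          linarith
        · have : 0 ≤ ∑ j ∈ Finset.range n, (if V / 2 ^ (j + 1) ≤ t i then V / 2 ^ j else 0) :=
            Finset.sum_nonneg fun j _ => by split_ifs <;> positivity
          rw [if_neg h]
          linarith
    exact key J
  have h2 : ∑ i ∈ s, t i ≤ ∑ j ∈ Finset.range J,
      2 * (V / 2 ^ (j + 1) * (s.filter (fun i => V / 2 ^ (j + 1) ≤ t i)).card)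
        + s.card * (V / 2 ^ J) := by
    refine (Finset.sum_le_sum h1).trans (le_of_eq ?_)
    rw [Finset.sum_add_distrib, Finset.sum_comm, Finset.sum_const, nsmul_eq_mul]
    congr 1
    refine Finset.sum_congr rfl fun j _ => ?_
    rw [← Finset.sum_filter, Finset.sum_const, nsmul_eq_mul, pow_succ]
    field_simp
  obtain ⟨j, hj, hmax⟩ := Finset.exists_max_image (Finset.range J)
    (fun j => V / 2 ^ (j + 1) * ((s.filter (fun i => V / 2 ^ (j + 1) ≤ t i)).card : ℝ))
    ⟨0, Finset.mem_range.2 hJ⟩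
  refine ⟨V / 2 ^ (j + 1), ?_, ?_, ?_⟩
  · gcongr
    · norm_num
    · have := Finset.mem_range.1 hj; omega
  · exact div_le_self hV.le (one_le_pow₀ (by norm_num))
  · have h3 := Finset.sum_le_card_nsmul (Finset.range J) _ _
      (fun j' hj' => mul_le_mul_of_nonneg_left (hmax j' hj') (by norm_num : (0:ℝ) ≤ 2))
    rw [Finset.card_range, nsmul_eq_mul] at h3
    linarith

theorem norm_e (x : ℝ) : ‖e x‖ = 1 := by
  rw [e, show (2 * Real.pi * Complex.I * x : ℂ) = ((2 * Real.pi * x : ℝ) : ℂ) * Complex.I by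
    push_cast; ring]
  exact Complex.norm_exp_ofReal_mul_I _

theorem e_add (x y : ℝ) : e (x + y) = e x * e y := by
  rw [e, e, e, ← Complex.exp_add]; push_cast; ring_nf

theorem conj_e (x : ℝ) : (starRingEnd ℂ) (e x) = e (-x) := by
  rw [e, e, ← Complex.exp_conj]; simp [Complex.conj_ofNat]

theorem e_nat_mul (n : ℕ) (x : ℝ) : e (n * x) = e x ^ n := by
  rw [e, e, ← Complex.exp_nat_mul]; push_cast; ring_nf

theorem e_int (n : ℤ) : e n = 1 := by
  rw [e, Complex.exp_eq_one_iff]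
  exact ⟨n, by push_cast; ring⟩

theorem le_norm_e_sub_one (θ η : ℝ) (hη : ∀ c : ℤ, η ≤ |θ - c|) : 4 * η ≤ ‖e θ - 1‖ := by
  set x : ℝ := θ - round θ with hx
  have h1 : e θ = e x := by
    rw [show θ = x + (round θ : ℤ) by rw [hx]; ring, e_add, e_int, mul_one]
  have h2 : |x| ≤ 1 / 2 := abs_sub_round θ
  rw [h1, e, show (2 * Real.pi * Complex.I * x : ℂ) = Complex.I * ((2 * Real.pi * x : ℝ) : ℂ) by
    push_cast; ring, Complex.norm_exp_I_mul_ofReal_sub_one]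
  have h0 : |Real.pi * x| = Real.pi * |x| := by rw [abs_mul, abs_of_pos Real.pi_pos]
  rw [show 2 * Real.pi * x / 2 = Real.pi * x by ring, Real.norm_eq_abs, abs_mul,
    Real.abs_sin_eq_sin_abs_of_abs_le_pi (by rw [h0]; nlinarith [Real.pi_pos])]
  have h3 := Real.mul_le_sin (x := |Real.pi * x|) (abs_nonneg _)
    (by rw [h0]; nlinarith [Real.pi_pos])
  have h4 : 2 / Real.pi * |Real.pi * x| = 2 * |x| := by
    rw [h0]; field_simp
  have h5 := hη (round θ)
  rw [h4] at h3
  rw [abs_two]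
  linarith

theorem norm_geom_le (a b : ℕ) (θ η : ℝ) (hη : ∀ c : ℤ, η ≤ |θ - c|) :
    ‖∑ n ∈ Finset.Icc a b, e (n * θ)‖ * η ≤ 1 := by
  by_cases hab : a ≤ b + 1
  · rw [show Finset.Icc a b = Finset.Ico a (b + 1) by ext; simp]
    simp_rw [e_nat_mul]
    have h1 := geom_sum_Ico_mul (e θ) hab
    have h2 : ‖e θ ^ (b + 1) - e θ ^ a‖ ≤ 2 := by
      refine (norm_sub_le _ _).trans ?_
      rw [norm_pow, norm_pow, norm_e, one_pow, one_pow]; norm_num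
    rw [← h1, norm_mul] at h2
    have h3 := le_norm_e_sub_one θ η hη
    nlinarith [norm_nonneg (∑ n ∈ Finset.Ico a (b + 1), e θ ^ n)]
  · rw [Finset.Icc_eq_empty (by omega)]; simp

theorem norm_sq_sum_le {ι : Type*} [LinearOrder ι] (s : Finset ι) (f : ι → ℂ) (hf : ∀ i ∈ s, ‖f i‖ ≤ 1) :
    ‖∑ i ∈ s, f i‖ ^ 2 ≤ s.card +
      2 * (∑ p ∈ (s ×ˢ s).filter (fun p => p.2 < p.1), f p.1 * (starRingEnd ℂ) (f p.2)).re := by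
  have h1 : ((‖∑ i ∈ s, f i‖ ^ 2 : ℝ) : ℂ) =
      ∑ p ∈ s ×ˢ s, f p.1 * (starRingEnd ℂ) (f p.2) := by
    rw [Complex.ofReal_pow, ← Complex.mul_conj', map_sum, Finset.sum_mul_sum, Finset.sum_product]
  have h2 : ∑ p ∈ s ×ˢ s, f p.1 * (starRingEnd ℂ) (f p.2) =
      ∑ p ∈ (s ×ˢ s).filter (fun p => p.2 < p.1), f p.1 * (starRingEnd ℂ) (f p.2) +
      (∑ p ∈ (s ×ˢ s).filter (fun p => p.1 < p.2), f p.1 * (starRingEnd ℂ) (f p.2) +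
      ∑ p ∈ (s ×ˢ s).filter (fun p => p.1 = p.2), f p.1 * (starRingEnd ℂ) (f p.2)) := by
    simp only [Finset.sum_filter]
    rw [← Finset.sum_add_distrib, ← Finset.sum_add_distrib]
    refine Finset.sum_congr rfl fun p _ => ?_
    rcases lt_trichotomy p.1 p.2 with h | h | h
    · simp [h, h.ne, h.not_gt]
    · simp [h]
    · simp [h, h.ne', h.not_gt]
  have h3 : ∑ p ∈ (s ×ˢ s).filter (fun p => p.1 < p.2), f p.1 * (starRingEnd ℂ) (f p.2) =
      (starRingEnd ℂ) (∑ p ∈ (s ×ˢ s).filter (fun p => p.2 < p.1),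
        f p.1 * (starRingEnd ℂ) (f p.2)) := by
    rw [map_sum]
    refine Finset.sum_nbij' Prod.swap Prod.swap ?_ ?_ ?_ ?_ ?_
    · intro p; simp; tauto
    · intro p; simp; tauto
    · intro p; simp
    · intro p; simp
    · intro p hp; simp [mul_comm]
  have h4 : ‖∑ p ∈ (s ×ˢ s).filter (fun p => p.1 = p.2), f p.1 * (starRingEnd ℂ) (f p.2)‖
      ≤ s.card := by
    rw [show (s ×ˢ s).filter (fun p => p.1 = p.2) = s.diag from ?_, Finset.sum_diag]
    · refine (norm_sum_le_of_le s (n := fun _ => (1:ℝ)) ?_).trans (by simp)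
      intro i hi
      rw [norm_mul, RCLike.norm_conj]
      nlinarith [hf i hi, norm_nonneg (f i)]
    · ext p; simp [Finset.mem_diag]; grind
  have h5 : ‖∑ i ∈ s, f i‖ ^ 2 = ((‖∑ i ∈ s, f i‖ ^ 2 : ℝ) : ℂ).re := (Complex.ofReal_re _).symm
  rw [h5, h1, h2, h3, Complex.add_re, Complex.add_re, Complex.conj_re]
  have h6 := (Complex.re_le_norm
    (∑ p ∈ (s ×ˢ s).filter (fun p => p.1 = p.2), f p.1 * (starRingEnd ℂ) (f p.2))).trans h4
  linarith

theorem norm_sq_weyl_le (a b : ℕ) (β : ℝ) :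
    ‖∑ n ∈ Finset.Icc a b, e (β * (n : ℝ) ^ 2)‖ ^ 2 ≤ (Finset.Icc a b).card +
      2 * ∑ h ∈ Finset.Icc 1 (b - a), ‖∑ n ∈ Finset.Icc a (b - h), e (n * (2 * h * β))‖ := by
  refine (norm_sq_sum_le _ _ (fun n _ => (norm_e _).le)).trans ?_
  gcongr
  refine (Complex.re_le_norm _).trans ?_
  have h1 : ∑ p ∈ (Finset.Icc a b ×ˢ Finset.Icc a b).filter (fun p => p.2 < p.1),
      e (β * (p.1 : ℝ) ^ 2) * (starRingEnd ℂ) (e (β * (p.2 : ℝ) ^ 2)) =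
      ∑ h ∈ Finset.Icc 1 (b - a), ∑ n ∈ Finset.Icc a (b - h),
        e (β * (h : ℝ) ^ 2) * e (n * (2 * h * β)) := by
    rw [Finset.sum_sigma']
    refine Finset.sum_nbij' (fun p => ⟨p.1 - p.2, p.2⟩) (fun x => (x.2 + x.1, x.2)) ?_ ?_ ?_ ?_ ?_
    · intro p; simp; omega
    · intro p; simp; omega
    · intro p; simp; intros; ext <;> simp; omega
    · intro p; simp
    · rintro ⟨p1, p2⟩; simp only [Finset.mem_filter, Finset.mem_product]
      intro hp
      rw [conj_e, ← e_add, ← e_add, Nat.cast_sub hp.2.le]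
      ring_nf
  rw [h1]
  refine (norm_sum_le _ _).trans (Finset.sum_le_sum fun h _ => ?_)
  rw [← Finset.mul_sum, norm_mul, norm_e, one_mul]

theorem weyl_large (a b : ℕ) (β N H : ℝ) (J : ℕ) (hJ : 0 < J) (hNJ : N ≤ 2 ^ J)
    (hN1 : 1 ≤ N) (hcard : ((Finset.Icc a b).card : ℝ) ≤ N) (hH : 0 < H)
    (hHN : 1024 * J * N ≤ H ^ 2) (hT : H ≤ ‖∑ n ∈ Finset.Icc a b, e (β * (n : ℝ) ^ 2)‖) :
    ∃ k : ℕ, ∃ c : ℤ, 1 ≤ k ∧ k * H ^ 2 ≤ 1024 * J * N ^ 2 ∧ |k * β - c| * H ^ 2 ≤ 1024 * J := by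
  have hJ1 : (1 : ℝ) ≤ J := by exact_mod_cast hJ
  have h1 := norm_sq_weyl_le a b β
  have h2 : H ^ 2 ≤ ‖∑ n ∈ Finset.Icc a b, e (β * (n : ℝ) ^ 2)‖ ^ 2 := by gcongr
  set g : ℕ → ℝ := fun h => ‖∑ n ∈ Finset.Icc a (b - h), e (n * (2 * h * β))‖ with hg
  have h3 : H ^ 2 ≤ N + 2 * ∑ h ∈ Finset.Icc 1 (b - a), g h := by linarith
  have hNH : 1024 * N ≤ H ^ 2 := by nlinarith
  have hsum : H ^ 2 / 4 ≤ ∑ h ∈ Finset.Icc 1 (b - a), g h := by linarith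
  have hcard2 : ((Finset.Icc 1 (b - a)).card : ℝ) ≤ N := by
    refine le_trans ?_ hcard
    rw [Nat.card_Icc, Nat.card_Icc]
    exact_mod_cast (by omega)
  have hgN : ∀ h ∈ Finset.Icc 1 (b - a), g h ≤ N := by
    intro h _
    refine le_trans ?_ hcard
    refine (norm_sum_le_of_le _ (n := fun _ => (1:ℝ)) fun n _ => (norm_e _).le).trans ?_
    simp only [Finset.sum_const, Nat.card_Icc, nsmul_eq_mul, mul_one]
    exact_mod_cast (by omega)
  have h2J : N / 2 ^ J ≤ 1 := by rw [div_le_one (by positivity)]; exact hNJ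
  obtain ⟨H', hH'1, hH'2, hlev⟩ := exists_level (Finset.Icc 1 (b - a)) g N J (by linarith) hgN
    (by nlinarith [Nat.cast_nonneg (α := ℝ) (Finset.Icc 1 (b - a)).card,
          show 0 ≤ N / 2 ^ J by positivity]) hJ
  have hH'0 : 0 < H' := lt_of_lt_of_le (by positivity) hH'1
  set s := (Finset.Icc 1 (b - a)).filter (fun i => H' ≤ g i) with hs
  have hW : H ^ 2 ≤ 16 * J * (H' * s.card) := by linarith
  have hW2 : 64 * N ≤ H' * s.card := by
    have : (16 * J : ℝ) * (64 * N) ≤ 16 * J * (H' * s.card) := by linarith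
    have := le_of_mul_le_mul_left this (by positivity)
    linarith
  have hne : s.Nonempty := by
    rw [Finset.nonempty_iff_ne_empty]
    intro h
    rw [h] at hW2
    simp at hW2
    linarith
  have hHH : H' * (1 / H') = 1 := by field_simp
  obtain ⟨q, c, hq, h5, h6⟩ := exists_approx_of_index s (fun i => i) (2 * β) (2 / H') N 1
    (by positivity) hne one_pos (by
      intro h hh
      rw [hs, Finset.mem_filter, Finset.mem_Icc] at hh
      refine ⟨hh.1.1, le_trans (by exact_mod_cast (by rw [Nat.card_Icc]; omega)) hcard2, ?_⟩
      by_contra hc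
      push Not at hc
      have := norm_geom_le a (b - h) (2 * h * β) (2 / H')
        (fun c => by rw [show 2 * h * β = h * (2 * β) by ring]; exact (hc c).le)
      have h7 : g h * (2 / H') ≤ 1 := this
      have h8 : H' * (2 / H') ≤ g h * (2 / H') := by gcongr; exact hh.2
      have : H' * (2 / H') = 2 := by field_simp
      linarith)
    (by
      intro i _
      exact_mod_cast (Finset.card_le_one.2 (by simp +contextual)))
    (by
      rw [show 32 * 1 * (N * (2 / H')) = 64 * N / H' by ring, div_le_iff₀ hH'0]
      linarith)
  refine ⟨2 * q, c, by omega, ?_, ?_⟩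
  · push_cast
    calc 2 * q * H ^ 2 ≤ 2 * q * (16 * J * (H' * s.card)) := by gcongr
      _ = 32 * J * H' * (q * s.card) := by ring
      _ ≤ 32 * J * H' * (32 * 1 * N) := by gcongr
      _ ≤ 32 * J * N * (32 * 1 * N) := by gcongr
      _ = _ := by ring
  · push_cast
    rw [show 2 * (q : ℝ) * β = q * (2 * β) by ring]
    calc |q * (2 * β) - c| * H ^ 2 ≤ |q * (2 * β) - c| * (16 * J * (H' * s.card)) := by gcongr
      _ = 16 * J * H' * (|q * (2 * β) - c| * s.card) := by ring
      _ ≤ 16 * J * H' * (32 * 1 * (2 / H')) := by gcongr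
      _ = 1024 * J := by field_simp; norm_num

theorem exists_eq_Icc (s : Finset ℕ) (h : ∀ x ∈ s, ∀ z ∈ s, ∀ y, x ≤ y → y ≤ z → y ∈ s) :
    ∃ a b, s = Finset.Icc a b := by
  by_cases hs : s.Nonempty
  · refine ⟨s.min' hs, s.max' hs, ?_⟩
    ext y
    rw [Finset.mem_Icc]
    exact ⟨fun hy => ⟨s.min'_le y hy, s.le_max' y hy⟩,
      fun hy => h _ (s.min'_mem hs) _ (s.max'_mem hs) y hy.1 hy.2⟩
  · exact ⟨1, 0, by simpa [Finset.not_nonempty_iff_eq_empty] using hs⟩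

theorem weyl_large' (s : Finset ℕ) (hs : ∀ x ∈ s, ∀ z ∈ s, ∀ y, x ≤ y → y ≤ z → y ∈ s)
    (β N H : ℝ) (J : ℕ) (hJ : 0 < J) (hNJ : N ≤ 2 ^ J)
    (hN1 : 1 ≤ N) (hcard : (s.card : ℝ) ≤ N) (hH : 0 < H)
    (hHN : 1024 * J * N ≤ H ^ 2) (hT : H ≤ ‖∑ n ∈ s, e (β * (n : ℝ) ^ 2)‖) :
    ∃ k : ℕ, ∃ c : ℤ, 1 ≤ k ∧ k * H ^ 2 ≤ 1024 * J * N ^ 2 ∧ |k * β - c| * H ^ 2 ≤ 1024 * J := by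
  obtain ⟨a, b, rfl⟩ := exists_eq_Icc s hs
  exact weyl_large a b β N H J hJ hNJ hN1 hcard hH hHN hT

/-- The number of representations of `k` as `r * (a ^ 2 - b ^ 2)`. -/
theorem card_sq_sub_sq_le (s : Finset (ℕ × ℕ)) (k : ℕ) (hk : k ≠ 0)
    (hs : ∀ p ∈ s, p.2 < p.1 ∧ p.1 ^ 2 - p.2 ^ 2 ∣ k) :
    s.card ≤ k.divisors.card ^ 2 := by
  rw [sq, ← Finset.card_product]
  refine Finset.card_le_card_of_injOn (fun p => (p.1 + p.2, p.1 - p.2)) ?_ ?_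
  · intro p hp
    obtain ⟨h1, h2⟩ := hs p hp
    rw [Nat.sq_sub_sq] at h2
    simp only [Finset.coe_product, Set.mem_prod, Finset.mem_coe, Nat.mem_divisors]
    exact ⟨⟨(Dvd.intro _ rfl).trans h2, hk⟩, ⟨(Dvd.intro_left _ rfl).trans h2, hk⟩⟩
  · rintro ⟨a, b⟩ hp ⟨a', b'⟩ hp' h
    have h1 := (hs _ hp).1
    have h2 := (hs _ hp').1
    simp only [Prod.mk.injEq] at h h1 h2 ⊢
    omega

theorem typeII_arith (P κ E M J N G H W : ℝ) (hM : 1 ≤ M) (hP : 0 < P) (hJ : 1 ≤ J) (hJκ : J ≤ κ)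
    (hκ : 2 ^ 60 ≤ κ) (hE : 0 < E) (hN : N * M = P) (hG : G * (4 * M) = E ^ 2)
    (hcA : κ ^ 5 * P ^ 4 ≤ E ^ 4 * M) (hH : 0 < H) (hW : G ≤ 4 * J * (H * W)) (hWN : W ≤ N ^ 2)
    (hW0 : 0 < W) :
    1024 * J * M ≤ H ^ 2 ∧
    32 * κ ^ 2 * ((1024 * J * P ^ 2 / H ^ 2) * (1024 * J / H ^ 2)) ≤ W ∧
    E ^ 4 ≤ 2 ^ 8 * J ^ 2 * P ^ 2 * (H ^ 2 * W) := by
  have hκ0 : 0 < κ := by linarith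
  have hN0 : 0 < N := by
    by_contra h
    nlinarith
  have hG0 : 0 < G := by
    by_contra h
    nlinarith [sq_pos_of_pos hE]
  -- lower bound for `H`
  have h1 : G ≤ 4 * J * N ^ 2 * H := by
    calc G ≤ 4 * J * (H * W) := hW
      _ ≤ 4 * J * (H * N ^ 2) := by gcongr
      _ = _ := by ring
  have h1' : E ^ 2 * M ≤ 16 * J * P ^ 2 * H := by
    calc E ^ 2 * M = G * (4 * M ^ 2) := by rw [← hG]; ring
      _ ≤ (4 * J * N ^ 2 * H) * (4 * M ^ 2) := by gcongr
      _ = 16 * J * (N * M) ^ 2 * H := by ring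
      _ = _ := by rw [hN]
  have hW' : E ^ 2 ≤ 16 * J * M * (H * W) := by
    calc E ^ 2 = G * (4 * M) := hG.symm
      _ ≤ (4 * J * (H * W)) * (4 * M) := by gcongr
      _ = _ := by ring
  have h2 : 1024 * J * M ≤ H ^ 2 := by
    have e1 : (E ^ 2 * M) ^ 2 ≤ (16 * J * P ^ 2 * H) ^ 2 := by gcongr
    have e2 : κ ^ 5 * P ^ 4 * M ≤ (16 * J * P ^ 2) ^ 2 * H ^ 2 := by nlinarith
    have e3 : (16 * J * P ^ 2) ^ 2 * (1024 * J * M) ≤ κ ^ 5 * P ^ 4 * M := by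
      calc (16 * J * P ^ 2) ^ 2 * (1024 * J * M) = 2 ^ 18 * J ^ 3 * (P ^ 4 * M) := by ring
        _ ≤ κ * κ ^ 3 * (P ^ 4 * M) := by gcongr; linarith
        _ ≤ κ ^ 5 * (P ^ 4 * M) := by
          gcongr
          calc κ * κ ^ 3 = κ ^ 4 := by ring
            _ ≤ κ ^ 5 := pow_le_pow_right₀ (by linarith) (by norm_num)
        _ = _ := by ring
    exact le_of_mul_le_mul_left (e3.trans e2) (by positivity)
  refine ⟨h2, ?_, ?_⟩
  · rw [show 32 * κ ^ 2 * ((1024 * J * P ^ 2 / H ^ 2) * (1024 * J / H ^ 2)) =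
      2 ^ 25 * κ ^ 2 * J ^ 2 * P ^ 2 / H ^ 4 by field_simp; norm_num, div_le_iff₀ (by positivity)]
    have e1 : E ^ 2 * (E ^ 2 * M) ^ 3 ≤ (16 * J * M * (H * W)) * (16 * J * P ^ 2 * H) ^ 3 := by
      gcongr
    have e2 : (κ ^ 5 * P ^ 4) ^ 2 ≤ (E ^ 4 * M) ^ 2 := by gcongr
    have e3 : κ ^ 10 * P ^ 8 * M ≤ 2 ^ 16 * J ^ 4 * M * P ^ 6 * (W * H ^ 4) := by
      calc κ ^ 10 * P ^ 8 * M = (κ ^ 5 * P ^ 4) ^ 2 * M := by ring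
        _ ≤ (E ^ 4 * M) ^ 2 * M := by gcongr
        _ = E ^ 2 * (E ^ 2 * M) ^ 3 := by ring
        _ ≤ _ := e1
        _ = _ := by ring
    have e4 : 2 ^ 16 * J ^ 4 * M * P ^ 6 * (2 ^ 25 * κ ^ 2 * J ^ 2 * P ^ 2) ≤ κ ^ 10 * P ^ 8 * M := by
      calc _ = 2 ^ 41 * κ ^ 2 * J ^ 6 * (P ^ 8 * M) := by ring
        _ ≤ κ * κ ^ 2 * κ ^ 6 * (P ^ 8 * M) := by gcongr; linarith
        _ = κ ^ 9 * (P ^ 8 * M) := by ring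
        _ ≤ κ ^ 10 * (P ^ 8 * M) := by gcongr <;> [linarith; norm_num]
        _ = _ := by ring
    exact le_of_mul_le_mul_left (e4.trans e3) (by positivity)
  · have e1 : E ^ 2 * (E ^ 2 * M) ≤ (16 * J * M * (H * W)) * (16 * J * P ^ 2 * H) := by gcongr
    refine le_of_mul_le_mul_left (a := M) ?_ (by linarith)
    calc M * E ^ 4 = E ^ 2 * (E ^ 2 * M) := by ring
      _ ≤ _ := e1
      _ = _ := by ring

theorem approx_of_scaled_approx (α E H W D : ℝ) (q : ℕ) (a : ℤ) (A B : ℝ) (hH : 0 < H) (hD : 0 ≤ D)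
    (hE : E ^ 4 ≤ D * (H ^ 2 * W)) (h1 : q * W ≤ A / H ^ 2) (h2 : |q * α - a| * W ≤ B / H ^ 2) :
    q * E ^ 4 ≤ D * A ∧ |q * α - a| * E ^ 4 ≤ D * B := by
  rw [le_div_iff₀ (by positivity)] at h1 h2
  constructor
  · calc q * E ^ 4 ≤ q * (D * (H ^ 2 * W)) := by gcongr
      _ = D * (q * W * H ^ 2) := by ring
      _ ≤ _ := by gcongr
  · calc |q * α - a| * E ^ 4 ≤ |q * α - a| * (D * (H ^ 2 * W)) := by gcongr
      _ = D * (|q * α - a| * W * H ^ 2) := by ring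
      _ ≤ _ := by gcongr

set_option maxHeartbeats 800000 in
theorem typeII_block (α P κ E : ℝ) (J A B M : ℕ) (y : ℕ → ℂ) (hM : 1 ≤ M)
    (hBP : (B : ℝ) ≤ P) (hP : 4 ≤ P) (hJ : 0 < J) (hJκ : (J : ℝ) ≤ κ) (hPJ : P ^ 2 ≤ 2 ^ J)
    (hκ : 2 ^ 60 ≤ κ) (hdiv : ∀ k : ℕ, 1 ≤ k → (k : ℝ) ≤ P ^ 4 → (k.divisors.card : ℝ) ≤ κ)
    (hy : ∀ n, ‖y n‖ ≤ 1) (hE : 0 < E) (c1 : 2 * P * M ≤ E ^ 2) (cA : κ ^ 5 * P ^ 4 ≤ E ^ 4 * M)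
    (hsum : E ≤ ∑ m ∈ Finset.Ico M (2 * M), ‖∑ n ∈ Finset.Icc 1 (B / M),
      if A ≤ m * n ∧ m * n ≤ B then y n * e (α * ((m : ℝ) * n) ^ 2) else 0‖) :
    ∃ q : ℕ, ∃ a : ℤ, 1 ≤ q ∧ q * E ^ 4 ≤ κ ^ 6 * P ^ 4 ∧ |q * α - a| * E ^ 4 ≤ κ ^ 6 * P ^ 2 := by
  have hM1 : (1 : ℝ) ≤ M := by exact_mod_cast hM
  have hM0 : (0 : ℝ) < M := by linarith
  have hP0 : 0 < P := by linarith
  have hJ1 : (1 : ℝ) ≤ J := by exact_mod_cast hJ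
  set N : ℝ := P / M with hN
  have hNM : N * M = P := by rw [hN]; field_simp
  have hN0 : 0 < N := by positivity
  have hBN : ((B / M : ℕ) : ℝ) ≤ N := (Nat.cast_div_le).trans (by rw [hN]; gcongr)
  set I := Finset.Icc 1 (B / M) with hI
  set f : ℕ → ℕ → ℂ := fun m n =>
    if A ≤ m * n ∧ m * n ≤ B then y n * e (α * ((m : ℝ) * n) ^ 2) else 0 with hf
  have hf1 : ∀ m n, ‖f m n‖ ≤ 1 := by
    intro m n
    simp only [hf]
    split_ifs
    · rw [norm_mul, norm_e, mul_one]; exact hy n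
    · simp
  set s := (I ×ˢ I).filter (fun p => p.2 < p.1) with hs
  set D : ℕ × ℕ → Finset ℕ := fun p => (Finset.Ico M (2 * M)).filter
    (fun m => (A ≤ m * p.1 ∧ m * p.1 ≤ B) ∧ (A ≤ m * p.2 ∧ m * p.2 ≤ B)) with hD
  set t : ℕ × ℕ → ℝ := fun p =>
    ‖∑ m ∈ D p, e ((α * ((p.1 ^ 2 - p.2 ^ 2 : ℕ) : ℝ)) * (m : ℝ) ^ 2)‖ with ht
  have hsI : ∀ p ∈ s, (1 ≤ p.1 ∧ p.1 ≤ B / M) ∧ (1 ≤ p.2 ∧ p.2 ≤ B / M) ∧ p.2 < p.1 := by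
    intro p hp
    rw [hs, Finset.mem_filter, Finset.mem_product, hI, Finset.mem_Icc, Finset.mem_Icc] at hp
    exact ⟨hp.1.1, hp.1.2, hp.2⟩
  have hIc : (I.card : ℝ) ≤ N := by simpa [hI] using hBN
  have hDc : ∀ p, ((D p).card : ℝ) ≤ M := by
    intro p
    have := Finset.card_filter_le (Finset.Ico M (2 * M))
      (fun m => (A ≤ m * p.1 ∧ m * p.1 ≤ B) ∧ (A ≤ m * p.2 ∧ m * p.2 ≤ B))
    rw [Nat.card_Ico, show 2 * M - M = M by omega] at this
    exact_mod_cast this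
  have htM : ∀ p ∈ s, t p ≤ M := by
    intro p _
    refine (norm_sum_le _ _).trans ?_
    simp only [norm_e, Finset.sum_const, nsmul_eq_mul, mul_one]
    exact hDc p
  have hpair : ∀ p ∈ s, ‖∑ m ∈ Finset.Ico M (2 * M), f m p.1 * (starRingEnd ℂ) (f m p.2)‖ ≤ t p := by
    intro p hp
    have h1 : ∑ m ∈ Finset.Ico M (2 * M), f m p.1 * (starRingEnd ℂ) (f m p.2) =
        (y p.1 * (starRingEnd ℂ) (y p.2)) *
          ∑ m ∈ D p, e ((α * ((p.1 ^ 2 - p.2 ^ 2 : ℕ) : ℝ)) * (m : ℝ) ^ 2) := by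
      rw [hD, Finset.sum_filter, Finset.mul_sum]
      refine Finset.sum_congr rfl fun m _ => ?_
      have hsub : ((p.1 ^ 2 - p.2 ^ 2 : ℕ) : ℝ) = (p.1 : ℝ) ^ 2 - (p.2 : ℝ) ^ 2 := by
        rw [Nat.cast_sub (Nat.pow_le_pow_left (hsI p hp).2.2.le 2)]; push_cast; ring
      simp only [hf]
      by_cases c1 : A ≤ m * p.1 ∧ m * p.1 ≤ B <;> by_cases c2 : A ≤ m * p.2 ∧ m * p.2 ≤ B
      · rw [if_pos c1, if_pos c2, if_pos ⟨c1, c2⟩, map_mul, conj_e, hsub,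
          show α * ((p.1 : ℝ) ^ 2 - (p.2 : ℝ) ^ 2) * (m : ℝ) ^ 2 =
            α * ((m : ℝ) * p.1) ^ 2 + -(α * ((m : ℝ) * p.2) ^ 2) by ring, e_add]
        ring
      all_goals simp [c1, c2]
    rw [h1, norm_mul, norm_mul, RCLike.norm_conj]
    have := mul_le_one₀ (hy p.1) (norm_nonneg _) (hy p.2)
    exact mul_le_of_le_one_left (norm_nonneg _) this
  have hG : E ^ 2 / (4 * M) ≤ ∑ p ∈ s, t p := by
    have e1 : E ^ 2 ≤ M * ∑ m ∈ Finset.Ico M (2 * M), ‖∑ n ∈ I, f m n‖ ^ 2 := by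
      have := sq_sum_le_card_mul_sum_sq (s := Finset.Ico M (2 * M)) (f := fun m => ‖∑ n ∈ I, f m n‖)
      rw [Nat.card_Ico, show 2 * M - M = M by omega] at this
      exact (by gcongr : E ^ 2 ≤ _).trans this
    have e2 : ∑ m ∈ Finset.Ico M (2 * M), ‖∑ n ∈ I, f m n‖ ^ 2 ≤ M * N + 2 * ∑ p ∈ s, t p := by
      calc _ ≤ ∑ m ∈ Finset.Ico M (2 * M), (N + 2 * (∑ p ∈ s, f m p.1 * (starRingEnd ℂ) (f m p.2)).re) := by
            refine Finset.sum_le_sum fun m _ => ?_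
            have := norm_sq_sum_le I (f m) (fun n _ => hf1 m n)
            linarith
        _ = M * N + 2 * (∑ p ∈ s, ∑ m ∈ Finset.Ico M (2 * M), f m p.1 * (starRingEnd ℂ) (f m p.2)).re := by
            rw [Finset.sum_add_distrib, Finset.sum_const, Nat.card_Ico,
              show 2 * M - M = M by omega, nsmul_eq_mul, ← Finset.mul_sum, Finset.sum_comm,
              Complex.re_sum]
        _ ≤ _ := by
            gcongr
            refine (Complex.re_le_norm _).trans ((norm_sum_le _ _).trans ?_)
            exact Finset.sum_le_sum hpair
    have e3 : E ^ 2 ≤ M * (M * N + 2 * ∑ p ∈ s, t p) := e1.trans (by gcongr)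
    rw [div_le_iff₀ (by positivity)]
    have e4 : M * (M * N) = P * M := by rw [← hNM]; ring
    nlinarith
  set G := E ^ 2 / (4 * M) with hGdef
  have hG0 : 0 < G := by positivity
  have hGE : G * (4 * M) = E ^ 2 := by rw [hGdef]; field_simp
  have hGP : 2 ≤ G := by
    rw [hGdef, le_div_iff₀ (by positivity)]; nlinarith
  have hscard : (s.card : ℝ) ≤ N ^ 2 := by
    have : s.card ≤ I.card * I.card := by
      rw [← Finset.card_product]; exact Finset.card_filter_le _ _
    calc (s.card : ℝ) ≤ I.card * I.card := by exact_mod_cast this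
      _ ≤ N * N := by gcongr
      _ = _ := by ring
  obtain ⟨H, hH1, hH2, hH3⟩ := exists_level s t M J hM0 htM (by
    refine le_trans ?_ (hGP.trans hG)
    rw [← mul_div_assoc, ← mul_div_assoc, div_le_iff₀ (by positivity)]
    have : (s.card : ℝ) * M ≤ P ^ 2 := by
      calc (s.card : ℝ) * M ≤ N ^ 2 * (M * M) := by
            gcongr; nlinarith
        _ = P ^ 2 := by rw [← hNM]; ring
    linarith) hJ
  have hH0 : 0 < H := lt_of_lt_of_le (by positivity) hH1
  set W := s.filter (fun p => H ≤ t p) with hW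
  have hWG : G ≤ 4 * J * (H * W.card) := hG.trans hH3
  have hW0 : (0 : ℝ) < W.card := by
    rcases (Nat.cast_nonneg (α := ℝ) W.card).lt_or_eq with h | h
    · exact h
    · rw [← h] at hWG; linarith [hWG, hG0, mul_zero H]
  have hWN : (W.card : ℝ) ≤ N ^ 2 :=
    le_trans (by exact_mod_cast Finset.card_filter_le _ _) hscard
  obtain ⟨a1, a2, a3⟩ := typeII_arith P κ E M J N G H W.card hM1 hP0 hJ1 hJκ hκ hE hNM hGE cA hH0
    hWG hWN hW0
  have hWne : W.Nonempty := by
    rw [← Finset.card_pos]; exact_mod_cast hW0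
  have hMJ : (M : ℝ) ≤ 2 ^ J := by
    obtain ⟨p, hp⟩ := hWne
    have hp1 := hsI p (Finset.mem_filter.1 hp).1
    have : 1 ≤ B / M := hp1.1.1.trans hp1.1.2
    have hMB : M ≤ B := by
      have := (Nat.le_div_iff_mul_le (by omega)).1 this
      omega
    have : (M : ℝ) ≤ B := by exact_mod_cast hMB
    nlinarith
  have key : ∀ p ∈ W, ∃ k : ℕ, ∃ c : ℤ, 1 ≤ k ∧ k * H ^ 2 ≤ 1024 * J * (M : ℝ) ^ 2 ∧
      |k * (α * ((p.1 ^ 2 - p.2 ^ 2 : ℕ) : ℝ)) - c| * H ^ 2 ≤ 1024 * J := by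
    intro p hp
    refine weyl_large' (D p) ?_ _ M H J hJ hMJ hM1 (hDc p) hH0 a1 (Finset.mem_filter.1 hp).2
    intro x hx z hz w hxw hwz
    simp only [hD, Finset.mem_filter, Finset.mem_Ico] at hx hz ⊢
    exact ⟨⟨by omega, by omega⟩,
      ⟨hx.2.1.1.trans (Nat.mul_le_mul_right _ hxw), (Nat.mul_le_mul_right _ hwz).trans hz.2.1.2⟩,
      ⟨hx.2.2.1.trans (Nat.mul_le_mul_right _ hxw), (Nat.mul_le_mul_right _ hwz).trans hz.2.2.2⟩⟩
  choose! k c hk1 hk2 hk3 using key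
  have hsq1 : ∀ p ∈ W, 1 ≤ p.1 ^ 2 - p.2 ^ 2 ∧ ((p.1 ^ 2 - p.2 ^ 2 : ℕ) : ℝ) ≤ N ^ 2 := by
    intro p hp
    obtain ⟨h1, h2, h3⟩ := hsI p (Finset.mem_filter.1 hp).1
    constructor
    · have := Nat.pow_lt_pow_left h3 (n := 2) (by norm_num)
      omega
    · have : ((p.1 ^ 2 - p.2 ^ 2 : ℕ) : ℝ) ≤ ((p.1 ^ 2 : ℕ) : ℝ) := by
        exact_mod_cast Nat.sub_le _ _
      refine this.trans ?_
      push_cast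
      have : (p.1 : ℝ) ≤ N := le_trans (by exact_mod_cast h1.2) hBN
      gcongr
  have hY : ∀ p ∈ W, ((k p * (p.1 ^ 2 - p.2 ^ 2) : ℕ) : ℝ) ≤ 1024 * J * P ^ 2 / H ^ 2 := by
    intro p hp
    rw [le_div_iff₀ (by positivity), Nat.cast_mul]
    calc (k p : ℝ) * ((p.1 ^ 2 - p.2 ^ 2 : ℕ) : ℝ) * H ^ 2
        = (k p * H ^ 2) * ((p.1 ^ 2 - p.2 ^ 2 : ℕ) : ℝ) := by ring
      _ ≤ (1024 * J * (M : ℝ) ^ 2) * N ^ 2 :=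
        mul_le_mul (hk2 p hp) (hsq1 p hp).2 (Nat.cast_nonneg _) (by positivity)
      _ = _ := by rw [← hNM]; ring
  have hYP : 1024 * J * P ^ 2 / H ^ 2 ≤ P ^ 4 := by
    rw [div_le_iff₀ (by positivity)]
    calc 1024 * J * P ^ 2 = (1024 * J * 1) * (P ^ 2 * 1) := by ring
      _ ≤ (1024 * J * M) * (P ^ 2 * P ^ 2) := by
        have : (1 : ℝ) ≤ P ^ 2 := by nlinarith
        gcongr
      _ ≤ H ^ 2 * (P ^ 2 * P ^ 2) := by gcongr
      _ = _ := by ring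
  have happ : ∀ i ∈ W, 1 ≤ k i * (i.1 ^ 2 - i.2 ^ 2) ∧
      ((k i * (i.1 ^ 2 - i.2 ^ 2) : ℕ) : ℝ) ≤ 1024 * J * P ^ 2 / H ^ 2 ∧
      ∃ c : ℤ, |((k i * (i.1 ^ 2 - i.2 ^ 2) : ℕ) : ℝ) * α - c| ≤ 1024 * J / H ^ 2 := by
    intro p hp
    refine ⟨Nat.mul_pos (hk1 p hp) (hsq1 p hp).1, hY p hp, c p, ?_⟩
    rw [le_div_iff₀ (by positivity), Nat.cast_mul, mul_assoc, mul_comm _ α]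
    exact hk3 p hp
  have hfib : ∀ i ∈ W, ((W.filter (fun j => k j * (j.1 ^ 2 - j.2 ^ 2) =
      k i * (i.1 ^ 2 - i.2 ^ 2))).card : ℝ) ≤ κ ^ 2 := by
    intro p hp
    have hkp : 1 ≤ k p * (p.1 ^ 2 - p.2 ^ 2) := Nat.mul_pos (hk1 p hp) (hsq1 p hp).1
    have h1 := card_sq_sub_sq_le
      (W.filter (fun j => k j * (j.1 ^ 2 - j.2 ^ 2) = k p * (p.1 ^ 2 - p.2 ^ 2)))
      (k p * (p.1 ^ 2 - p.2 ^ 2)) (by omega) (by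
        intro j hj
        obtain ⟨hj1, hj2⟩ := Finset.mem_filter.1 hj
        exact ⟨(hsI j (Finset.mem_filter.1 hj1).1).2.2, hj2 ▸ Dvd.intro_left _ rfl⟩)
    have h2 := hdiv _ hkp ((hY p hp).trans hYP)
    calc _ ≤ (((k p * (p.1 ^ 2 - p.2 ^ 2)).divisors.card : ℝ)) ^ 2 := by exact_mod_cast h1
      _ ≤ _ := by gcongr
  obtain ⟨q, a, hq1, hq2, hq3⟩ := exists_approx_of_index W (fun p => k p * (p.1 ^ 2 - p.2 ^ 2)) α
    (1024 * J / H ^ 2) (1024 * J * P ^ 2 / H ^ 2) (κ ^ 2) (by positivity) hWne (by positivity) happ hfib a2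
  obtain ⟨b1, b2⟩ := approx_of_scaled_approx α E H W.card (2 ^ 8 * J ^ 2 * P ^ 2) q a
    (32 * κ ^ 2 * (1024 * J * P ^ 2)) (32 * κ ^ 2 * (1024 * J)) hH0 (by positivity) a3
    (hq2.trans (le_of_eq (by ring))) (hq3.trans (le_of_eq (by ring)))
  have hfin : 2 ^ 23 * κ ^ 2 * J ^ 3 ≤ κ ^ 6 := by
    calc 2 ^ 23 * κ ^ 2 * J ^ 3 ≤ κ * κ ^ 2 * κ ^ 3 := by gcongr; linarith
      _ = _ := by ring
  refine ⟨q, a, hq1, b1.trans ?_, b2.trans ?_⟩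
  · calc _ = 2 ^ 23 * κ ^ 2 * J ^ 3 * P ^ 4 := by ring
      _ ≤ _ := by gcongr
  · calc _ = 2 ^ 23 * κ ^ 2 * J ^ 3 * P ^ 2 := by ring
      _ ≤ _ := by gcongr

theorem typeI_level (α P κ E : ℝ) (J A B M : ℕ) (hM : 1 ≤ M) (hBP : (B : ℝ) ≤ P)
    (hP : 4 ≤ P) (hJ : 0 < J) (hJκ : (J : ℝ) ≤ κ) (hPJ : P ^ 2 ≤ 2 ^ J) (hκ : 2 ^ 60 ≤ κ)
    (hE : 1 ≤ E) (d1 : κ ^ 4 * (M * P) ≤ E ^ 2)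
    (hsum : E ≤ ∑ m ∈ Finset.Ico M (2 * M), ‖∑ n ∈ Finset.Icc 1 (B / M),
      if A ≤ m * n ∧ m * n ≤ B then e (α * ((m : ℝ) * n) ^ 2) else 0‖) :
    ∃ (H : ℝ) (D : Finset ℕ) (r : ℕ → ℕ) (b : ℕ → ℤ), 0 < H ∧ D ⊆ Finset.Ico M (2 * M) ∧
      D.Nonempty ∧ E ≤ 4 * J * (H * D.card) ∧ E ≤ 4 * J * (H * M) ∧ 1024 * J ≤ H ^ 2 ∧
      ∀ m ∈ D, 1 ≤ r m ∧ r m * H ^ 2 ≤ 1024 * J * (P / M) ^ 2 ∧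
        |r m * (m : ℝ) ^ 2 * α - b m| * H ^ 2 ≤ 1024 * J := by
  have hM1 : (1 : ℝ) ≤ M := by exact_mod_cast hM
  have hM0 : (0 : ℝ) < M := by linarith
  have hP0 : 0 < P := by linarith
  have hJ1 : (1 : ℝ) ≤ J := by exact_mod_cast hJ
  set N : ℝ := P / M with hN
  have hNM : N * M = P := by rw [hN]; field_simp
  have hN0 : 0 < N := by positivity
  have hBN : ((B / M : ℕ) : ℝ) ≤ N := (Nat.cast_div_le).trans (by rw [hN]; gcongr)
  set D : ℕ → Finset ℕ := fun m => (Finset.Icc 1 (B / M)).filter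
    (fun n => A ≤ m * n ∧ m * n ≤ B) with hD
  set t : ℕ → ℝ := fun m => ‖∑ n ∈ D m, e ((α * (m : ℝ) ^ 2) * (n : ℝ) ^ 2)‖ with ht
  have hDc : ∀ m, ((D m).card : ℝ) ≤ N := by
    intro m
    have := Finset.card_filter_le (Finset.Icc 1 (B / M)) (fun n => A ≤ m * n ∧ m * n ≤ B)
    rw [Nat.card_Icc, Nat.add_sub_cancel] at this
    exact le_trans (by exact_mod_cast this) hBN
  have htN : ∀ m ∈ Finset.Ico M (2 * M), t m ≤ N := by
    intro m _
    refine (norm_sum_le _ _).trans ?_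
    simp only [norm_e, Finset.sum_const, nsmul_eq_mul, mul_one]
    exact hDc m
  have hsum' : E ≤ ∑ m ∈ Finset.Ico M (2 * M), t m := by
    refine hsum.trans (le_of_eq (Finset.sum_congr rfl fun m _ => ?_))
    simp only [ht, hD]
    rw [Finset.sum_filter]
    congr 1
    refine Finset.sum_congr rfl fun n _ => ?_
    split_ifs <;> [(congr 1; ring); rfl]
  have hc : (Finset.Ico M (2 * M)).card = M := by rw [Nat.card_Ico]; omega
  obtain ⟨H, hH1, hH2, hH3⟩ := exists_level _ t N J hN0 htN (by
    refine le_trans ?_ (hE.trans hsum')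
    rw [hc, ← mul_div_assoc, ← mul_div_assoc, div_le_iff₀ (by positivity), mul_comm (M : ℝ), hNM]
    nlinarith) hJ
  have hH0 : 0 < H := lt_of_lt_of_le (by positivity) hH1
  set W := (Finset.Ico M (2 * M)).filter (fun m => H ≤ t m) with hW
  have hEW : E ≤ 4 * J * (H * W.card) := hsum'.trans hH3
  have hW0 : (0 : ℝ) < W.card := by
    rcases (Nat.cast_nonneg (α := ℝ) W.card).lt_or_eq with h | h
    · exact h
    · rw [← h] at hEW; linarith [mul_zero H]
  have hWM : (W.card : ℝ) ≤ M := by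
    have := Finset.card_filter_le (Finset.Ico M (2 * M)) (fun m => H ≤ t m)
    rw [hc] at this
    exact_mod_cast this
  have hEM : E ≤ 4 * J * (H * M) := hEW.trans (by gcongr)
  have hWne : W.Nonempty := by
    rw [← Finset.card_pos]; exact_mod_cast hW0
  have hκ0 : 0 < κ := by linarith
  have hH : 1024 * J * N ≤ H ^ 2 := by
    have e1 : E ^ 2 ≤ (4 * J * (H * M)) ^ 2 := by gcongr
    refine le_of_mul_le_mul_left (a := 16 * J ^ 2 * (M : ℝ) ^ 2) ?_ (by positivity)
    calc 16 * J ^ 2 * (M : ℝ) ^ 2 * (1024 * J * N) = 2 ^ 14 * J ^ 3 * (M * (N * M)) := by ring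
      _ ≤ κ * κ ^ 3 * (M * (N * M)) := by gcongr; linarith
      _ = κ ^ 4 * (M * P) := by rw [hNM]; ring
      _ ≤ E ^ 2 := d1
      _ ≤ _ := e1
      _ = _ := by ring
  have hpos : 1 ≤ B / M := by
    by_contra h0
    have h0 : B / M = 0 := Nat.lt_one_iff.1 (not_le.1 h0)
    simp [h0] at hsum
    linarith
  have hN1 : 1 ≤ N := le_trans (by exact_mod_cast hpos) hBN
  have hNJ : N ≤ 2 ^ J := by nlinarith
  have key : ∀ m ∈ W, ∃ k : ℕ, ∃ c : ℤ, 1 ≤ k ∧ k * H ^ 2 ≤ 1024 * J * N ^ 2 ∧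
      |k * (α * (m : ℝ) ^ 2) - c| * H ^ 2 ≤ 1024 * J := by
    intro m hm
    refine weyl_large' (D m) ?_ _ N H J hJ hNJ hN1 (hDc m) hH0 hH (Finset.mem_filter.1 hm).2
    intro x hx z hz w hxw hwz
    simp only [hD, Finset.mem_filter, Finset.mem_Icc] at hx hz ⊢
    exact ⟨⟨by omega, by omega⟩,
      ⟨hx.2.1.trans (Nat.mul_le_mul_left _ hxw), (Nat.mul_le_mul_left _ hwz).trans hz.2.2⟩⟩
  choose! r b hr1 hr2 hr3 using key
  refine ⟨H, W, r, b, hH0, Finset.filter_subset _ _, hWne, hEW, hEM, by nlinarith, fun m hm =>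
    ⟨hr1 m hm, hr2 m hm, ?_⟩⟩
  rw [show r m * (m : ℝ) ^ 2 * α = r m * (α * (m : ℝ) ^ 2) by ring]
  exact hr3 m hm

set_option maxHeartbeats 800000 in
theorem typeI_small (α P κ E : ℝ) (J A B M : ℕ) (hM : 1 ≤ M) (hBP : (B : ℝ) ≤ P)
    (hP : 4 ≤ P) (hJ : 0 < J) (hJκ : (J : ℝ) ≤ κ) (hPJ : P ^ 2 ≤ 2 ^ J) (hκ : 2 ^ 60 ≤ κ)
    (hdiv : ∀ k : ℕ, 1 ≤ k → (k : ℝ) ≤ P ^ 4 → (k.divisors.card : ℝ) ≤ κ)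
    (hE : 1 ≤ E) (d1 : κ ^ 4 * (M * P) ≤ E ^ 2) (f1 : κ ^ 8 * (P ^ 2 * (M : ℝ) ^ 3) ≤ E ^ 4)
    (hME : M * E ^ 2 ≤ κ ^ 4 * P ^ 2)
    (hsum : E ≤ ∑ m ∈ Finset.Ico M (2 * M), ‖∑ n ∈ Finset.Icc 1 (B / M),
      if A ≤ m * n ∧ m * n ≤ B then e (α * ((m : ℝ) * n) ^ 2) else 0‖) :
    ∃ q : ℕ, ∃ a : ℤ, 1 ≤ q ∧ q * E ^ 4 ≤ κ ^ 9 * P ^ 4 ∧ |q * α - a| * E ^ 4 ≤ κ ^ 9 * P ^ 2 := by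
  obtain ⟨H, D, r, b, hH0, hDs, hDne, hED, hEM, hHJ, hr⟩ :=
    typeI_level α P κ E J A B M hM hBP hP hJ hJκ hPJ hκ hE d1 hsum
  have hM1 : (1 : ℝ) ≤ M := by exact_mod_cast hM
  have hM0 : (0 : ℝ) < M := by linarith
  have hP0 : 0 < P := by linarith
  have hJ1 : (1 : ℝ) ≤ J := by exact_mod_cast hJ
  have hκ0 : 0 < κ := by linarith
  have hDm : ∀ m ∈ D, 1 ≤ m ∧ (m : ℝ) ≤ 2 * M := by
    intro m hm
    have := Finset.mem_Ico.1 (hDs hm)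
    exact ⟨by omega, by exact_mod_cast this.2.le⟩
  have hY : ∀ m ∈ D, ((r m * m ^ 2 : ℕ) : ℝ) ≤ 2 ^ 12 * J * P ^ 2 / H ^ 2 := by
    intro m hm
    rw [le_div_iff₀ (by positivity)]
    push_cast
    calc (r m : ℝ) * (m : ℝ) ^ 2 * H ^ 2 = (r m * H ^ 2) * (m : ℝ) ^ 2 := by ring
      _ ≤ (1024 * J * (P / M) ^ 2) * (2 * M) ^ 2 :=
        mul_le_mul (hr m hm).2.1 (pow_le_pow_left₀ (by positivity) (hDm m hm).2 2) (by positivity) (by positivity)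
      _ = _ := by field_simp; norm_num
  have hYP : 2 ^ 12 * J * P ^ 2 / H ^ 2 ≤ P ^ 4 := by
    rw [div_le_iff₀ (by positivity)]
    calc 2 ^ 12 * J * P ^ 2 = (1024 * J) * (4 * P ^ 2) := by ring
      _ ≤ H ^ 2 * (P ^ 2 * P ^ 2) := by gcongr; nlinarith
      _ = _ := by ring
  have happ : ∀ m ∈ D, 1 ≤ r m * m ^ 2 ∧ ((r m * m ^ 2 : ℕ) : ℝ) ≤ 2 ^ 12 * J * P ^ 2 / H ^ 2 ∧
      ∃ c : ℤ, |((r m * m ^ 2 : ℕ) : ℝ) * α - c| ≤ 1024 * J / H ^ 2 := by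
    intro m hm
    refine ⟨Nat.mul_pos (hr m hm).1 (pow_pos (hDm m hm).1 2), hY m hm, b m, ?_⟩
    rw [le_div_iff₀ (by positivity)]
    push_cast
    exact (hr m hm).2.2
  have hfib : ∀ m ∈ D, ((D.filter (fun j => r j * j ^ 2 = r m * m ^ 2)).card : ℝ) ≤ κ := by
    intro m hm
    have h0 := (happ m hm).1
    refine le_trans ?_ (hdiv _ h0 ((hY m hm).trans hYP))
    refine Nat.cast_le.2 (Finset.card_le_card fun j hj => ?_)
    rw [Nat.mem_divisors]
    refine ⟨?_, by omega⟩
    rw [← (Finset.mem_filter.1 hj).2]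
    exact (dvd_pow_self j (by norm_num)).mul_left _
  have hC : 32 * κ * ((2 ^ 12 * J * P ^ 2 / H ^ 2) * (1024 * J / H ^ 2)) ≤ D.card := by
    rw [show 32 * κ * ((2 ^ 12 * J * P ^ 2 / H ^ 2) * (1024 * J / H ^ 2)) =
      2 ^ 27 * κ * J ^ 2 * P ^ 2 / H ^ 4 by field_simp; norm_num, div_le_iff₀ (by positivity)]
    have e1 : E * E ^ 3 ≤ (4 * J * (H * D.card)) * (4 * J * (H * M)) ^ 3 := by gcongr
    refine le_of_mul_le_mul_left (a := 2 ^ 8 * J ^ 4 * (M : ℝ) ^ 3) ?_ (by positivity)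
    calc 2 ^ 8 * J ^ 4 * (M : ℝ) ^ 3 * (2 ^ 27 * κ * J ^ 2 * P ^ 2)
        = 2 ^ 35 * κ * J ^ 6 * (P ^ 2 * (M : ℝ) ^ 3) := by ring
      _ ≤ κ * κ * κ ^ 6 * (P ^ 2 * (M : ℝ) ^ 3) := by gcongr; linarith
      _ = κ ^ 8 * (P ^ 2 * (M : ℝ) ^ 3) := by ring
      _ ≤ E ^ 4 := f1
      _ = E * E ^ 3 := by ring
      _ ≤ _ := e1
      _ = _ := by ring
  obtain ⟨q, a, hq1, hq2, hq3⟩ := exists_approx_of_index D (fun m => r m * m ^ 2) α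
    (1024 * J / H ^ 2) (2 ^ 12 * J * P ^ 2 / H ^ 2) κ (by positivity) hDne hκ0 happ hfib hC
  have hEE : E ^ 4 ≤ 16 * J ^ 2 * M * E ^ 2 * (H ^ 2 * D.card) := by
    calc E ^ 4 = E ^ 2 * (E * E) := by ring
      _ ≤ E ^ 2 * ((4 * J * (H * D.card)) * (4 * J * (H * M))) := by gcongr
      _ = _ := by ring
  obtain ⟨b1, b2⟩ := approx_of_scaled_approx α E H D.card (16 * J ^ 2 * M * E ^ 2) q a
    (32 * κ * (2 ^ 12 * J * P ^ 2)) (32 * κ * (1024 * J)) hH0 (by positivity) hEE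
    (hq2.trans (le_of_eq (by ring))) (hq3.trans (le_of_eq (by ring)))
  have hfin : 2 ^ 21 * κ * J ^ 3 ≤ κ ^ 5 := by
    calc 2 ^ 21 * κ * J ^ 3 ≤ κ * κ * κ ^ 3 := by gcongr; linarith
      _ = _ := by ring
  refine ⟨q, a, hq1, b1.trans ?_, b2.trans ?_⟩
  · calc _ = 2 ^ 21 * κ * J ^ 3 * P ^ 2 * (M * E ^ 2) := by ring
      _ ≤ κ ^ 5 * P ^ 2 * (κ ^ 4 * P ^ 2) := by gcongr
      _ = _ := by ring
  · calc _ = 2 ^ 19 * κ * J ^ 3 * (M * E ^ 2) := by ring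
      _ ≤ 2 ^ 21 * κ * J ^ 3 * (M * E ^ 2) := by gcongr <;> norm_num
      _ ≤ κ ^ 5 * (κ ^ 4 * P ^ 2) := by gcongr
      _ = _ := by ring

/-- Pairs of distinct elements in a common fibre, by Cauchy–Schwarz. -/
theorem card_sq_le_pairs (D : Finset ℕ) (r : ℕ → ℕ) (R : ℝ) (hr : ∀ m ∈ D, 1 ≤ r m ∧ (r m : ℝ) ≤ R)
    (hDne : D.Nonempty) :
    (D.card : ℝ) ^ 2 ≤ R * (D.card +
      2 * ((D ×ˢ D).filter (fun p => p.2 < p.1 ∧ r p.1 = r p.2)).card) := by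
  have h1 : D.card = ∑ v ∈ D.image r, (D.filter (fun m => r m = v)).card :=
    Finset.card_eq_sum_card_image r D
  have h2 : ((D.image r).card : ℝ) ≤ R := by
    obtain ⟨m0, hm0⟩ := hDne
    have hR : 0 ≤ R := le_trans (Nat.cast_nonneg _) (hr m0 hm0).2
    have : (D.image r).card ≤ ⌊R⌋₊ := by
      have h3 : D.image r ⊆ Finset.Icc 1 ⌊R⌋₊ := by
        intro v hv
        obtain ⟨m, hm, rfl⟩ := Finset.mem_image.1 hv
        exact Finset.mem_Icc.2 ⟨(hr m hm).1, Nat.le_floor (hr m hm).2⟩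
      simpa using Finset.card_le_card h3
    exact le_trans (by exact_mod_cast this) (Nat.floor_le hR)
  have h3 : ∑ v ∈ D.image r, (D.filter (fun m => r m = v)).card ^ 2 =
      ((D ×ˢ D).filter (fun p => r p.1 = r p.2)).card := by
    rw [Finset.card_eq_sum_card_fiberwise (f := fun p : ℕ × ℕ => r p.1) (t := D.image r)]
    · refine Finset.sum_congr rfl fun v _ => ?_
      rw [sq, ← Finset.card_product]
      congr 1
      ext p
      simp only [Finset.mem_product, Finset.mem_filter]
      constructor
      · rintro ⟨⟨h1, h2⟩, h3, h4⟩; exact ⟨⟨⟨h1, h3⟩, h2.trans h4.symm⟩, h2⟩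
      · rintro ⟨⟨⟨h1, h3⟩, h5⟩, h2⟩; exact ⟨⟨h1, h2⟩, h3, h5 ▸ h2⟩
    · intro p hp
      have := (Finset.mem_filter.1 hp).1
      exact Finset.mem_image_of_mem _ (Finset.mem_product.1 this).1
  have h4 : ((D ×ˢ D).filter (fun p => r p.1 = r p.2)).card ≤
      D.card + 2 * ((D ×ˢ D).filter (fun p => p.2 < p.1 ∧ r p.1 = r p.2)).card := by
    have hsub : (D ×ˢ D).filter (fun p => r p.1 = r p.2) ⊆
        D.image (fun m => (m, m)) ∪ ((D ×ˢ D).filter (fun p => p.2 < p.1 ∧ r p.1 = r p.2) ∪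
          ((D ×ˢ D).filter (fun p => p.2 < p.1 ∧ r p.1 = r p.2)).image Prod.swap) := by
      rintro ⟨x, z⟩ hp
      simp only [Finset.mem_filter, Finset.mem_product, Finset.mem_union, Finset.mem_image,
        Prod.mk.injEq, Prod.exists, Prod.swap_prod_mk] at hp ⊢
      rcases lt_trichotomy x z with h | h | h
      · exact Or.inr (Or.inr ⟨z, x, ⟨⟨hp.1.2, hp.1.1⟩, h, hp.2.symm⟩, rfl, rfl⟩)
      · exact Or.inl ⟨x, hp.1.1, rfl, h⟩
      · exact Or.inr (Or.inl ⟨hp.1, h, hp.2⟩)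
    refine (Finset.card_le_card hsub).trans ((Finset.card_union_le _ _).trans ?_)
    rw [two_mul]
    exact add_le_add Finset.card_image_le ((Finset.card_union_le _ _).trans
      (add_le_add le_rfl Finset.card_image_le))
  have h5 := sq_sum_le_card_mul_sum_sq (s := D.image r)
    (f := fun v => ((D.filter (fun m => r m = v)).card : ℝ))
  have h6 : ∑ v ∈ D.image r, ((D.filter (fun m => r m = v)).card : ℝ) = D.card := by
    rw [h1]; push_cast; rfl
  have h7 : ∑ v ∈ D.image r, ((D.filter (fun m => r m = v)).card : ℝ) ^ 2 ≤ D.card +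
      2 * ((D ×ˢ D).filter (fun p => p.2 < p.1 ∧ r p.1 = r p.2)).card := by
    have := (Nat.cast_le (α := ℝ)).2 (h3.le.trans h4)
    simpa only [Nat.cast_sum, Nat.cast_pow, Nat.cast_add, Nat.cast_mul, Nat.cast_ofNat] using this
  rw [h6] at h5
  have hR : 0 ≤ R := le_trans (Nat.cast_nonneg _) h2
  exact h5.trans ((mul_le_mul_of_nonneg_right h2 (Finset.sum_nonneg fun _ _ => sq_nonneg _)).trans
    (mul_le_mul_of_nonneg_left h7 hR))

set_option maxHeartbeats 800000 in
theorem typeI_large (α P κ E : ℝ) (J A B M : ℕ) (hM : 1 ≤ M) (hBP : (B : ℝ) ≤ P)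
    (hP : 4 ≤ P) (hJ : 0 < J) (hJκ : (J : ℝ) ≤ κ) (hPJ : P ^ 2 ≤ 2 ^ J) (hκ : 2 ^ 60 ≤ κ)
    (hdiv : ∀ k : ℕ, 1 ≤ k → (k : ℝ) ≤ P ^ 4 → (k.divisors.card : ℝ) ≤ κ)
    (hE : 1 ≤ E) (d1 : κ ^ 4 * (M * P) ≤ E ^ 2) (d2 : κ ^ 4 * P ^ 2 ≤ E ^ 2 * M)
    (d3 : κ ^ 12 * (P ^ 4 * (M : ℝ) ^ 2) ≤ E ^ 6)
    (hsum : E ≤ ∑ m ∈ Finset.Ico M (2 * M), ‖∑ n ∈ Finset.Icc 1 (B / M),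
      if A ≤ m * n ∧ m * n ≤ B then e (α * ((m : ℝ) * n) ^ 2) else 0‖) :
    ∃ q : ℕ, ∃ a : ℤ, 1 ≤ q ∧ q * E ^ 4 ≤ κ ^ 9 * P ^ 4 ∧ |q * α - a| * E ^ 4 ≤ κ ^ 9 * P ^ 2 := by
  obtain ⟨H, D, r, b, hH0, hDs, hDne, hED, hEM, hHJ, hr⟩ :=
    typeI_level α P κ E J A B M hM hBP hP hJ hJκ hPJ hκ hE d1 hsum
  have hM1 : (1 : ℝ) ≤ M := by exact_mod_cast hM
  have hM0 : (0 : ℝ) < M := by linarith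
  have hP0 : 0 < P := by linarith
  have hJ1 : (1 : ℝ) ≤ J := by exact_mod_cast hJ
  have hκ0 : 0 < κ := by linarith
  have hE0 : 0 < E := by linarith
  set R : ℝ := 1024 * J * (P / M) ^ 2 / H ^ 2 with hR
  have hR0 : 0 < R := by positivity
  have hDm : ∀ m ∈ D, 1 ≤ m ∧ (m : ℝ) ≤ 2 * M := by
    intro m hm
    have := Finset.mem_Ico.1 (hDs hm)
    exact ⟨by omega, by exact_mod_cast this.2.le⟩
  have hrR : ∀ m ∈ D, 1 ≤ r m ∧ (r m : ℝ) ≤ R := fun m hm =>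
    ⟨(hr m hm).1, by rw [hR, le_div_iff₀ (by positivity)]; exact (hr m hm).2.1⟩
  have hpairs := card_sq_le_pairs D r R hrR hDne
  set W := (D ×ˢ D).filter (fun p => p.2 < p.1 ∧ r p.1 = r p.2) with hW
  set K : ℝ := (D.card : ℝ) with hK
  have hK0 : 0 < K := by rw [hK]; exact_mod_cast hDne.card_pos
  have hKR : 2 * R ≤ K := by
    rw [hR, ← mul_div_assoc, div_le_iff₀ (by positivity)]
    refine le_of_mul_le_mul_left (a := 16 * J ^ 2 * (M : ℝ) ^ 2) ?_ (by positivity)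
    calc 16 * J ^ 2 * (M : ℝ) ^ 2 * (2 * (1024 * J * (P / M) ^ 2)) = 2 ^ 15 * J ^ 3 * P ^ 2 := by
          field_simp; norm_num
      _ ≤ κ * κ ^ 3 * P ^ 2 := by gcongr; linarith
      _ = κ ^ 4 * P ^ 2 := by ring
      _ ≤ E ^ 2 * M := d2
      _ = (E * E) * M := by ring
      _ ≤ ((4 * J * (H * K)) * (4 * J * (H * M))) * M := by gcongr
      _ = _ := by ring
  have hKW : K ^ 2 ≤ 4 * R * W.card := by nlinarith
  have hKW' : K ^ 2 * H ^ 2 * (M : ℝ) ^ 2 ≤ 2 ^ 12 * J * P ^ 2 * W.card := by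
    calc K ^ 2 * H ^ 2 * (M : ℝ) ^ 2 ≤ (4 * R * W.card) * H ^ 2 * (M : ℝ) ^ 2 := by gcongr
      _ = _ := by rw [hR]; field_simp; ring
  have hW0 : (0 : ℝ) < W.card := by
    rcases (Nat.cast_nonneg (α := ℝ) W.card).lt_or_eq with h | h
    · exact h
    · rw [← h] at hKW; nlinarith
  have hWne : W.Nonempty := by
    rw [← Finset.card_pos]; exact_mod_cast hW0
  have hWD : ∀ p ∈ W, p.1 ∈ D ∧ p.2 ∈ D ∧ p.2 < p.1 ∧ r p.1 = r p.2 := by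
    intro p hp
    rw [hW, Finset.mem_filter, Finset.mem_product] at hp
    exact ⟨hp.1.1, hp.1.2, hp.2⟩
  have hY : ∀ p ∈ W, ((r p.1 * (p.1 ^ 2 - p.2 ^ 2) : ℕ) : ℝ) ≤ 2 ^ 12 * J * P ^ 2 / H ^ 2 := by
    intro p hp
    obtain ⟨w1, w2, w3, w4⟩ := hWD p hp
    rw [le_div_iff₀ (by positivity)]
    have hs : ((p.1 ^ 2 - p.2 ^ 2 : ℕ) : ℝ) ≤ (2 * (M : ℝ)) ^ 2 := by
      calc ((p.1 ^ 2 - p.2 ^ 2 : ℕ) : ℝ) ≤ ((p.1 ^ 2 : ℕ) : ℝ) := by exact_mod_cast Nat.sub_le _ _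
        _ = (p.1 : ℝ) ^ 2 := by push_cast; rfl
        _ ≤ _ := by gcongr; exact (hDm _ w1).2
    rw [Nat.cast_mul]
    calc (r p.1 : ℝ) * ((p.1 ^ 2 - p.2 ^ 2 : ℕ) : ℝ) * H ^ 2
        = (r p.1 * H ^ 2) * ((p.1 ^ 2 - p.2 ^ 2 : ℕ) : ℝ) := by ring
      _ ≤ (1024 * J * (P / M) ^ 2) * (2 * M) ^ 2 :=
        mul_le_mul (hr _ w1).2.1 hs (Nat.cast_nonneg _) (by positivity)
      _ = _ := by field_simp; norm_num
  have hYP : 2 ^ 12 * J * P ^ 2 / H ^ 2 ≤ P ^ 4 := by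
    rw [div_le_iff₀ (by positivity)]
    calc 2 ^ 12 * J * P ^ 2 = (1024 * J) * (4 * P ^ 2) := by ring
      _ ≤ H ^ 2 * (P ^ 2 * P ^ 2) := by gcongr; nlinarith
      _ = _ := by ring
  have hpos : ∀ p ∈ W, 1 ≤ r p.1 * (p.1 ^ 2 - p.2 ^ 2) := by
    intro p hp
    obtain ⟨w1, w2, w3, w4⟩ := hWD p hp
    have := Nat.pow_lt_pow_left w3 (n := 2) (by norm_num)
    exact Nat.mul_pos (hr _ w1).1 (by omega)
  have happ : ∀ p ∈ W, 1 ≤ r p.1 * (p.1 ^ 2 - p.2 ^ 2) ∧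
      ((r p.1 * (p.1 ^ 2 - p.2 ^ 2) : ℕ) : ℝ) ≤ 2 ^ 12 * J * P ^ 2 / H ^ 2 ∧
      ∃ c : ℤ, |((r p.1 * (p.1 ^ 2 - p.2 ^ 2) : ℕ) : ℝ) * α - c| ≤ 2 ^ 11 * J / H ^ 2 := by
    intro p hp
    obtain ⟨w1, w2, w3, w4⟩ := hWD p hp
    refine ⟨hpos p hp, hY p hp, b p.1 - b p.2, ?_⟩
    have hsub : ((p.1 ^ 2 - p.2 ^ 2 : ℕ) : ℝ) = (p.1 : ℝ) ^ 2 - (p.2 : ℝ) ^ 2 := by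
      rw [Nat.cast_sub (Nat.pow_le_pow_left w3.le 2)]; push_cast; ring
    have t1 := (hr _ w1).2.2
    have t2 := (hr _ w2).2.2
    rw [← w4] at t2
    rw [le_div_iff₀ (by positivity), Nat.cast_mul, hsub, show (r p.1 : ℝ) * ((p.1 : ℝ) ^ 2 -
      (p.2 : ℝ) ^ 2) * α - ((b p.1 - b p.2 : ℤ) : ℝ) = (r p.1 * (p.1 : ℝ) ^ 2 * α - b p.1) -
      (r p.1 * (p.2 : ℝ) ^ 2 * α - b p.2) by push_cast; ring]
    calc _ ≤ (|r p.1 * (p.1 : ℝ) ^ 2 * α - b p.1| + |r p.1 * (p.2 : ℝ) ^ 2 * α - b p.2|) * H ^ 2 := by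
          gcongr; exact abs_sub _ _
      _ ≤ _ := by linarith
  have hfib : ∀ p ∈ W, ((W.filter (fun j => r j.1 * (j.1 ^ 2 - j.2 ^ 2) =
      r p.1 * (p.1 ^ 2 - p.2 ^ 2))).card : ℝ) ≤ κ ^ 2 := by
    intro p hp
    have h1 := card_sq_sub_sq_le
      (W.filter (fun j => r j.1 * (j.1 ^ 2 - j.2 ^ 2) = r p.1 * (p.1 ^ 2 - p.2 ^ 2)))
      (r p.1 * (p.1 ^ 2 - p.2 ^ 2)) (by have := hpos p hp; omega) (by
        intro j hj
        obtain ⟨hj1, hj2⟩ := Finset.mem_filter.1 hj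
        exact ⟨(hWD j hj1).2.2.1, hj2 ▸ Dvd.intro_left _ rfl⟩)
    have h2 := hdiv _ (hpos p hp) ((hY p hp).trans hYP)
    calc _ ≤ (((r p.1 * (p.1 ^ 2 - p.2 ^ 2)).divisors.card : ℝ)) ^ 2 := by exact_mod_cast h1
      _ ≤ _ := by gcongr
  have hC : 32 * κ ^ 2 * ((2 ^ 12 * J * P ^ 2 / H ^ 2) * (2 ^ 11 * J / H ^ 2)) ≤ W.card := by
    rw [show 32 * κ ^ 2 * ((2 ^ 12 * J * P ^ 2 / H ^ 2) * (2 ^ 11 * J / H ^ 2)) =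
      2 ^ 28 * κ ^ 2 * J ^ 2 * P ^ 2 / H ^ 4 by field_simp; norm_num, div_le_iff₀ (by positivity)]
    refine le_of_mul_le_mul_left (a := 2 ^ 12 * J * P ^ 2 * (2 ^ 12 * J ^ 6 * (M : ℝ) ^ 2)) ?_
      (by positivity)
    calc 2 ^ 12 * J * P ^ 2 * (2 ^ 12 * J ^ 6 * (M : ℝ) ^ 2) * (2 ^ 28 * κ ^ 2 * J ^ 2 * P ^ 2)
        = 2 ^ 52 * κ ^ 2 * J ^ 9 * (P ^ 4 * (M : ℝ) ^ 2) := by ring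
      _ ≤ κ * κ ^ 2 * κ ^ 9 * (P ^ 4 * (M : ℝ) ^ 2) := by gcongr; linarith
      _ = κ ^ 12 * (P ^ 4 * (M : ℝ) ^ 2) := by ring
      _ ≤ E ^ 6 := d3
      _ = E ^ 2 * E ^ 4 := by ring
      _ ≤ (4 * J * (H * K)) ^ 2 * (4 * J * (H * M)) ^ 4 := by gcongr
      _ = (2 ^ 12 * J ^ 6 * (M : ℝ) ^ 2) * H ^ 4 * (K ^ 2 * H ^ 2 * (M : ℝ) ^ 2) := by ring
      _ ≤ (2 ^ 12 * J ^ 6 * (M : ℝ) ^ 2) * H ^ 4 * (2 ^ 12 * J * P ^ 2 * W.card) := by gcongr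
      _ = _ := by ring
  obtain ⟨q, a, hq1, hq2, hq3⟩ := exists_approx_of_index W (fun p => r p.1 * (p.1 ^ 2 - p.2 ^ 2)) α
    (2 ^ 11 * J / H ^ 2) (2 ^ 12 * J * P ^ 2 / H ^ 2) (κ ^ 2) (by positivity) hWne (by positivity)
    happ hfib hC
  have hEE : E ^ 4 ≤ 2 ^ 20 * J ^ 5 * P ^ 2 * (H ^ 2 * W.card) := by
    calc E ^ 4 = E ^ 2 * E ^ 2 := by ring
      _ ≤ (4 * J * (H * K)) ^ 2 * (4 * J * (H * M)) ^ 2 := by gcongr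
      _ = 2 ^ 8 * J ^ 4 * H ^ 2 * (K ^ 2 * H ^ 2 * (M : ℝ) ^ 2) := by ring
      _ ≤ 2 ^ 8 * J ^ 4 * H ^ 2 * (2 ^ 12 * J * P ^ 2 * W.card) := by gcongr
      _ = _ := by ring
  obtain ⟨b1, b2⟩ := approx_of_scaled_approx α E H W.card (2 ^ 20 * J ^ 5 * P ^ 2) q a
    (32 * κ ^ 2 * (2 ^ 12 * J * P ^ 2)) (32 * κ ^ 2 * (2 ^ 11 * J)) hH0 (by positivity) hEE
    (hq2.trans (le_of_eq (by ring))) (hq3.trans (le_of_eq (by ring)))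
  have hfin : 2 ^ 37 * κ ^ 2 * J ^ 6 ≤ κ ^ 9 := by
    calc 2 ^ 37 * κ ^ 2 * J ^ 6 ≤ κ * κ ^ 2 * κ ^ 6 := by gcongr; linarith
      _ = _ := by ring
  refine ⟨q, a, hq1, b1.trans ?_, b2.trans ?_⟩
  · calc _ = 2 ^ 37 * κ ^ 2 * J ^ 6 * P ^ 4 := by ring
      _ ≤ _ := by gcongr
  · calc _ = 2 ^ 36 * κ ^ 2 * J ^ 6 * P ^ 2 := by ring
      _ ≤ 2 ^ 37 * κ ^ 2 * J ^ 6 * P ^ 2 := by gcongr <;> norm_num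
      _ ≤ _ := by gcongr

/-- Parameters for the exponential sum over `A ≤ m ≤ B ≤ t ^ 7` at a point `α` that has no
rational approximation of quality corresponding to the level `E`. -/
structure MinorRegime (α t κ E : ℝ) (J A B : ℕ) : Prop where
  two_le : 2 ≤ t
  J_pos : 0 < J
  J_le : (J : ℝ) ≤ κ
  le_two_pow : (t ^ 7) ^ 2 ≤ 2 ^ J
  le_κ : 2 ^ 60 ≤ κ
  divisors_le : ∀ k : ℕ, 1 ≤ k → (k : ℝ) ≤ (t ^ 7) ^ 4 → (k.divisors.card : ℝ) ≤ κ
  le_A : t ^ 7 ≤ κ * A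
  B_le : (B : ℝ) ≤ t ^ 7
  le_E : κ ^ 4 * t ^ 6 ≤ E
  no_approx : ¬ ∃ q : ℕ, ∃ a : ℤ, 1 ≤ q ∧ q * E ^ 4 ≤ κ ^ 9 * (t ^ 7) ^ 4 ∧
    |q * α - a| * E ^ 4 ≤ κ ^ 9 * (t ^ 7) ^ 2

theorem sum_antidiagonal_eq (F x y : ℕ → ℂ) (A B : ℕ) :
    ∑ m ∈ Finset.Icc A B, (∑ p ∈ m.divisorsAntidiagonal, x p.1 * y p.2) * F m =
      ∑ d ∈ Finset.Icc 1 B, x d * ∑ n ∈ Finset.Icc 1 B,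
        if A ≤ d * n ∧ d * n ≤ B then y n * F (d * n) else 0 := by
  simp_rw [Finset.mul_sum, ← Finset.sum_product', Finset.sum_mul]
  rw [Finset.sum_sigma']
  simp_rw [mul_ite, mul_zero]
  rw [← Finset.sum_filter]
  refine Finset.sum_bij' (fun s _ => s.2) (fun p _ => ⟨p.1 * p.2, p⟩) ?_ ?_ ?_ ?_ ?_
  · rintro ⟨m, d, n⟩ h
    simp only [Finset.mem_sigma, Finset.mem_Icc, Nat.mem_divisorsAntidiagonal] at h
    obtain ⟨⟨h1, h2⟩, rfl, h4⟩ := h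
    simp only [Finset.mem_filter, Finset.mem_product, Finset.mem_Icc]
    have hd : 0 < d := Nat.pos_of_ne_zero (by rintro rfl; simp at h4)
    have hn : 0 < n := Nat.pos_of_ne_zero (by rintro rfl; simp at h4)
    exact ⟨⟨⟨hd, (Nat.le_mul_of_pos_right d hn).trans h2⟩,
      ⟨hn, (Nat.le_mul_of_pos_left n hd).trans h2⟩⟩, h1, h2⟩
  · rintro ⟨d, n⟩ h
    simp only [Finset.mem_filter, Finset.mem_product, Finset.mem_Icc] at h
    simp only [Finset.mem_sigma, Finset.mem_Icc, Nat.mem_divisorsAntidiagonal]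
    exact ⟨h.2, trivial, (Nat.mul_pos h.1.1.1 h.1.2.1).ne'⟩
  · rintro ⟨m, d, n⟩ h
    simp only [Finset.mem_sigma, Finset.mem_Icc, Nat.mem_divisorsAntidiagonal] at h
    obtain ⟨_, rfl, _⟩ := h
    rfl
  · rintro ⟨d, n⟩ _; rfl
  · rintro ⟨m, d, n⟩ h
    simp only [Finset.mem_sigma, Nat.mem_divisorsAntidiagonal] at h
    obtain ⟨_, rfl, _⟩ := h
    simp only; ring

theorem bilinear_le_of_blocks (F x y : ℕ → ℂ) (A B J : ℕ) (E L₁ L₂ : ℝ) (hB : B < 2 ^ J)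
    (hE : 0 ≤ E) (hx : ∀ d, ‖x d‖ ≤ 1) (hsupp : ∀ d, x d ≠ 0 → L₁ ≤ d ∧ (d : ℝ) ≤ L₂)
    (hblock : ∀ M : ℕ, 1 ≤ M → L₁ < 2 * M → (M : ℝ) ≤ L₂ →
      ∑ m ∈ Finset.Ico M (2 * M), ‖∑ n ∈ Finset.Icc 1 (B / M),
        if A ≤ m * n ∧ m * n ≤ B then y n * F (m * n) else 0‖ ≤ E) :
    ‖∑ m ∈ Finset.Icc A B, (∑ p ∈ m.divisorsAntidiagonal, x p.1 * y p.2) * F m‖ ≤ J * E := by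
  rw [sum_antidiagonal_eq F x y A B]
  set g : ℕ → ℂ := fun d => x d * ∑ n ∈ Finset.Icc 1 B,
        if A ≤ d * n ∧ d * n ≤ B then y n * F (d * n) else 0 with hg
  have hsub : ∀ d M : ℕ, 1 ≤ M → M ≤ d → ∑ n ∈ Finset.Icc 1 B,
        (if A ≤ d * n ∧ d * n ≤ B then y n * F (d * n) else 0) = ∑ n ∈ Finset.Icc 1 (B / M),
        (if A ≤ d * n ∧ d * n ≤ B then y n * F (d * n) else 0) := by
    intro d M hM hMd
    symm
    refine Finset.sum_subset (Finset.Icc_subset_Icc_right (Nat.div_le_self _ _)) ?_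
    intro n hn hn'
    rw [if_neg]
    rintro ⟨_, h2⟩
    apply hn'
    rw [Finset.mem_Icc] at hn ⊢
    refine ⟨hn.1, (Nat.le_div_iff_mul_le (by omega)).2 ?_⟩
    calc n * M ≤ n * d := Nat.mul_le_mul_left _ hMd
      _ = d * n := mul_comm _ _
      _ ≤ B := h2
  have hb : ∀ j, ∑ d ∈ Finset.Ico (2 ^ j) (2 * 2 ^ j), ‖g d‖ ≤ E := by
    intro j
    by_cases hrel : L₁ < 2 * ((2 ^ j : ℕ) : ℝ) ∧ ((2 ^ j : ℕ) : ℝ) ≤ L₂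
    · refine le_trans (Finset.sum_le_sum fun d hd => ?_)
        (hblock (2 ^ j) Nat.one_le_two_pow hrel.1 hrel.2)
      rw [hg, ← hsub d (2 ^ j) Nat.one_le_two_pow (Finset.mem_Ico.1 hd).1, norm_mul]
      exact mul_le_of_le_one_left (norm_nonneg _) (hx d)
    · refine le_trans (le_of_eq (Finset.sum_eq_zero fun d hd => ?_)) hE
      have hd' := Finset.mem_Ico.1 hd
      have h0 : x d = 0 := by
        by_contra h0
        obtain ⟨h1, h2⟩ := hsupp d h0
        have e1 : ((2 ^ j : ℕ) : ℝ) ≤ d := by exact_mod_cast hd'.1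
        have e2 : (d : ℝ) < 2 * ((2 ^ j : ℕ) : ℝ) := by exact_mod_cast hd'.2
        exact hrel ⟨by linarith, by linarith⟩
      simp [hg, h0]
  have hmaps : ∀ d ∈ Finset.Icc 1 B, Nat.log 2 d ∈ Finset.range J := by
    intro d hd
    rw [Finset.mem_Icc] at hd
    rw [Finset.mem_range]
    exact Nat.log_lt_of_lt_pow (by omega) (by omega)
  have hsubset : ∀ j, (Finset.Icc 1 B).filter (fun d => Nat.log 2 d = j) ⊆
      Finset.Ico (2 ^ j) (2 * 2 ^ j) := by
    intro j d hd
    obtain ⟨hd1, rfl⟩ := Finset.mem_filter.1 hd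
    rw [Finset.mem_Icc] at hd1
    rw [Finset.mem_Ico]
    refine ⟨Nat.pow_log_le_self 2 (by omega), ?_⟩
    have := Nat.lt_pow_succ_log_self (b := 2) (by norm_num) d
    rw [pow_succ] at this; omega
  calc ‖∑ d ∈ Finset.Icc 1 B, g d‖ ≤ ∑ d ∈ Finset.Icc 1 B, ‖g d‖ := norm_sum_le _ _
    _ = ∑ j ∈ Finset.range J, ∑ d ∈ (Finset.Icc 1 B).filter (fun d => Nat.log 2 d = j), ‖g d‖ :=
      (Finset.sum_fiberwise_of_maps_to hmaps _).symm
    _ ≤ ∑ j ∈ Finset.range J, ∑ d ∈ Finset.Ico (2 ^ j) (2 * 2 ^ j), ‖g d‖ :=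
      Finset.sum_le_sum fun j _ =>
        Finset.sum_le_sum_of_subset_of_nonneg (hsubset j) fun _ _ _ => norm_nonneg _
    _ ≤ ∑ j ∈ Finset.range J, E := Finset.sum_le_sum fun j _ => hb j
    _ = J * E := by simp

namespace MinorRegime

variable {α t κ E : ℝ} {J A B : ℕ}

theorem B_lt (h : MinorRegime α t κ E J A B) : B < 2 ^ J := by
  have h1 : (2 : ℝ) ≤ t ^ 7 := by
    calc (2 : ℝ) ≤ t := h.two_le
      _ ≤ t ^ 7 := le_self_pow₀ (by linarith [h.two_le]) (by norm_num)
  have h2 := h.B_le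
  have h3 := h.le_two_pow
  have : (B : ℝ) < 2 ^ J := by nlinarith
  exact_mod_cast this

theorem one_le_E (h : MinorRegime α t κ E J A B) : 1 ≤ E := by
  refine le_trans ?_ h.le_E
  have h1 : (1 : ℝ) ≤ t := by linarith [h.two_le]
  have h2 : (1 : ℝ) ≤ κ := by linarith [h.le_κ]
  exact one_le_mul_of_one_le_of_one_le (one_le_pow₀ h2) (one_le_pow₀ h1)

theorem four_le (h : MinorRegime α t κ E J A B) : 4 ≤ t ^ 7 := by
  calc (4 : ℝ) ≤ 2 ^ 7 := by norm_num
    _ ≤ t ^ 7 := pow_le_pow_left₀ (by norm_num) h.two_le 7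

theorem typeI (h : MinorRegime α t κ E J A B) (x : ℕ → ℂ) (hx : ∀ d, ‖x d‖ ≤ 1)
    (hsupp : ∀ d : ℕ, x d ≠ 0 → (d : ℝ) ≤ t ^ 4) :
    ‖∑ m ∈ Finset.Icc A B, (∑ p ∈ m.divisorsAntidiagonal, x p.1) * e (α * (m : ℝ) ^ 2)‖ ≤ J * E := by
  have ht1 : (1 : ℝ) ≤ t := by linarith [h.two_le]
  have hκ1 : (1 : ℝ) ≤ κ := by linarith [h.le_κ]
  have ht0 : 0 < t := by linarith
  have hκ0 : 0 < κ := by linarith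
  have hE := h.le_E
  have hE1 := h.one_le_E
  have hE0 : 0 < E := by linarith
  have := bilinear_le_of_blocks (fun m => e (α * (m : ℝ) ^ 2)) x (fun _ => 1) A B J E 0 (t ^ 4)
    h.B_lt hE0.le hx (fun d hd => ⟨Nat.cast_nonneg _, hsupp d hd⟩) ?_
  · simpa using this
  intro M hM _ hMt
  by_contra! hlt
  simp only [one_mul, Nat.cast_mul] at hlt
  have hM1 : (1 : ℝ) ≤ M := by exact_mod_cast hM
  have hM0 : (0 : ℝ) < M := by linarith
  apply h.no_approx
  have d1 : κ ^ 4 * (M * t ^ 7) ≤ E ^ 2 := by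
    calc κ ^ 4 * (M * t ^ 7) ≤ κ ^ 8 * (t ^ 5 * t ^ 7) := by
          gcongr
          · norm_num
          · exact hMt.trans (pow_le_pow_right₀ ht1 (by norm_num))
      _ = (κ ^ 4 * t ^ 6) ^ 2 := by ring
      _ ≤ _ := by gcongr
  rcases le_total (M * E ^ 2) (κ ^ 4 * (t ^ 7) ^ 2) with hc | hc
  · refine typeI_small α (t ^ 7) κ E J A B M hM h.B_le h.four_le h.J_pos h.J_le h.le_two_pow h.le_κ
      h.divisors_le hE1 d1 ?_ hc hlt.le
    refine le_of_mul_le_mul_left (a := E ^ 6) ?_ (by positivity)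
    calc E ^ 6 * (κ ^ 8 * ((t ^ 7) ^ 2 * (M : ℝ) ^ 3)) = κ ^ 8 * (t ^ 7) ^ 2 * (M * E ^ 2) ^ 3 := by ring
      _ ≤ κ ^ 8 * (t ^ 7) ^ 2 * (κ ^ 4 * (t ^ 7) ^ 2) ^ 3 := by gcongr
      _ = κ ^ 20 * t ^ 56 := by ring
      _ ≤ κ ^ 40 * t ^ 60 := by gcongr <;> norm_num
      _ = (κ ^ 4 * t ^ 6) ^ 10 := by ring
      _ ≤ E ^ 10 := by gcongr
      _ = _ := by ring
  · refine typeI_large α (t ^ 7) κ E J A B M hM h.B_le h.four_le h.J_pos h.J_le h.le_two_pow h.le_κ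
      h.divisors_le hE1 d1 (by linarith) ?_ hlt.le
    calc κ ^ 12 * ((t ^ 7) ^ 4 * (M : ℝ) ^ 2) ≤ κ ^ 24 * ((t ^ 7) ^ 4 * (t ^ 4) ^ 2) := by
          gcongr; norm_num
      _ = (κ ^ 4 * t ^ 6) ^ 6 := by ring
      _ ≤ E ^ 6 := by gcongr

theorem typeII (h : MinorRegime α t κ E J A B) (x y : ℕ → ℂ) (hx : ∀ d, ‖x d‖ ≤ 1)
    (hy : ∀ d, ‖y d‖ ≤ 1) (hsupp : ∀ d : ℕ, x d ≠ 0 → t ^ 4 ≤ κ * d ∧ (d : ℝ) ≤ t ^ 5) :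
    ‖∑ m ∈ Finset.Icc A B, (∑ p ∈ m.divisorsAntidiagonal, x p.1 * y p.2) * e (α * (m : ℝ) ^ 2)‖ ≤
      J * E := by
  have ht1 : (1 : ℝ) ≤ t := by linarith [h.two_le]
  have hκ2 := h.le_κ
  have hκ1 : (1 : ℝ) ≤ κ := by linarith [h.le_κ]
  have ht0 : 0 < t := by linarith
  have hκ0 : 0 < κ := by linarith
  have hE := h.le_E
  have hE1 := h.one_le_E
  have hE0 : 0 < E := by linarith
  refine bilinear_le_of_blocks (fun m => e (α * (m : ℝ) ^ 2)) x y A B J E (t ^ 4 / κ) (t ^ 5)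
    h.B_lt hE0.le hx (fun d hd => ⟨?_, (hsupp d hd).2⟩) ?_
  · rw [div_le_iff₀ hκ0, mul_comm]; exact (hsupp d hd).1
  intro M hM hMl hMt
  by_contra! hlt
  simp only [Nat.cast_mul] at hlt
  have hM1 : (1 : ℝ) ≤ M := by exact_mod_cast hM
  have hM0 : (0 : ℝ) < M := by linarith
  rw [div_lt_iff₀ hκ0] at hMl
  apply h.no_approx
  obtain ⟨q, a, h1, h2, h3⟩ := typeII_block α (t ^ 7) κ E J A B M y hM h.B_le h.four_le h.J_pos h.J_le
    h.le_two_pow h.le_κ h.divisors_le hy hE0 (by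
      calc 2 * t ^ 7 * M ≤ κ ^ 8 * t ^ 7 * t ^ 5 := by
            gcongr
            calc (2 : ℝ) ≤ κ := by linarith
              _ ≤ κ ^ 8 := le_self_pow₀ hκ1 (by norm_num)
        _ = (κ ^ 4 * t ^ 6) ^ 2 := by ring
        _ ≤ _ := by gcongr) (by
      calc κ ^ 5 * (t ^ 7) ^ 4 = κ ^ 5 * t ^ 24 * t ^ 4 := by ring
        _ ≤ κ ^ 5 * t ^ 24 * (2 * M * κ) := by gcongr
        _ = 2 * κ ^ 6 * t ^ 24 * M := by ring
        _ ≤ κ * κ ^ 15 * t ^ 24 * M := by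
          gcongr <;> [linarith; norm_num]
        _ = (κ ^ 4 * t ^ 6) ^ 4 * M := by ring
        _ ≤ _ := by gcongr) hlt.le
  have hk : κ ^ 6 ≤ κ ^ 9 := pow_le_pow_right₀ hκ1 (by norm_num)
  exact ⟨q, a, h1, h2.trans (by gcongr), h3.trans (by gcongr)⟩

end MinorRegime

/-- Complex-valued version of `psi` with natural threshold. -/
def psiN (n s : ℕ) : ℂ := if ∀ p : ℕ, p.Prime → p ∣ n → s ≤ p then 1 else 0

theorem psiN_add_sum (n s : ℕ) (hn : n ≠ 0) :
    psiN n s + ∑ p ∈ n.primeFactors.filter (fun p => p < s), psiN (n / p) p = 1 := by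
  by_cases h : ∀ p : ℕ, p.Prime → p ∣ n → s ≤ p
  · rw [psiN, if_pos h, Finset.sum_eq_zero, add_zero]
    intro p hp
    simp only [Finset.mem_filter, Nat.mem_primeFactors] at hp
    have := h p hp.1.1 hp.1.2.1
    omega
  · rw [psiN, if_neg h, zero_add]
    push Not at h
    obtain ⟨p, hp, hpn, hps⟩ := h
    have hn1 : n ≠ 1 := fun h => hp.one_lt.ne' (Nat.dvd_one.1 (h ▸ hpn))
    have hm := Nat.minFac_prime hn1
    rw [Finset.sum_eq_single n.minFac]
    · rw [psiN, if_pos]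
      intro r hr hrn
      exact Nat.minFac_le_of_dvd hr.two_le (hrn.trans (Nat.div_dvd_of_dvd (Nat.minFac_dvd n)))
    · intro r hr hrm
      simp only [Finset.mem_filter, Nat.mem_primeFactors] at hr
      rw [psiN, if_neg]
      intro hall
      have h1 : n.minFac ∣ n / r := by
        have : n.minFac ∣ n / r * r := by
          rw [Nat.div_mul_cancel hr.1.2.1]; exact Nat.minFac_dvd n
        rcases hm.dvd_mul.1 this with h | h
        · exact h
        · exact absurd ((Nat.prime_dvd_prime_iff_eq hm hr.1.1).1 h).symm hrm
      have h2 := hall _ hm h1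
      have h3 := Nat.minFac_le_of_dvd hr.1.1.two_le hr.1.2.1
      omega
    · intro hnot
      exfalso
      apply hnot
      simp only [Finset.mem_filter, Nat.mem_primeFactors]
      exact ⟨⟨hm, Nat.minFac_dvd n, hn⟩, (Nat.minFac_le_of_dvd hp.two_le hpn).trans_lt hps⟩

theorem psiN_buchstab (n w s : ℕ) (hn : n ≠ 0) (hws : w ≤ s) :
    psiN n s = psiN n w -
      ∑ p ∈ n.primeFactors.filter (fun p => w ≤ p ∧ p < s), psiN (n / p) p := by
  have h1 := psiN_add_sum n s hn
  have h2 := psiN_add_sum n w hn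
  have h3 : n.primeFactors.filter (fun p => p < s) =
      n.primeFactors.filter (fun p => p < w) ∪ n.primeFactors.filter (fun p => w ≤ p ∧ p < s) := by
    ext p
    simp only [Finset.mem_union, Finset.mem_filter]
    constructor
    · rintro ⟨h1, h2⟩
      rcases lt_or_ge p w with h | h
      · exact Or.inl ⟨h1, h⟩
      · exact Or.inr ⟨h1, h, h2⟩
    · rintro (⟨h1, h2⟩ | ⟨h1, h2, h3⟩)
      · exact ⟨h1, by omega⟩
      · exact ⟨h1, h3⟩
  rw [h3, Finset.sum_union] at h1
  · linear_combination h1 - h2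
  · rw [Finset.disjoint_left]
    intro p hp hp'
    simp only [Finset.mem_filter] at hp hp'
    omega

/-- Squarefree divisors of `n` all of whose prime factors are below `w`. -/
def smoothDivisors (n w : ℕ) : Finset ℕ :=
  n.divisors.filter (fun k => Squarefree k ∧ ∀ p : ℕ, p.Prime → p ∣ k → p < w)

theorem mem_smoothDivisors {n w k : ℕ} : k ∈ smoothDivisors n w ↔
    (k ∣ n ∧ n ≠ 0) ∧ Squarefree k ∧ ∀ p : ℕ, p.Prime → p ∣ k → p < w := by
  rw [smoothDivisors, Finset.mem_filter, Nat.mem_divisors]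

theorem psiN_eq_truncated (n w : ℕ) (T : ℝ) (hn : n ≠ 0) (hT : 1 ≤ T) :
    psiN n w = ∑ k ∈ (smoothDivisors n w).filter (fun k : ℕ => (k : ℝ) ≤ T),
        ((ArithmeticFunction.moebius k : ℤ) : ℂ) +
      ∑ a ∈ (smoothDivisors n w).filter
          (fun a : ℕ => T < (a : ℝ) ∧ ((a / a.minFac : ℕ) : ℝ) ≤ T),
        ((ArithmeticFunction.moebius a : ℤ) : ℂ) * psiN (n / a) a.minFac := by
  set K := smoothDivisors n w with hK
  set lp : ℕ → ℕ := fun k => if k = 1 then w else k.minFac with hlp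
  set f : ℕ → ℂ := fun k => ((ArithmeticFunction.moebius k : ℤ) : ℂ) * psiN (n / k) (lp k) with hf
  have h1K : 1 ∈ K := by
    rw [hK, mem_smoothDivisors]
    refine ⟨⟨one_dvd _, hn⟩, squarefree_one, fun p hp h => absurd (Nat.dvd_one.1 h) hp.one_lt.ne'⟩
  have hlp_le : ∀ k p : ℕ, p.Prime → p < lp k → ∀ r : ℕ, r.Prime → r ∣ k → p < r := by
    intro k p hp hpk r hr hrk
    have hk1 : k ≠ 1 := fun h => hr.one_lt.ne' (Nat.dvd_one.1 (h ▸ hrk))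
    rw [hlp] at hpk
    simp only [hk1, if_false] at hpk
    exact hpk.trans_le (Nat.minFac_le_of_dvd hr.two_le hrk)
  have hlp_mul : ∀ k p : ℕ, p.Prime → p < lp k → (k * p).minFac = p := by
    intro k p hp hpk
    refine le_antisymm (Nat.minFac_le_of_dvd hp.two_le (Dvd.intro_left _ rfl)) ?_
    have hne : k * p ≠ 1 := fun h => hp.one_lt.ne' (Nat.eq_one_of_mul_eq_one_left h)
    have hm := Nat.minFac_prime hne
    rcases hm.dvd_mul.1 (Nat.minFac_dvd (k * p)) with h | h
    · exact (hlp_le k p hp hpk _ hm h).le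
    · exact ((Nat.prime_dvd_prime_iff_eq hm hp).1 h).ge
  have hcop : ∀ k p : ℕ, p.Prime → p < lp k → Nat.Coprime k p := by
    intro k p hp hpk
    rw [Nat.coprime_comm, Nat.Prime.coprime_iff_not_dvd hp]
    intro h
    exact lt_irrefl _ (hlp_le k p hp hpk p hp h)
  have hstep : ∀ k ∈ K, f k = ((ArithmeticFunction.moebius k : ℤ) : ℂ) +
      ∑ p ∈ (n / k).primeFactors.filter (fun p => p < lp k), f (k * p) := by
    intro k hk
    rw [hK, mem_smoothDivisors] at hk
    obtain ⟨⟨hkn, _⟩, hsq, hsm⟩ := hk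
    have hnk : n / k ≠ 0 := (Nat.div_pos (Nat.le_of_dvd (Nat.pos_of_ne_zero hn) hkn)
      (Nat.pos_of_dvd_of_pos hkn (Nat.pos_of_ne_zero hn))).ne'
    have hb := psiN_add_sum (n / k) (lp k) hnk
    have hsum : ∑ p ∈ (n / k).primeFactors.filter (fun p => p < lp k), f (k * p) =
        - (((ArithmeticFunction.moebius k : ℤ) : ℂ) *
          ∑ p ∈ (n / k).primeFactors.filter (fun p => p < lp k), psiN (n / k / p) p) := by
      rw [Finset.mul_sum, ← Finset.sum_neg_distrib]
      refine Finset.sum_congr rfl fun p hp => ?_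
      simp only [Finset.mem_filter, Nat.mem_primeFactors] at hp
      have hpp := hp.1.1
      have hne : k * p ≠ 1 := fun h => hpp.one_lt.ne' (Nat.eq_one_of_mul_eq_one_left h)
      have hmu : ArithmeticFunction.moebius (k * p) = - ArithmeticFunction.moebius k := by
        rw [ArithmeticFunction.isMultiplicative_moebius.map_mul_of_coprime (hcop k p hpp hp.2),
          ArithmeticFunction.moebius_apply_prime hpp]; ring
      have hl : lp (k * p) = p := by
        rw [hlp]; simp only [hne, if_false]; exact hlp_mul k p hpp hp.2
      simp only [hf]
      rw [hmu, hl, Nat.div_div_eq_div_mul]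
      push_cast; ring
    rw [hsum]
    simp only [hf]
    linear_combination ((ArithmeticFunction.moebius k : ℤ) : ℂ) * hb
  have hdouble : ∑ k ∈ K.filter (fun k : ℕ => (k : ℝ) ≤ T),
      ∑ p ∈ (n / k).primeFactors.filter (fun p => p < lp k), f (k * p) =
      ∑ a ∈ K.filter (fun a : ℕ => a ≠ 1 ∧ ((a / a.minFac : ℕ) : ℝ) ≤ T), f a := by
    rw [Finset.sum_sigma']
    refine Finset.sum_bij' (fun s _ => s.1 * s.2) (fun a _ => ⟨a / a.minFac, a.minFac⟩) ?_ ?_ ?_ ?_ ?_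
    · rintro ⟨k, p⟩ h
      simp only [Finset.mem_sigma, Finset.mem_filter, Nat.mem_primeFactors] at h
      obtain ⟨⟨hk, hkT⟩, ⟨hp, hpn, hnk⟩, hpl⟩ := h
      rw [hK, mem_smoothDivisors] at hk
      obtain ⟨⟨hkn, _⟩, hsq, hsm⟩ := hk
      have hk0 : 0 < k := Nat.pos_of_dvd_of_pos hkn (Nat.pos_of_ne_zero hn)
      have hpw : p < w := by
        by_cases hk1 : k = 1
        · simpa [hlp, hk1] using hpl
        · have := hsm _ (Nat.minFac_prime hk1) (Nat.minFac_dvd k)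
          simp only [hlp, hk1, if_false] at hpl
          exact hpl.trans this
      simp only [Finset.mem_filter]
      rw [hK, mem_smoothDivisors, hlp_mul k p hp hpl, Nat.mul_div_cancel _ hp.pos]
      refine ⟨⟨⟨?_, hn⟩, ?_, ?_⟩, ?_, hkT⟩
      · have := Nat.mul_dvd_mul_left k hpn
        rwa [Nat.mul_div_cancel' hkn] at this
      · exact (Nat.squarefree_mul (hcop k p hp hpl)).2 ⟨hsq, hp.squarefree⟩
      · intro r hr hrd
        rcases hr.dvd_mul.1 hrd with h | h
        · exact hsm r hr h
        · rw [(Nat.prime_dvd_prime_iff_eq hr hp).1 h]; exact hpw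
      · exact fun h => hp.one_lt.ne' (Nat.eq_one_of_mul_eq_one_left h)
    · intro a ha
      rw [Finset.mem_filter, hK, mem_smoothDivisors] at ha
      obtain ⟨⟨⟨han, _⟩, hsq, hsm⟩, ha1, haT⟩ := ha
      have hm := Nat.minFac_prime ha1
      have hda : a / a.minFac ∣ a := Nat.div_dvd_of_dvd (Nat.minFac_dvd a)
      have ha0 : 0 < a := Nat.pos_of_dvd_of_pos han (Nat.pos_of_ne_zero hn)
      have hmul : a / a.minFac * a.minFac = a := Nat.div_mul_cancel (Nat.minFac_dvd a)
      simp only [Finset.mem_sigma, Finset.mem_filter, Nat.mem_primeFactors]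
      rw [hK, mem_smoothDivisors]
      refine ⟨⟨⟨⟨hda.trans han, hn⟩, hsq.squarefree_of_dvd hda, fun p hp h => hsm p hp (h.trans hda)⟩,
        haT⟩, ⟨hm, ?_, ?_⟩, ?_⟩
      · refine (Nat.dvd_div_iff_mul_dvd (hda.trans han)).2 ?_
        rwa [hmul]
      · exact (Nat.div_pos (Nat.le_of_dvd (Nat.pos_of_ne_zero hn) (hda.trans han))
          (Nat.pos_of_dvd_of_pos hda ha0)).ne'
      · by_cases h1 : a / a.minFac = 1
        · have : a.minFac = a := by rw [h1, one_mul] at hmul; exact hmul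
          simp only [hlp, h1, if_true]
          exact hsm _ hm (Nat.minFac_dvd a)
        · simp only [hlp, h1, if_false]
          have hm2 := Nat.minFac_prime h1
          have hle := Nat.minFac_le_of_dvd hm2.two_le ((Nat.minFac_dvd (a / a.minFac)).trans hda)
          refine lt_of_le_of_ne hle fun heq => ?_
          have hd : a.minFac * a.minFac ∣ a := by
            have h3 : a.minFac ∣ a / a.minFac := by
              have := Nat.minFac_dvd (a / a.minFac)
              rwa [← heq] at this
            have h2 := Nat.mul_dvd_mul_right h3 a.minFac
            rwa [hmul] at h2
          exact hm.one_lt.ne' (Nat.isUnit_iff.1 (hsq _ hd))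
    · rintro ⟨k, p⟩ h
      simp only [Finset.mem_sigma, Finset.mem_filter, Nat.mem_primeFactors] at h
      obtain ⟨_, ⟨hp, _⟩, hpl⟩ := h
      simp only
      rw [hlp_mul k p hp hpl, Nat.mul_div_cancel _ hp.pos]
    · intro a _
      exact Nat.div_mul_cancel (Nat.minFac_dvd a)
    · rintro ⟨k, p⟩ _; rfl
  have hS : ∑ k ∈ K.filter (fun k : ℕ => (k : ℝ) ≤ T), f k =
      ∑ k ∈ K.filter (fun k : ℕ => (k : ℝ) ≤ T), ((ArithmeticFunction.moebius k : ℤ) : ℂ) +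
      ∑ a ∈ K.filter (fun a : ℕ => a ≠ 1 ∧ ((a / a.minFac : ℕ) : ℝ) ≤ T), f a := by
    rw [← hdouble, ← Finset.sum_add_distrib]
    exact Finset.sum_congr rfl fun k hk => hstep k (Finset.mem_filter.1 hk).1
  have hone : ∑ k ∈ K.filter (fun k : ℕ => (k : ℝ) ≤ T), f k = psiN n w +
      ∑ k ∈ K.filter (fun k : ℕ => (k : ℝ) ≤ T ∧ k ≠ 1), f k := by
    rw [← Finset.add_sum_erase _ _ (Finset.mem_filter.2 ⟨h1K, by simpa using hT⟩)]
    congr 1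
    · simp [hf, hlp]
    · refine Finset.sum_congr ?_ fun _ _ => rfl
      ext k; simp only [Finset.mem_erase, Finset.mem_filter]; tauto
  have hsplit : ∑ a ∈ K.filter (fun a : ℕ => a ≠ 1 ∧ ((a / a.minFac : ℕ) : ℝ) ≤ T), f a =
      ∑ k ∈ K.filter (fun k : ℕ => (k : ℝ) ≤ T ∧ k ≠ 1), f k +
      ∑ a ∈ K.filter (fun a : ℕ => T < (a : ℝ) ∧ ((a / a.minFac : ℕ) : ℝ) ≤ T),
        ((ArithmeticFunction.moebius a : ℤ) : ℂ) * psiN (n / a) a.minFac := by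
    rw [← Finset.sum_filter_add_sum_filter_not _ (fun a : ℕ => (a : ℝ) ≤ T)]
    rw [Finset.filter_filter, Finset.filter_filter]
    congr 1
    · refine Finset.sum_congr ?_ fun _ _ => rfl
      ext k; simp only [Finset.mem_filter]
      constructor
      · rintro ⟨h1, ⟨h2, h3⟩, h4⟩; exact ⟨h1, h4, h2⟩
      · rintro ⟨h1, h2, h3⟩
        refine ⟨h1, ⟨h3, le_trans ?_ h2⟩, h2⟩
        exact_mod_cast Nat.div_le_self _ _
    · have hset : K.filter (fun a : ℕ => (a ≠ 1 ∧ ((a / a.minFac : ℕ) : ℝ) ≤ T) ∧ ¬ (a : ℝ) ≤ T) =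
          K.filter (fun a : ℕ => T < (a : ℝ) ∧ ((a / a.minFac : ℕ) : ℝ) ≤ T) := by
        ext k; simp only [Finset.mem_filter, not_le]
        constructor
        · rintro ⟨h1, ⟨h2, h3⟩, h4⟩; exact ⟨h1, h4, h3⟩
        · rintro ⟨h1, h2, h3⟩
          refine ⟨h1, ⟨?_, h3⟩, h2⟩
          rintro rfl
          simp at h2; linarith
      rw [hset]
      refine Finset.sum_congr rfl fun a ha => ?_
      have ha1 : a ≠ 1 := by
        rintro rfl
        have := (Finset.mem_filter.1 ha).2.1
        simp at this; linarith
      simp only [hf, hlp, ha1, if_false]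
  rw [hone, hsplit] at hS
  linear_combination hS

theorem sum_e_eq (Q v w : ℕ) (hv : v < Q) (hw : w < Q) :
    ∑ h ∈ Finset.range Q, e (-((w : ℝ) * (h / Q))) * e (h * v / Q) = if v = w then (Q : ℂ) else 0 := by
  have hQ : (Q : ℝ) ≠ 0 := by have : 0 < Q := by omega
                              positivity
  have h1 : ∀ h : ℕ, e (-((w : ℝ) * (h / Q))) * e (h * v / Q) = e (((v : ℝ) - w) / Q) ^ h := by
    intro h
    rw [← e_add, ← e_nat_mul]
    congr 1; field_simp; ring
  simp_rw [h1]
  split_ifs with hvw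
  · subst hvw
    simp [e]
  · have h2 : e (((v : ℝ) - w) / Q) ≠ 1 := by
      intro h
      have h3 := le_norm_e_sub_one (((v : ℝ) - w) / Q) (1 / Q) (fun c => by
        rw [show ((v : ℝ) - w) / Q - c = (((v - w - c * Q : ℤ)) : ℝ) / Q by push_cast; field_simp,
          abs_div, Nat.abs_cast]
        gcongr
        have : (v : ℤ) - w - c * Q ≠ 0 := by
          intro h0
          have h4 : (Q : ℤ) ∣ (v : ℤ) - w := ⟨c, by linarith⟩
          have h5 := Int.eq_zero_of_abs_lt_dvd h4 (by rw [abs_lt]; constructor <;> omega)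
          omega
        exact_mod_cast Int.one_le_abs this)
      rw [h, sub_self, norm_zero] at h3
      have : 0 < 4 * (1 / (Q : ℝ)) := by
        have : 0 < (Q : ℝ) := lt_of_le_of_ne (Nat.cast_nonneg _) hQ.symm
        positivity
      linarith
    have h3 : e (((v : ℝ) - w) / Q) ^ Q = 1 := by
      rw [← e_nat_mul, show (Q : ℝ) * (((v : ℝ) - w) / Q) = ((v - w : ℤ) : ℝ) by
        push_cast; field_simp, e_int]
    rw [geom_sum_eq h2, h3, sub_self, zero_div]

theorem sum_inv_le (J : ℕ) : ∑ h ∈ Finset.Ico (1 : ℕ) (2 ^ J), (1 : ℝ) / (h : ℝ) ≤ 1 + J := by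
  have h1 := harmonic_le_one_add_log (2 ^ J)
  rw [harmonic_eq_sum_Icc] at h1
  push_cast at h1
  rw [Real.log_pow] at h1
  have h2 : ∑ h ∈ Finset.Ico (1 : ℕ) (2 ^ J), (1 : ℝ) / (h : ℝ) ≤
      ∑ i ∈ Finset.Icc (1 : ℕ) (2 ^ J), ((i : ℝ))⁻¹ := by
    simp_rw [one_div]
    refine Finset.sum_le_sum_of_subset_of_nonneg ?_ fun _ _ _ => by positivity
    intro h; simp only [Finset.mem_Ico, Finset.mem_Icc]; omega
  have h3 : Real.log 2 ≤ 1 := by linarith [Real.log_two_lt_d9]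
  nlinarith [(Nat.cast_nonneg J : (0 : ℝ) ≤ J)]

theorem exists_separation (J : ℕ) (hJ : 0 < J) : ∃ c : ℕ → ℕ → ℂ, ∃ b : ℕ → ℝ,
    (∀ h, 0 < b h) ∧ (∀ h < 2 ^ J, ∀ s, ‖c h s‖ ≤ b h) ∧ ∑ h ∈ Finset.range (2 ^ J), b h ≤ 5 * J ∧
    ∀ s < 2 ^ J, ∀ v < 2 ^ J, (if s ≤ v then (1 : ℂ) else 0) =
      ∑ h ∈ Finset.range (2 ^ J), c h s * e (h * v / ((2 ^ J : ℕ) : ℝ)) := by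
  set Q : ℕ := 2 ^ J with hQ
  have hQ1 : 1 ≤ Q := Nat.one_le_two_pow
  have hQ0 : (0 : ℝ) < Q := by exact_mod_cast hQ1
  refine ⟨fun h s => (1 / (Q : ℂ)) * ∑ w ∈ Finset.Icc s (Q - 1), e (-((w : ℝ) * (h / Q))),
    fun h => if 0 < h ∧ h < Q then 1 / (h : ℝ) + 1 / ((Q - h : ℕ) : ℝ) else 1, ?_, ?_, ?_, ?_⟩
  · intro h
    simp only
    split_ifs with hh
    · have : 0 < (h : ℝ) := by exact_mod_cast hh.1
      positivity
    · norm_num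
  · intro h hh s
    simp only
    rw [norm_mul, norm_div, norm_one, Complex.norm_natCast]
    split_ifs with h0
    · have hh0 : 0 < (h : ℝ) := by exact_mod_cast h0.1
      have hsub : ((Q - h : ℕ) : ℝ) = Q - h := by rw [Nat.cast_sub h0.2.le]
      have hQh : (0 : ℝ) < Q - h := by have : (h : ℝ) < Q := by exact_mod_cast h0.2
                                       linarith
      have hbase := norm_geom_le s (Q - 1) (-(h / Q : ℝ)) (min (h : ℝ) (Q - h) / Q) (fun c => by
        rw [show -(h / Q : ℝ) - c = (((-h - c * Q : ℤ)) : ℝ) / Q by push_cast; field_simp; try ring,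
          abs_div, Nat.abs_cast]
        gcongr
        rcases le_or_gt 0 c with hc | hc
        · refine (min_le_left _ _).trans ?_
          rw [le_abs]; right
          push_cast
          have : (0 : ℝ) ≤ c := by exact_mod_cast hc
          nlinarith
        · refine (min_le_right _ _).trans ?_
          rw [le_abs]; left
          push_cast
          have : (c : ℝ) ≤ -1 := by exact_mod_cast (by omega : c ≤ -1)
          nlinarith)
      simp_rw [mul_neg] at hbase
      rw [hsub]
      set N := ‖∑ w ∈ Finset.Icc s (Q - 1), e (-((w : ℝ) * (h / Q)))‖ with hN
      have hN0 : 0 ≤ N := norm_nonneg _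
      have h3 : 1 / (Q : ℝ) * N * min (h : ℝ) (Q - h) ≤ 1 := by
        calc _ = N * (min (h : ℝ) (Q - h) / Q) := by ring
          _ ≤ 1 := hbase
      rcases min_cases (h : ℝ) (Q - h) with ⟨hm, _⟩ | ⟨hm, _⟩
      · rw [hm, ← le_div_iff₀ hh0] at h3
        have : 0 ≤ 1 / ((Q : ℝ) - h) := by positivity
        linarith
      · rw [hm, ← le_div_iff₀ hQh] at h3
        have : 0 ≤ 1 / (h : ℝ) := by positivity
        linarith
    · rw [one_div, inv_mul_le_iff₀ hQ0, mul_one]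
      refine (norm_sum_le _ _).trans ?_
      simp only [norm_e, Finset.sum_const, nsmul_eq_mul, mul_one, Nat.card_Icc]
      exact_mod_cast (by omega : Q - 1 + 1 - s ≤ Q)
  · have hJ1 : (1 : ℝ) ≤ J := by exact_mod_cast hJ
    rw [Finset.range_eq_Ico, Finset.sum_eq_sum_Ico_succ_bot (by omega)]
    simp only [lt_self_iff_false, false_and, if_false, zero_add]
    have h1 : ∑ h ∈ Finset.Ico 1 Q,
        (if 0 < h ∧ h < Q then 1 / (h : ℝ) + 1 / ((Q - h : ℕ) : ℝ) else 1) =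
        ∑ h ∈ Finset.Ico 1 Q, 1 / (h : ℝ) + ∑ h ∈ Finset.Ico 1 Q, 1 / ((Q - h : ℕ) : ℝ) := by
      rw [← Finset.sum_add_distrib]
      refine Finset.sum_congr rfl fun h hh => ?_
      rw [Finset.mem_Ico] at hh
      rw [if_pos (by omega)]
    have h2 : ∑ h ∈ Finset.Ico 1 Q, 1 / ((Q - h : ℕ) : ℝ) = ∑ h ∈ Finset.Ico 1 Q, 1 / (h : ℝ) := by
      refine Finset.sum_bij' (fun h _ => Q - h) (fun h _ => Q - h) ?_ ?_ ?_ ?_ ?_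
      all_goals intro h hh; rw [Finset.mem_Ico] at hh
      · rw [Finset.mem_Ico]; omega
      · rw [Finset.mem_Ico]; omega
      · omega
      · omega
    rw [h1, h2]
    have := sum_inv_le J
    rw [← hQ] at this
    linarith
  · intro s hs v hv
    simp only
    simp_rw [mul_assoc, Finset.sum_mul]
    rw [← Finset.mul_sum, Finset.sum_comm]
    rw [Finset.sum_congr rfl fun w hw => sum_e_eq Q v w hv (by
      rw [Finset.mem_Icc] at hw; omega), Finset.sum_ite_eq]
    have hQc : (Q : ℂ) ≠ 0 := by exact_mod_cast (by omega : Q ≠ 0)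
    by_cases hsv : s ≤ v
    · rw [if_pos hsv, if_pos (by rw [Finset.mem_Icc]; omega)]
      field_simp
    · rw [if_neg hsv, if_neg (by rw [Finset.mem_Icc]; omega), mul_zero]

namespace MinorRegime

variable {α t κ E : ℝ} {J A B : ℕ}

theorem one_le_t (h : MinorRegime α t κ E J A B) : 1 ≤ t := by linarith [h.two_le]

theorem one_le_κ (h : MinorRegime α t κ E J A B) : 1 ≤ κ := by linarith [h.le_κ]

theorem one_le_A (h : MinorRegime α t κ E J A B) : 1 ≤ A := by
  by_contra! hA
  have h1 := h.le_A
  have h2 := h.four_le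
  have : A = 0 := by omega
  simp only [this, Nat.cast_zero, mul_zero] at h1
  linarith

theorem typeI_scaled (h : MinorRegime α t κ E J A B) {K : ℝ} (hK : 0 < K) (x : ℕ → ℂ)
    (hx : ∀ d, ‖x d‖ ≤ K) (hsupp : ∀ d : ℕ, x d ≠ 0 → (d : ℝ) ≤ t ^ 4) :
    ‖∑ m ∈ Finset.Icc A B, (∑ p ∈ m.divisorsAntidiagonal, x p.1) * e (α * (m : ℝ) ^ 2)‖ ≤
      K * (J * E) := by
  have hKc : (K : ℂ) ≠ 0 := by exact_mod_cast hK.ne'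
  have h1 := h.typeI (fun d => (K : ℂ)⁻¹ * x d) (fun d => by
    rw [norm_mul, norm_inv, Complex.norm_of_nonneg hK.le, inv_mul_le_iff₀ hK, mul_one]
    exact hx d) (fun d hd => hsupp d (right_ne_zero_of_mul hd))
  simp_rw [← Finset.mul_sum, mul_assoc] at h1
  rwa [← Finset.mul_sum, norm_mul, norm_inv, Complex.norm_of_nonneg hK.le,
    inv_mul_le_iff₀ hK] at h1

theorem typeII_scaled (h : MinorRegime α t κ E J A B) {K : ℝ} (hK : 0 < K) (x y : ℕ → ℂ)
    (hx : ∀ d, ‖x d‖ ≤ K) (hy : ∀ d, ‖y d‖ ≤ 1)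
    (hsupp : ∀ d : ℕ, x d ≠ 0 → t ^ 4 ≤ (d : ℝ) ∧ (d : ℝ) ≤ t ^ 5) :
    ‖∑ m ∈ Finset.Icc A B, (∑ p ∈ m.divisorsAntidiagonal, x p.1 * y p.2) *
      e (α * (m : ℝ) ^ 2)‖ ≤ K * (J * E) := by
  have hKc : (K : ℂ) ≠ 0 := by exact_mod_cast hK.ne'
  have h1 := h.typeII (fun d => (K : ℂ)⁻¹ * x d) y (fun d => by
    rw [norm_mul, norm_inv, Complex.norm_of_nonneg hK.le, inv_mul_le_iff₀ hK, mul_one]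
    exact hx d) hy (fun d hd => by
      obtain ⟨h1, h2⟩ := hsupp d (right_ne_zero_of_mul hd)
      exact ⟨h1.trans (le_mul_of_one_le_left (by positivity) h.one_le_κ), h2⟩)
  simp_rw [mul_assoc, ← Finset.mul_sum, mul_assoc] at h1
  rwa [← Finset.mul_sum, norm_mul, norm_inv, Complex.norm_of_nonneg hK.le,
    inv_mul_le_iff₀ hK] at h1

theorem typeII_swapped (h : MinorRegime α t κ E J A B) {K : ℝ} (hK : 0 < K) (x y : ℕ → ℂ)
    (hx : ∀ d, ‖x d‖ ≤ K) (hy : ∀ d, ‖y d‖ ≤ 1)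
    (hsupp : ∀ d : ℕ, x d ≠ 0 → t ^ 2 ≤ (d : ℝ) ∧ (d : ℝ) ≤ t ^ 3) :
    ‖∑ m ∈ Finset.Icc A B, (∑ p ∈ m.divisorsAntidiagonal, x p.1 * y p.2) *
      e (α * (m : ℝ) ^ 2)‖ ≤ K * (J * E) := by
  have hKc : (K : ℂ) ≠ 0 := by exact_mod_cast hK.ne'
  have ht0 : 0 < t := by linarith [h.one_le_t]
  set y' : ℕ → ℂ := fun b => if t ^ 4 ≤ κ * b ∧ (b : ℝ) ≤ t ^ 5 then y b else 0 with hy'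
  have h1 := h.typeII y' (fun d => (K : ℂ)⁻¹ * x d) (fun d => by
    rw [hy']; dsimp only
    split_ifs
    · exact hy d
    · simp) (fun d => by
    rw [norm_mul, norm_inv, Complex.norm_of_nonneg hK.le, inv_mul_le_iff₀ hK, mul_one]
    exact hx d) (fun d hd => by
      by_contra hc
      exact hd (if_neg hc))
  have h2 : ∀ m ∈ Finset.Icc A B,
      (∑ p ∈ m.divisorsAntidiagonal, y' p.1 * ((K : ℂ)⁻¹ * x p.2)) * e (α * (m : ℝ) ^ 2) =
      (K : ℂ)⁻¹ * ((∑ p ∈ m.divisorsAntidiagonal, x p.1 * y p.2) * e (α * (m : ℝ) ^ 2)) := by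
    intro m hm
    rw [Finset.mem_Icc] at hm
    rw [← mul_assoc, Finset.mul_sum]
    congr 1
    nth_rewrite 1 [← Nat.map_swap_divisorsAntidiagonal]
    rw [Finset.sum_map]
    refine Finset.sum_congr rfl fun p hp => ?_
    obtain ⟨hpm, -⟩ := Nat.mem_divisorsAntidiagonal.1 hp
    simp only [Equiv.coe_toEmbedding, Equiv.prodComm_apply, Prod.fst_swap, Prod.snd_swap]
    by_cases hx0 : x p.1 = 0
    · simp [hx0]
    · obtain ⟨h3, h4⟩ := hsupp _ hx0
      have hmB : (p.1 : ℝ) * p.2 ≤ t ^ 7 := by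
        refine le_trans ?_ h.B_le
        exact_mod_cast hpm ▸ hm.2
      have hmA : t ^ 7 ≤ κ * ((p.1 : ℝ) * p.2) := by
        refine h.le_A.trans ?_
        have hκ := h.one_le_κ
        gcongr
        exact_mod_cast hpm ▸ hm.1
      have hd0 : (0 : ℝ) < p.1 := lt_of_lt_of_le (by positivity) h3
      rw [hy']; dsimp only
      rw [if_pos]
      · ring
      · constructor
        · refine le_of_mul_le_mul_left (a := t ^ 3) ?_ (by positivity)
          have hκ := h.one_le_κ
          calc t ^ 3 * t ^ 4 = t ^ 7 := by ring
            _ ≤ κ * ((p.1 : ℝ) * p.2) := hmA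
            _ ≤ κ * (t ^ 3 * p.2) := by gcongr
            _ = _ := by ring
        · refine le_of_mul_le_mul_left (a := t ^ 2) ?_ (by positivity)
          calc t ^ 2 * (p.2 : ℝ) ≤ p.1 * p.2 := by gcongr
            _ ≤ t ^ 7 := hmB
            _ = _ := by ring
  rw [Finset.sum_congr rfl h2, ← Finset.mul_sum, norm_mul, norm_inv, Complex.norm_of_nonneg hK.le,
    inv_mul_le_iff₀ hK] at h1
  exact h1

/-- The ranges in which a bilinear sum is under control. -/
def _root_.InBilinearRange (t : ℝ) (d : ℕ) : Prop :=
  (t ^ 2 ≤ (d : ℝ) ∧ (d : ℝ) ≤ t ^ 3) ∨ (t ^ 4 ≤ (d : ℝ) ∧ (d : ℝ) ≤ t ^ 5)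

theorem bilinear (h : MinorRegime α t κ E J A B) {K : ℝ} (hK : 0 < K) (x y : ℕ → ℂ)
    (hx : ∀ d, ‖x d‖ ≤ K) (hy : ∀ d, ‖y d‖ ≤ 1)
    (hsupp : ∀ d : ℕ, x d ≠ 0 → InBilinearRange t d) :
    ‖∑ m ∈ Finset.Icc A B, (∑ p ∈ m.divisorsAntidiagonal, x p.1 * y p.2) *
      e (α * (m : ℝ) ^ 2)‖ ≤ 2 * K * (J * E) := by
  set P : ℕ → Prop := fun d => t ^ 2 ≤ (d : ℝ) ∧ (d : ℝ) ≤ t ^ 3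
  have hsplit : ∀ d, x d = (if P d then x d else 0) + (if P d then 0 else x d) := by
    intro d; split_ifs <;> simp
  have e1 : ∑ m ∈ Finset.Icc A B, (∑ p ∈ m.divisorsAntidiagonal, x p.1 * y p.2) *
      e (α * (m : ℝ) ^ 2) =
      ∑ m ∈ Finset.Icc A B, (∑ p ∈ m.divisorsAntidiagonal, (if P p.1 then x p.1 else 0) * y p.2) *
      e (α * (m : ℝ) ^ 2) +
      ∑ m ∈ Finset.Icc A B, (∑ p ∈ m.divisorsAntidiagonal, (if P p.1 then 0 else x p.1) * y p.2) *
      e (α * (m : ℝ) ^ 2) := by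
    rw [← Finset.sum_add_distrib]
    refine Finset.sum_congr rfl fun m _ => ?_
    rw [← add_mul, ← Finset.sum_add_distrib]
    congr 1
    refine Finset.sum_congr rfl fun p _ => ?_
    rw [← add_mul, ← hsplit]
  rw [e1]
  have h1 := h.typeII_swapped hK (fun d => if P d then x d else 0) y (fun d => by
    split_ifs
    · exact hx d
    · simpa using hK.le) hy (fun d hd => by
      by_contra hc; exact hd (if_neg hc))
  have h2 := h.typeII_scaled hK (fun d => if P d then 0 else x d) y (fun d => by
    split_ifs
    · simpa using hK.le
    · exact hx d) hy (fun d hd => by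
      by_cases hP : P d
      · exact absurd (if_pos hP) hd
      · rw [if_neg hP] at hd
        exact (hsupp d hd).resolve_left hP)
  refine (norm_add_le _ _).trans ?_
  linarith

end MinorRegime

/-- The coefficient `∑_{d ∣ m} ∑_s x(d, s) ψ(m / d, s)`. -/
def sieveCoeff (J : ℕ) (x : ℕ → ℕ → ℂ) (m : ℕ) : ℂ :=
  ∑ p ∈ m.divisorsAntidiagonal, ∑ s ∈ Finset.range (2 ^ J), x p.1 s * psiN p.2 s

/-- Index of the smallest prime factor, capped so as to stay below `Q`. -/
def roughness (Q n : ℕ) : ℕ := if n = 1 then Q - 1 else n.minFac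

theorem psiN_eq_roughness {Q n s : ℕ} (hs : s < Q) :
    psiN n s = if s ≤ roughness Q n then 1 else 0 := by
  rw [psiN, roughness]
  by_cases hn : n = 1
  · rw [if_pos hn, if_pos (show s ≤ Q - 1 by omega), if_pos]
    rintro p hp h
    rw [hn, Nat.dvd_one] at h
    exact absurd h hp.one_lt.ne'
  · rw [if_neg hn]
    have hmf := Nat.minFac_prime hn
    refine if_congr ⟨fun h => h _ hmf (Nat.minFac_dvd n), fun h p hp hpn =>
      h.trans (Nat.minFac_le_of_dvd hp.two_le hpn)⟩ rfl rfl

theorem MinorRegime.sieve_leaf {α t κ E : ℝ} {J A B : ℕ} (h : MinorRegime α t κ E J A B) {K : ℝ}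
    (hK : 0 < K) (x : ℕ → ℕ → ℂ) (hx : ∀ d, ∑ s ∈ Finset.range (2 ^ J), ‖x d s‖ ≤ K)
    (hsupp : ∀ d s : ℕ, x d s ≠ 0 → InBilinearRange t d) :
    ‖∑ m ∈ Finset.Icc A B, sieveCoeff J x m * e (α * (m : ℝ) ^ 2)‖ ≤ K * (κ ^ 3 * E) := by
  obtain ⟨c, b, hb0, hcb, hbs, hsep⟩ := exists_separation J h.J_pos
  set X : ℕ → ℕ → ℂ := fun k d => ∑ s ∈ Finset.range (2 ^ J), x d s * c k s with hX
  set Y : ℕ → ℕ → ℂ := fun k n => e (k * roughness (2 ^ J) n / ((2 ^ J : ℕ) : ℝ)) with hY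
  have hBlt := h.B_lt
  have key : ∑ m ∈ Finset.Icc A B, sieveCoeff J x m * e (α * (m : ℝ) ^ 2) =
      ∑ k ∈ Finset.range (2 ^ J), ∑ m ∈ Finset.Icc A B,
        (∑ p ∈ m.divisorsAntidiagonal, X k p.1 * Y k p.2) * e (α * (m : ℝ) ^ 2) := by
    rw [Finset.sum_comm]
    refine Finset.sum_congr rfl fun m hm => ?_
    rw [← Finset.sum_mul, Finset.sum_comm, sieveCoeff]
    congr 1
    refine Finset.sum_congr rfl fun p hp => ?_
    obtain ⟨hpm, hm0⟩ := Nat.mem_divisorsAntidiagonal.1 hp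
    rw [Finset.mem_Icc] at hm
    have hp2 : p.2 < 2 ^ J := by
      have : p.2 ≤ m := Nat.le_of_dvd (Nat.pos_of_ne_zero hm0) ⟨p.1, by rw [← hpm, mul_comm]⟩
      omega
    have hv : roughness (2 ^ J) p.2 < 2 ^ J := by
      rw [roughness]
      split_ifs with h1
      · have : 0 < 2 ^ J := by positivity
        omega
      · have h0 : 0 < p.2 := Nat.pos_of_ne_zero (by rintro h0; rw [h0, mul_zero] at hpm; omega)
        exact (Nat.minFac_le h0).trans_lt hp2
    simp_rw [hX, Finset.sum_mul]
    rw [Finset.sum_comm]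
    refine Finset.sum_congr rfl fun s hs => ?_
    rw [Finset.mem_range] at hs
    rw [psiN_eq_roughness hs, hsep s hs _ hv, Finset.mul_sum]
    exact Finset.sum_congr rfl fun k _ => by rw [hY]; ring
  rw [key]
  have hXle : ∀ k < 2 ^ J, ∀ d, ‖X k d‖ ≤ K * b k := by
    intro k hk d
    calc ‖X k d‖ ≤ ∑ s ∈ Finset.range (2 ^ J), ‖x d s * c k s‖ := norm_sum_le _ _
      _ ≤ ∑ s ∈ Finset.range (2 ^ J), ‖x d s‖ * b k := by
          refine Finset.sum_le_sum fun s hs => ?_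
          rw [norm_mul]
          gcongr
          exact hcb k hk s
      _ = (∑ s ∈ Finset.range (2 ^ J), ‖x d s‖) * b k := by rw [Finset.sum_mul]
      _ ≤ K * b k := mul_le_mul_of_nonneg_right (hx d) (hb0 k).le
  have hterm : ∀ k ∈ Finset.range (2 ^ J), ‖∑ m ∈ Finset.Icc A B,
      (∑ p ∈ m.divisorsAntidiagonal, X k p.1 * Y k p.2) * e (α * (m : ℝ) ^ 2)‖ ≤
      2 * (K * b k) * (J * E) := by
    intro k hk
    rw [Finset.mem_range] at hk
    refine h.bilinear (mul_pos hK (hb0 k)) (X k) (Y k) (hXle k hk) (fun d => (norm_e _).le) ?_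
    intro d hd
    rw [hX] at hd
    obtain ⟨s, _, hs⟩ := Finset.exists_ne_zero_of_sum_ne_zero hd
    exact hsupp d s (left_ne_zero_of_mul hs)
  have hE0 : 0 ≤ E := by linarith [h.one_le_E]
  have hκ := h.le_κ
  calc _ ≤ ∑ k ∈ Finset.range (2 ^ J), 2 * (K * b k) * (J * E) :=
        (norm_sum_le _ _).trans (Finset.sum_le_sum hterm)
    _ = 2 * K * (J * E) * ∑ k ∈ Finset.range (2 ^ J), b k := by
        rw [Finset.mul_sum]; exact Finset.sum_congr rfl fun k _ => by ring
    _ ≤ 2 * K * (κ * E) * (5 * κ) := by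
        have := h.J_le
        have h5 : ∑ k ∈ Finset.range (2 ^ J), b k ≤ 5 * κ := by linarith
        have h6 : 0 ≤ ∑ k ∈ Finset.range (2 ^ J), b k := Finset.sum_nonneg fun k _ => (hb0 k).le
        gcongr
    _ = K * ((10 * κ ^ 2) * E) := by ring
    _ ≤ K * (κ ^ 3 * E) := by
        gcongr
        nlinarith [sq_nonneg κ]

theorem sum_antidiagonal_assoc (f : ℕ → ℕ → ℕ → ℂ) (m : ℕ) :
    ∑ p ∈ m.divisorsAntidiagonal, ∑ r ∈ p.2.divisorsAntidiagonal, f p.1 r.1 r.2 =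
      ∑ p ∈ m.divisorsAntidiagonal, ∑ r ∈ p.1.divisorsAntidiagonal, f r.1 r.2 p.2 := by
  rw [Finset.sum_sigma', Finset.sum_sigma']
  refine Finset.sum_nbij' (fun s => ⟨(s.1.1 * s.2.1, s.2.2), (s.1.1, s.2.1)⟩)
    (fun s => ⟨(s.2.1, s.2.2 * s.1.2), (s.2.2, s.1.2)⟩) ?_ ?_ ?_ ?_ ?_
  · rintro ⟨⟨d, n⟩, a, b⟩ h
    simp only [Finset.mem_sigma, Nat.mem_divisorsAntidiagonal] at h ⊢
    obtain ⟨⟨h1, h2⟩, h3, h4⟩ := h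
    subst h3 h1
    refine ⟨⟨by ring, h2⟩, trivial, ?_⟩
    intro h0; apply h2; rw [← mul_assoc, h0, zero_mul]
  · rintro ⟨⟨d, n⟩, a, b⟩ h
    simp only [Finset.mem_sigma, Nat.mem_divisorsAntidiagonal] at h ⊢
    obtain ⟨⟨h1, h2⟩, h3, h4⟩ := h
    subst h3 h1
    refine ⟨⟨by ring, h2⟩, trivial, ?_⟩
    intro h0; apply h2; rw [mul_assoc, h0, mul_zero]
  · rintro ⟨⟨d, n⟩, a, b⟩ h
    simp only [Finset.mem_sigma, Nat.mem_divisorsAntidiagonal] at h ⊢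
    obtain ⟨⟨h1, h2⟩, h3, h4⟩ := h
    subst h3
    rfl
  · rintro ⟨⟨d, n⟩, a, b⟩ h
    simp only [Finset.mem_sigma, Nat.mem_divisorsAntidiagonal] at h ⊢
    obtain ⟨⟨h1, h2⟩, h3, h4⟩ := h
    subst h3
    rfl
  · rintro ⟨⟨d, n⟩, a, b⟩ h
    rfl

/-- Multiplying the divisor variable of a state by a further factor. -/
def pushState (φ : ℕ → ℕ → ℕ → ℂ) (D s : ℕ) : ℂ := ∑ r ∈ D.divisorsAntidiagonal, φ r.1 r.2 s

theorem exists_of_pushState_ne_zero {φ : ℕ → ℕ → ℕ → ℂ} {D s : ℕ} (h : pushState φ D s ≠ 0) :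
    ∃ d a, d * a = D ∧ D ≠ 0 ∧ φ d a s ≠ 0 := by
  obtain ⟨r, hr, h0⟩ := Finset.exists_ne_zero_of_sum_ne_zero h
  obtain ⟨h1, h2⟩ := Nat.mem_divisorsAntidiagonal.1 hr
  exact ⟨r.1, r.2, h1, h2, h0⟩

theorem sum_norm_pushState_le {κ K R : ℝ} (hκ : 0 ≤ κ) (hK : 0 ≤ K) (S : Finset ℕ)
    (φ : ℕ → ℕ → ℕ → ℂ)
    (hdiv : ∀ k : ℕ, 1 ≤ k → (k : ℝ) ≤ R → (k.divisors.card : ℝ) ≤ κ)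
    (hφ : ∀ d a, ∑ s ∈ S, ‖φ d a s‖ ≤ K)
    (hsupp : ∀ d a s : ℕ, φ d a s ≠ 0 → ((d * a : ℕ) : ℝ) ≤ R) (D : ℕ) :
    ∑ s ∈ S, ‖pushState φ D s‖ ≤ K * κ := by
  by_cases hD : D ≠ 0 ∧ (D : ℝ) ≤ R
  · calc ∑ s ∈ S, ‖pushState φ D s‖ ≤ ∑ s ∈ S, ∑ r ∈ D.divisorsAntidiagonal, ‖φ r.1 r.2 s‖ :=
          Finset.sum_le_sum fun s _ => norm_sum_le _ _
      _ = ∑ r ∈ D.divisorsAntidiagonal, ∑ s ∈ S, ‖φ r.1 r.2 s‖ := Finset.sum_comm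
      _ ≤ ∑ r ∈ D.divisorsAntidiagonal, K := Finset.sum_le_sum fun r _ => hφ _ _
      _ = K * D.divisors.card := by
          rw [Finset.sum_const, nsmul_eq_mul, mul_comm, ← Nat.map_div_right_divisors,
            Finset.card_map]
      _ ≤ K * κ := by gcongr; exact hdiv D (Nat.pos_of_ne_zero hD.1) hD.2
  · refine le_trans (le_of_eq (Finset.sum_eq_zero fun s _ => ?_)) (mul_nonneg hK hκ)
    rw [norm_eq_zero]
    by_contra h0
    obtain ⟨d, a, rfl, h2, h3⟩ := exists_of_pushState_ne_zero h0
    exact hD ⟨h2, hsupp d a s h3⟩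

theorem sieveCoeff_pushState (J m : ℕ) (φ : ℕ → ℕ → ℕ → ℂ) :
    sieveCoeff J (pushState φ) m = ∑ p ∈ m.divisorsAntidiagonal,
      ∑ r ∈ p.2.divisorsAntidiagonal, ∑ s ∈ Finset.range (2 ^ J), φ p.1 r.1 s * psiN r.2 s := by
  rw [sum_antidiagonal_assoc (fun d a b => ∑ s ∈ Finset.range (2 ^ J), φ d a s * psiN b s)]
  refine Finset.sum_congr rfl fun p _ => ?_
  rw [Finset.sum_comm]
  refine Finset.sum_congr rfl fun s _ => ?_
  rw [pushState, Finset.sum_mul]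

theorem MinorRegime.lt_two_pow {α t κ E : ℝ} {J A B : ℕ} (h : MinorRegime α t κ E J A B) {k : ℕ}
    (hk : (k : ℝ) ≤ t) : k < 2 ^ J := by
  have h1 : (k : ℝ) < 2 ^ J := by
    have := h.two_le
    calc (k : ℝ) ≤ t := hk
      _ < t * t ^ 13 := by
        have : (1 : ℝ) < t ^ 13 := one_lt_pow₀ (by linarith) (by norm_num)
        nlinarith
      _ = (t ^ 7) ^ 2 := by ring
      _ ≤ _ := h.le_two_pow
  exact_mod_cast h1

theorem moebius_norm_le (k : ℕ) : ‖((ArithmeticFunction.moebius k : ℤ) : ℂ)‖ ≤ 1 := by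
  rw [Complex.norm_intCast]
  exact_mod_cast ArithmeticFunction.abs_moebius_le_one

set_option maxHeartbeats 800000 in
theorem MinorRegime.rough_bound {α t κ E : ℝ} {J A B : ℕ} (h : MinorRegime α t κ E J A B) {K : ℝ}
    (hK : 0 < K) (x : ℕ → ℂ) (hx : ∀ d, ‖x d‖ ≤ K) (hsupp : ∀ d : ℕ, x d ≠ 0 → (d : ℝ) ≤ t ^ 4) :
    ‖∑ m ∈ Finset.Icc A B, (∑ p ∈ m.divisorsAntidiagonal, x p.1 * psiN p.2 ⌈t⌉₊) *
      e (α * (m : ℝ) ^ 2)‖ ≤ K * (2 * κ ^ 4 * E) := by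
  have ht1 := h.one_le_t
  have ht0 : 0 < t := by linarith
  have hκ1 := h.one_le_κ
  have hE1 := h.one_le_E
  set w := ⌈t⌉₊ with hw
  set sm : ℕ → Prop := fun k => Squarefree k ∧ ∀ p : ℕ, p.Prime → p ∣ k → p < w with hsm
  set mu : ℕ → ℂ := fun k => ((ArithmeticFunction.moebius k : ℤ) : ℂ) with hmu
  have hdiv : ∀ k : ℕ, 1 ≤ k → (k : ℝ) ≤ t ^ 5 → (k.divisors.card : ℝ) ≤ κ := fun k hk hk' =>
    h.divisors_le k hk (hk'.trans (by
      rw [← pow_mul]; exact pow_le_pow_right₀ ht1 (by norm_num)))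
  set φ₁ : ℕ → ℕ → ℕ → ℂ := fun d k s =>
    if sm k ∧ ((d * k : ℕ) : ℝ) ≤ t ^ 4 ∧ s = 0 then x d * mu k else 0 with hφ₁
  set φ₂ : ℕ → ℕ → ℕ → ℂ := fun d a s =>
    if sm a ∧ t ^ 4 < ((d * a : ℕ) : ℝ) ∧ ((d * (a / a.minFac) : ℕ) : ℝ) ≤ t ^ 4 ∧
      (d : ℝ) ≤ t ^ 4 ∧ s = a.minFac then x d * mu a else 0 with hφ₂
  have hxmu : ∀ d k, ‖x d * mu k‖ ≤ K := by
    intro d k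
    rw [norm_mul]
    calc _ ≤ K * 1 := mul_le_mul (hx d) (moebius_norm_le k) (norm_nonneg _) hK.le
      _ = K := mul_one K
  have hb₁ : ∀ d a, ∑ s ∈ ({0} : Finset ℕ), ‖φ₁ d a s‖ ≤ K := by
    intro d a
    rw [Finset.sum_singleton, hφ₁]; dsimp only
    split_ifs
    · exact hxmu d a
    · simpa using hK.le
  have hb₂ : ∀ d a, ∑ s ∈ Finset.range (2 ^ J), ‖φ₂ d a s‖ ≤ K := by
    intro d a
    calc ∑ s ∈ Finset.range (2 ^ J), ‖φ₂ d a s‖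
        ≤ ∑ s ∈ Finset.range (2 ^ J), if s = a.minFac then K else 0 := by
          refine Finset.sum_le_sum fun s _ => ?_
          rw [hφ₂]; dsimp only
          split_ifs with h1 h2 h2
          · exact hxmu d a
          · exact absurd h1.2.2.2.2 h2
          · simpa using hK.le
          · simp
      _ ≤ K := by
          rw [Finset.sum_ite_eq']
          split_ifs <;> linarith
  have hsmall : ∀ d a : ℕ, sm a → t ^ 4 < ((d * a : ℕ) : ℝ) → (d : ℝ) ≤ t ^ 4 →
      ((a.minFac : ℕ) : ℝ) ≤ t := by
    intro d a ha h1 h2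
    have ha1 : a ≠ 1 := by
      rintro rfl
      rw [mul_one] at h1
      linarith
    exact (Nat.lt_ceil.1 (ha.2 _ (Nat.minFac_prime ha1) (Nat.minFac_dvd a))).le
  have hs₂ : ∀ d a s : ℕ, φ₂ d a s ≠ 0 →
      t ^ 4 ≤ ((d * a : ℕ) : ℝ) ∧ ((d * a : ℕ) : ℝ) ≤ t ^ 5 := by
    intro d a s h0
    have hc : sm a ∧ t ^ 4 < ((d * a : ℕ) : ℝ) ∧ ((d * (a / a.minFac) : ℕ) : ℝ) ≤ t ^ 4 ∧
      (d : ℝ) ≤ t ^ 4 ∧ s = a.minFac := by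
      by_contra hc; exact h0 (if_neg hc)
    obtain ⟨h1, h2, h3, h4, -⟩ := hc
    refine ⟨h2.le, ?_⟩
    have h5 : d * a = d * (a / a.minFac) * a.minFac := by
      rw [mul_assoc, Nat.div_mul_cancel (Nat.minFac_dvd a)]
    rw [h5, Nat.cast_mul]
    calc _ ≤ t ^ 4 * t := by
          gcongr
          exact hsmall d a h1 h2 h4
      _ = t ^ 5 := by ring
  have hs₁ : ∀ d a s : ℕ, φ₁ d a s ≠ 0 → ((d * a : ℕ) : ℝ) ≤ t ^ 4 := by
    intro d a s h0
    by_contra hc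
    exact h0 (if_neg fun hc' => hc hc'.2.1)
  have hp₁ : ∀ D, ‖pushState φ₁ D 0‖ ≤ K * κ := by
    intro D
    have := sum_norm_pushState_le (by linarith) hK.le {0} φ₁ hdiv hb₁ (fun d a s h0 =>
      (hs₁ d a s h0).trans (pow_le_pow_right₀ ht1 (by norm_num))) D
    simpa using this
  have hp₂ := sum_norm_pushState_le (by linarith) hK.le (Finset.range (2 ^ J)) φ₂ hdiv hb₂
    (fun d a s h0 => (hs₂ d a s h0).2)
  have hKκ : 0 < K * κ := by positivity
  have b1 := h.typeI_scaled hKκ (fun D => pushState φ₁ D 0) hp₁ (fun D h0 => by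
    obtain ⟨d, a, rfl, -, h3⟩ := exists_of_pushState_ne_zero h0
    exact hs₁ d a 0 h3)
  have b2 := h.sieve_leaf hKκ (pushState φ₂) hp₂ (fun D s h0 => by
    obtain ⟨d, a, rfl, -, h3⟩ := exists_of_pushState_ne_zero h0
    exact Or.inr (hs₂ d a s h3))
  have key : ∀ m, ∑ p ∈ m.divisorsAntidiagonal, x p.1 * psiN p.2 w =
      ∑ p ∈ m.divisorsAntidiagonal, pushState φ₁ p.1 0 + sieveCoeff J (pushState φ₂) m := by
    intro m
    rw [sieveCoeff_pushState]
    simp_rw [pushState]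
    rw [← sum_antidiagonal_assoc (fun d a b => φ₁ d a 0), ← Finset.sum_add_distrib]
    refine Finset.sum_congr rfl fun p hp => ?_
    obtain ⟨hpm, hm0⟩ := Nat.mem_divisorsAntidiagonal.1 hp
    by_cases hx0 : x p.1 = 0
    · rw [hx0, zero_mul, Finset.sum_eq_zero, Finset.sum_eq_zero, add_zero]
      · intro r _
        refine Finset.sum_eq_zero fun s _ => ?_
        simp [hφ₂, hx0]
      · intro r _
        simp [hφ₁, hx0]
    have hd4 := hsupp _ hx0
    have hd0 : 0 < p.1 := Nat.pos_of_ne_zero fun h0 => hm0 (by rw [← hpm, h0, zero_mul])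
    have hn0 : p.2 ≠ 0 := fun h0 => hm0 (by rw [← hpm, h0, mul_zero])
    have hd0' : (0 : ℝ) < p.1 := by exact_mod_cast hd0
    rw [psiN_eq_truncated p.2 w (t ^ 4 / p.1) hn0 (by rw [le_div_iff₀ hd0']; simpa using hd4),
      mul_add]
    rw [Nat.sum_divisorsAntidiagonal (fun a b => φ₁ p.1 a 0),
      Nat.sum_divisorsAntidiagonal (fun a b => ∑ s ∈ Finset.range (2 ^ J), φ₂ p.1 a s * psiN b s)]
    rw [smoothDivisors, Finset.filter_filter, Finset.filter_filter, Finset.sum_filter,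
      Finset.sum_filter, Finset.mul_sum, Finset.mul_sum]
    congr 1
    · refine Finset.sum_congr rfl fun k _ => ?_
      rw [hφ₁]; dsimp only
      rw [mul_ite, mul_zero]
      refine if_congr ?_ rfl rfl
      rw [le_div_iff₀ hd0', Nat.cast_mul, mul_comm (k : ℝ)]
      simp [hsm]
    · refine Finset.sum_congr rfl fun a _ => ?_
      by_cases hc : sm a ∧ t ^ 4 < ((p.1 * a : ℕ) : ℝ) ∧
          ((p.1 * (a / a.minFac) : ℕ) : ℝ) ≤ t ^ 4
      · have hlt : a.minFac < 2 ^ J := h.lt_two_pow (hsmall _ a hc.1 hc.2.1 hd4)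
        have hφe : ∀ s, φ₂ p.1 a s * psiN (p.2 / a) s =
            if s = a.minFac then x p.1 * mu a * psiN (p.2 / a) s else 0 := by
          intro s
          rw [hφ₂]; dsimp only
          rw [ite_mul, zero_mul]
          refine if_congr ?_ rfl rfl
          exact ⟨fun h => h.2.2.2.2, fun h => ⟨hc.1, hc.2.1, hc.2.2, hd4, h⟩⟩
        simp_rw [hφe]
        rw [Finset.sum_ite_eq', if_pos (Finset.mem_range.2 hlt), if_pos, mul_assoc]
        refine ⟨hc.1, ?_, ?_⟩
        · rw [div_lt_iff₀ hd0', mul_comm]; exact_mod_cast hc.2.1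
        · rw [le_div_iff₀ hd0', mul_comm]; exact_mod_cast hc.2.2
      · rw [if_neg, mul_zero, Finset.sum_eq_zero]
        · intro s _
          rw [hφ₂]; dsimp only
          rw [if_neg, zero_mul]
          exact fun h => hc ⟨h.1, h.2.1, h.2.2.1⟩
        · rintro ⟨h1, h2, h3⟩
          apply hc
          rw [div_lt_iff₀ hd0', mul_comm] at h2
          rw [le_div_iff₀ hd0', mul_comm] at h3
          exact ⟨h1, by exact_mod_cast h2, by exact_mod_cast h3⟩
  simp_rw [key, add_mul, Finset.sum_add_distrib]
  refine (norm_add_le _ _).trans ?_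
  have hJ := h.J_le
  calc _ ≤ K * κ * (J * E) + K * κ * (κ ^ 3 * E) := add_le_add b1 b2
    _ ≤ K * κ * (κ ^ 3 * E) + K * κ * (κ ^ 3 * E) := by
        gcongr
        exact hJ.trans (le_self_pow₀ hκ1 (by norm_num))
    _ = _ := by ring

/-- `ψ(m / d, s)` can be reduced to sums under control by at most `n` Buchstab iterations. -/
def Resolvable (t : ℝ) : ℕ → ℕ → ℕ → Prop
  | 0, d, _ => InBilinearRange t d
  | n + 1, d, s => InBilinearRange t d ∨ ((d : ℝ) ≤ t ^ 4 ∧ ⌈t⌉₊ ≤ s ∧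
      ∀ p : ℕ, p.Prime → ⌈t⌉₊ ≤ p → p < s → Resolvable t n (d * p) p)

theorem psiN_eq_sub_sum_antidiagonal (n w s : ℕ) (hn : n ≠ 0) (hws : w ≤ s) :
    psiN n s = psiN n w - ∑ r ∈ n.divisorsAntidiagonal,
      if r.1.Prime ∧ w ≤ r.1 ∧ r.1 < s then psiN r.2 r.1 else 0 := by
  rw [psiN_buchstab n w s hn hws,
    Nat.sum_divisorsAntidiagonal (fun a b => if a.Prime ∧ w ≤ a ∧ a < s then psiN b a else 0),
    ← Finset.sum_filter]
  congr 1
  refine Finset.sum_congr ?_ fun _ _ => rfl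
  ext p
  simp only [Finset.mem_filter, Nat.mem_primeFactors, Nat.mem_divisors]
  tauto

theorem sieveCoeff_add (J : ℕ) (x y : ℕ → ℕ → ℂ) (m : ℕ) :
    sieveCoeff J (fun d s => x d s + y d s) m = sieveCoeff J x m + sieveCoeff J y m := by
  simp only [sieveCoeff, add_mul, Finset.sum_add_distrib]

namespace MinorRegime

variable {α t κ E : ℝ} {J A B : ℕ}

/-- The new state produced by one Buchstab iteration. -/
def buchstabState (J B w : ℕ) (x : ℕ → ℕ → ℂ) (d p s : ℕ) : ℂ :=
  if p.Prime ∧ w ≤ p ∧ d * p ≤ B ∧ s = p then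
    ∑ s' ∈ Finset.range (2 ^ J), if p < s' then x d s' else 0 else 0

theorem sieveCoeff_buchstab (J B w : ℕ) (x : ℕ → ℕ → ℂ) (hB : B < 2 ^ J)
    (hw : ∀ d s, x d s ≠ 0 → w ≤ s) (m : ℕ) (hm : m ≤ B) :
    sieveCoeff J x m = ∑ p ∈ m.divisorsAntidiagonal,
      (∑ s ∈ Finset.range (2 ^ J), x p.1 s) * psiN p.2 w -
      sieveCoeff J (pushState (buchstabState J B w x)) m := by
  rw [sieveCoeff_pushState, sieveCoeff, ← Finset.sum_sub_distrib]
  refine Finset.sum_congr rfl fun p hp => ?_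
  obtain ⟨hpm, hm0⟩ := Nat.mem_divisorsAntidiagonal.1 hp
  have hn0 : p.2 ≠ 0 := fun h0 => hm0 (by rw [← hpm, h0, mul_zero])
  have h1 : ∀ s ∈ Finset.range (2 ^ J), x p.1 s * psiN p.2 s = x p.1 s * psiN p.2 w -
      ∑ r ∈ p.2.divisorsAntidiagonal,
        if r.1.Prime ∧ w ≤ r.1 ∧ r.1 < s then x p.1 s * psiN r.2 r.1 else 0 := by
    intro s _
    by_cases hx : x p.1 s = 0
    · simp [hx]
    · rw [psiN_eq_sub_sum_antidiagonal p.2 w s hn0 (hw _ _ hx), mul_sub, Finset.mul_sum]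
      simp_rw [mul_ite, mul_zero]
  rw [Finset.sum_congr rfl h1, Finset.sum_sub_distrib, Finset.sum_mul]
  congr 1
  rw [Finset.sum_comm]
  refine Finset.sum_congr rfl fun r hr => ?_
  obtain ⟨hrn, -⟩ := Nat.mem_divisorsAntidiagonal.1 hr
  have hdr : p.1 * r.1 ≤ B := by
    refine (Nat.le_of_dvd (Nat.pos_of_ne_zero hm0) ⟨r.2, ?_⟩).trans hm
    rw [← hpm, ← hrn]; ring
  have hr1 : r.1 < 2 ^ J := by
    refine lt_of_le_of_lt (Nat.le_of_dvd (Nat.pos_of_ne_zero hm0) ⟨p.1 * r.2, ?_⟩)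
      (hm.trans_lt hB)
    rw [← hpm, ← hrn]; ring
  by_cases hc : r.1.Prime ∧ w ≤ r.1
  · have h2 : ∀ s, buchstabState J B w x p.1 r.1 s * psiN r.2 s = if s = r.1 then
        (∑ s' ∈ Finset.range (2 ^ J), if r.1 < s' then x p.1 s' else 0) * psiN r.2 s else 0 := by
      intro s
      rw [buchstabState, ite_mul, zero_mul]
      exact if_congr ⟨fun h => h.2.2.2, fun h => ⟨hc.1, hc.2, hdr, h⟩⟩ rfl rfl
    simp_rw [h2]
    rw [Finset.sum_ite_eq', if_pos (Finset.mem_range.2 hr1), Finset.sum_mul]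
    refine Finset.sum_congr rfl fun s _ => ?_
    rw [ite_mul, zero_mul]
    exact if_congr ⟨fun h => h.2.2, fun h => ⟨hc.1, hc.2, h⟩⟩ rfl rfl
  · rw [Finset.sum_eq_zero, Finset.sum_eq_zero]
    · intro s _
      rw [buchstabState, if_neg, zero_mul]
      exact fun h => hc ⟨h.1, h.2.1⟩
    · intro s _
      rw [if_neg]
      exact fun h => hc ⟨h.1, h.2.1⟩

theorem sieve_bound (h : MinorRegime α t κ E J A B) (n : ℕ) : ∀ {K : ℝ}, 0 < K →
    ∀ x : ℕ → ℕ → ℂ, (∀ d, ∑ s ∈ Finset.range (2 ^ J), ‖x d s‖ ≤ K) →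
    (∀ d s : ℕ, x d s ≠ 0 → Resolvable t n d s) →
    ‖∑ m ∈ Finset.Icc A B, sieveCoeff J x m * e (α * (m : ℝ) ^ 2)‖ ≤ K * (κ ^ (2 * n + 5) * E) := by
  have hκ := h.le_κ
  have hκ1 := h.one_le_κ
  have hE0 : 0 < E := by linarith [h.one_le_E]
  have hκ0 : 0 < κ := by linarith
  have hleaf : ∀ {K : ℝ}, 0 < K → ∀ x : ℕ → ℕ → ℂ,
      (∀ d, ∑ s ∈ Finset.range (2 ^ J), ‖x d s‖ ≤ K) →
      (∀ d s : ℕ, x d s ≠ 0 → InBilinearRange t d) →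
      ‖∑ m ∈ Finset.Icc A B, sieveCoeff J x m * e (α * (m : ℝ) ^ 2)‖ ≤ K * (κ ^ 3 * E) :=
    fun hK x hx hs => h.sieve_leaf hK x hx hs
  induction n with
  | zero =>
    intro K hK x hx hs
    refine (hleaf hK x hx hs).trans ?_
    gcongr; norm_num
  | succ n ih =>
    intro K hK x hx hs
    set x₁ : ℕ → ℕ → ℂ := fun d s => if InBilinearRange t d then x d s else 0 with hx₁
    set x₂ : ℕ → ℕ → ℂ := fun d s => if InBilinearRange t d then 0 else x d s with hx₂
    have hx12 : x = fun d s => x₁ d s + x₂ d s := by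
      funext d s
      simp only [hx₁, hx₂]
      split_ifs <;> simp
    have hn₁ : ∀ d s, ‖x₁ d s‖ ≤ ‖x d s‖ := by
      intro d s; simp only [hx₁]; split_ifs <;> simp
    have hn₂ : ∀ d s, ‖x₂ d s‖ ≤ ‖x d s‖ := by
      intro d s; simp only [hx₂]; split_ifs <;> simp
    have hb₁ : ∀ d, ∑ s ∈ Finset.range (2 ^ J), ‖x₁ d s‖ ≤ K := fun d =>
      (Finset.sum_le_sum fun s _ => hn₁ d s).trans (hx d)
    have hb₂ : ∀ d, ∑ s ∈ Finset.range (2 ^ J), ‖x₂ d s‖ ≤ K := fun d =>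
      (Finset.sum_le_sum fun s _ => hn₂ d s).trans (hx d)
    have hr₂ : ∀ d s, x₂ d s ≠ 0 → (d : ℝ) ≤ t ^ 4 ∧ ⌈t⌉₊ ≤ s ∧
        ∀ p : ℕ, p.Prime → ⌈t⌉₊ ≤ p → p < s → Resolvable t n (d * p) p := by
      intro d s h0
      simp only [hx₂] at h0
      by_cases hd : InBilinearRange t d
      · rw [if_pos hd] at h0; exact absurd rfl h0
      · rw [if_neg hd] at h0
        exact (hs d s h0).resolve_left hd
    have c1 := hleaf hK x₁ hb₁ (fun d s h0 => by
      by_contra hd; exact h0 (if_neg hd))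
    have c2 := h.rough_bound hK (fun d => ∑ s ∈ Finset.range (2 ^ J), x₂ d s)
      (fun d => (norm_sum_le _ _).trans (hb₂ d)) (fun d h0 => by
        obtain ⟨s, _, h1⟩ := Finset.exists_ne_zero_of_sum_ne_zero h0
        exact (hr₂ d s h1).1)
    have hKκ : 0 < K * κ := by positivity
    have hphi : ∀ d p, ∑ s ∈ Finset.range (2 ^ J), ‖buchstabState J B ⌈t⌉₊ x₂ d p s‖ ≤ K := by
      intro d p
      calc _ ≤ ∑ s ∈ Finset.range (2 ^ J), if s = p then K else 0 := by
            refine Finset.sum_le_sum fun s _ => ?_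
            rw [buchstabState]
            split_ifs with h1 h2 h2
            · refine (norm_sum_le _ _).trans ((Finset.sum_le_sum fun s' _ => ?_).trans (hb₂ d))
              split_ifs <;> simp
            · exact absurd h1.2.2.2 h2
            · simpa using hK.le
            · simp
        _ ≤ K := by
            rw [Finset.sum_ite_eq']
            split_ifs <;> linarith
    have hBt : (B : ℝ) ≤ (t ^ 7) ^ 4 :=
      h.B_le.trans (le_self_pow₀ (one_le_pow₀ h.one_le_t) (by norm_num))
    have c3 := ih hKκ (pushState (buchstabState J B ⌈t⌉₊ x₂))
      (sum_norm_pushState_le hκ0.le hK.le _ _ h.divisors_le hphi (fun d a s h0 => by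
        by_contra hc
        refine h0 (if_neg fun h1 => hc ?_)
        refine le_trans ?_ hBt
        exact_mod_cast h1.2.2.1)) (fun D s h0 => by
        obtain ⟨d, p, rfl, -, h3⟩ := exists_of_pushState_ne_zero h0
        have hc : p.Prime ∧ ⌈t⌉₊ ≤ p ∧ d * p ≤ B ∧ s = p := by
          by_contra hc; exact h3 (if_neg hc)
        rw [buchstabState, if_pos hc] at h3
        obtain ⟨s', _, h4⟩ := Finset.exists_ne_zero_of_sum_ne_zero h3
        have hps : p < s' := by
          by_contra hps; exact h4 (if_neg hps)
        rw [if_pos hps] at h4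
        rw [hc.2.2.2]
        exact (hr₂ d s' h4).2.2 p hc.1 hc.2.1 hps)
    have e1 : ∑ m ∈ Finset.Icc A B, sieveCoeff J x m * e (α * (m : ℝ) ^ 2) =
        ∑ m ∈ Finset.Icc A B, sieveCoeff J x₁ m * e (α * (m : ℝ) ^ 2) +
        (∑ m ∈ Finset.Icc A B, (∑ p ∈ m.divisorsAntidiagonal,
          (∑ s ∈ Finset.range (2 ^ J), x₂ p.1 s) * psiN p.2 ⌈t⌉₊) * e (α * (m : ℝ) ^ 2) -
        ∑ m ∈ Finset.Icc A B, sieveCoeff J (pushState (buchstabState J B ⌈t⌉₊ x₂)) m *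
          e (α * (m : ℝ) ^ 2)) := by
      rw [← Finset.sum_sub_distrib, ← Finset.sum_add_distrib]
      refine Finset.sum_congr rfl fun m hm => ?_
      rw [← sub_mul, ← sieveCoeff_buchstab J B ⌈t⌉₊ x₂ h.B_lt (fun d s h0 => (hr₂ d s h0).2.1) m
        (Finset.mem_Icc.1 hm).2, ← add_mul, ← sieveCoeff_add, ← hx12]
    rw [e1]
    calc _ ≤ K * (κ ^ 3 * E) + (K * (2 * κ ^ 4 * E) + K * κ * (κ ^ (2 * n + 5) * E)) :=
          (norm_add_le _ _).trans (add_le_add c1 ((norm_sub_le _ _).trans (add_le_add c2 c3)))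
      _ ≤ K * (κ ^ (2 * n + 6) * E) + (K * (2 * κ ^ (2 * n + 6) * E) +
            K * (κ ^ (2 * n + 6) * E)) := by
          have h6 : κ ^ 3 ≤ κ ^ (2 * n + 6) := pow_le_pow_right₀ hκ1 (by omega)
          have h7 : κ ^ 4 ≤ κ ^ (2 * n + 6) := pow_le_pow_right₀ hκ1 (by omega)
          have h8 : K * κ * (κ ^ (2 * n + 5) * E) = K * (κ ^ (2 * n + 6) * E) := by ring
          rw [h8]
          gcongr
      _ = K * (4 * κ ^ (2 * n + 6) * E) := by ring
      _ ≤ K * (κ * κ ^ (2 * n + 6) * E) := by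
          gcongr
          linarith
      _ = _ := by ring

end MinorRegime

theorem resolvable_one_of_lt {t : ℝ} (ht : 1 ≤ t) {d s : ℕ} (h1 : t ^ 2 ≤ (d : ℝ))
    (h2 : (d : ℝ) ≤ t ^ 4) (hs : ⌈t⌉₊ ≤ s) (h3 : (d : ℝ) * s ≤ t ^ 5) : Resolvable t 1 d s := by
  by_cases hd : (d : ℝ) ≤ t ^ 3
  · exact Or.inl (Or.inl ⟨h1, hd⟩)
  · push Not at hd
    refine Or.inr ⟨h2, hs, fun p hp htp hps => Or.inr ?_⟩
    have h4 : t ≤ p := Nat.ceil_le.1 htp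
    push_cast
    constructor
    · calc t ^ 4 = t ^ 3 * t := by ring
        _ ≤ (d : ℝ) * p := by gcongr
    · refine le_trans ?_ h3
      gcongr

theorem resolvable_of_le {t : ℝ} {n d s : ℕ} (h : Resolvable t n d s) : Resolvable t (n + 1) d s := by
  induction n generalizing d s with
  | zero => exact Or.inl h
  | succ n ih =>
    rcases h with h | ⟨h1, h2, h3⟩
    · exact Or.inl h
    · exact Or.inr ⟨h1, h2, fun p hp hw hs => ih (h3 p hp hw hs)⟩

theorem resolvable_unit {t c : ℝ} (ht : 1 ≤ t) (hc0 : 0 ≤ c) (hc : c ^ 3 = t ^ 5) :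
    Resolvable t 3 1 ⌈c⌉₊ := by
  have ht0 : 0 < t := by linarith
  have htc : t ≤ c := by
    refine le_of_pow_le_pow_left₀ (n := 3) (by norm_num) hc0 ?_
    rw [hc]; exact pow_le_pow_right₀ ht (by norm_num)
  have hc2 : c ^ 2 ≤ t ^ 4 := by
    refine le_of_pow_le_pow_left₀ (n := 3) (by norm_num) (by positivity) ?_
    calc (c ^ 2) ^ 3 = (c ^ 3) ^ 2 := by ring
      _ = t ^ 10 := by rw [hc]; ring
      _ ≤ t ^ 12 := pow_le_pow_right₀ ht (by norm_num)
      _ = _ := by ring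
  have hc1 : 1 ≤ c := ht.trans htc
  refine Or.inr ⟨by simpa using one_le_pow₀ ht, Nat.ceil_le_ceil htc, fun p hp htp hps => ?_⟩
  have hpc : (p : ℝ) < c := Nat.lt_ceil.1 hps
  have htp' : t ≤ p := Nat.ceil_le.1 htp
  rw [one_mul]
  refine Or.inr ⟨?_, htp, fun r hr htr hrp => ?_⟩
  · calc (p : ℝ) ≤ c := hpc.le
      _ ≤ c ^ 2 := le_self_pow₀ hc1 (by norm_num)
      _ ≤ _ := hc2
  have htr' : t ≤ r := Nat.ceil_le.1 htr
  have hrp' : (r : ℝ) < p := by exact_mod_cast hrp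
  refine resolvable_one_of_lt ht ?_ ?_ htr ?_ <;> push_cast
  · rw [sq]; gcongr
  · refine le_trans ?_ hc2
    rw [sq]
    have := hrp'.trans hpc
    gcongr
  · rw [← hc, pow_three']
    have := hrp'.trans hpc
    gcongr

theorem resolvable_small {t c z : ℝ} {p : ℕ} (ht : 1 ≤ t) (hc : t ≤ c) (hcp : c ≤ p)
    (hp : (p : ℝ) < t ^ 2) (hz0 : 0 ≤ z) (hz : z ^ 2 * p = t ^ 5) : Resolvable t 3 p ⌈z⌉₊ := by
  have ht0 : 0 < t := by linarith
  have hp0 : (0 : ℝ) < p := by linarith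
  have htz : t ≤ z := by
    refine le_of_pow_le_pow_left₀ (n := 2) (by norm_num) hz0 ?_
    refine le_of_mul_le_mul_right ?_ hp0
    rw [hz]
    calc t ^ 2 * p ≤ t ^ 2 * t ^ 2 := by gcongr
      _ = t ^ 4 := by ring
      _ ≤ _ := pow_le_pow_right₀ ht (by norm_num)
  have hpz : p * z ≤ t ^ 4 := by
    refine le_of_pow_le_pow_left₀ (n := 2) (by norm_num) (by positivity) ?_
    calc (p * z) ^ 2 = p * (z ^ 2 * p) := by ring
      _ = p * t ^ 5 := by rw [hz]
      _ ≤ t ^ 2 * t ^ 5 := by gcongr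
      _ = t ^ 7 := by ring
      _ ≤ t ^ 8 := pow_le_pow_right₀ ht (by norm_num)
      _ = _ := by ring
  refine Or.inr ⟨hp.le.trans (pow_le_pow_right₀ ht (by norm_num)), Nat.ceil_le_ceil htz,
    fun r hr htr hrz => resolvable_of_le ?_⟩
  have htr' : t ≤ r := Nat.ceil_le.1 htr
  have hrz' : (r : ℝ) < z := Nat.lt_ceil.1 hrz
  refine resolvable_one_of_lt ht ?_ ?_ htr ?_ <;> push_cast
  · rw [sq]; gcongr; linarith
  · refine le_trans ?_ hpz
    gcongr
  · rw [← hz]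
    calc (p : ℝ) * r * r = r ^ 2 * p := by ring
      _ ≤ _ := by gcongr

theorem resolvable_middle {t : ℝ} {p s : ℕ} (hp : t ^ 2 ≤ (p : ℝ)) (hp' : (p : ℝ) ≤ t ^ 3) :
    Resolvable t 3 p s := Or.inl (Or.inl ⟨hp, hp'⟩)

theorem resolvable_large {t z : ℝ} {p : ℕ} (ht : 1 ≤ t) (hp : t ^ 3 < (p : ℝ))
    (hp' : (p : ℝ) ≤ t ^ 4) (hz : z * p = t ^ 5) : Resolvable t 3 p ⌈z⌉₊ := by
  have ht0 : 0 < t := by linarith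
  have hp0 : (0 : ℝ) < p := lt_trans (by positivity) hp
  refine Or.inr ⟨hp', Nat.ceil_le_ceil ?_, fun r hr htr hrz => Or.inl (Or.inr ?_)⟩
  · refine le_of_mul_le_mul_right ?_ hp0
    rw [hz]
    calc t * p ≤ t * t ^ 4 := by gcongr
      _ = _ := by ring
  have htr' : t ≤ r := Nat.ceil_le.1 htr
  have hrz' : (r : ℝ) < z := Nat.lt_ceil.1 hrz
  push_cast
  constructor
  · calc t ^ 4 = t ^ 3 * t := by ring
      _ ≤ _ := by gcongr
  · rw [← hz, mul_comm]; gcongr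

/-- The state encoding the weight `rho X`. -/
def rhoState (X : ℝ) (d s : ℕ) : ℂ :=
  if d = 1 then (if s = ⌈X ^ ((5 : ℝ) / 42)⌉₊ then 1 else 0)
  else if (d.Prime ∧ X ^ ((5 : ℝ) / 42) ≤ (d : ℝ) ∧ (d : ℝ) < X ^ ((1 : ℝ) / 4)) ∧ s = ⌈zfun X d⌉₊
    then -1 else 0

theorem psi_eq_psiN (m : ℕ) (z : ℝ) : (psi m z : ℂ) = psiN m ⌈z⌉₊ := by
  rw [psi, psiN]
  simp only [Nat.ceil_le]
  split_ifs <;> simp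

theorem sum_norm_rhoState_le (X : ℝ) (S : Finset ℕ) (d : ℕ) : ∑ s ∈ S, ‖rhoState X d s‖ ≤ 1 := by
  have key : ∀ s₀ : ℕ, (∀ s, ‖rhoState X d s‖ ≤ if s = s₀ then 1 else 0) →
      ∑ s ∈ S, ‖rhoState X d s‖ ≤ 1 := by
    intro s₀ h
    refine (Finset.sum_le_sum fun s _ => h s).trans ?_
    rw [Finset.sum_ite_eq']
    split_ifs <;> norm_num
  by_cases hd : d = 1
  · refine key ⌈X ^ ((5 : ℝ) / 42)⌉₊ fun s => ?_
    rw [rhoState, if_pos hd]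
    split_ifs <;> simp
  · refine key ⌈zfun X d⌉₊ fun s => ?_
    rw [rhoState, if_neg hd]
    split_ifs with h1 h2 h2
    · simp
    · exact absurd h1.2 h2
    · simp
    · simp

theorem rho_eq_sieveCoeff {X : ℝ} {J m : ℕ} (hm : m ≠ 0) (hc : ⌈X ^ ((5 : ℝ) / 42)⌉₊ < 2 ^ J)
    (hz : ∀ p : ℕ, p.Prime → (p : ℝ) < X ^ ((1 : ℝ) / 4) → ⌈zfun X p⌉₊ < 2 ^ J) :
    (rho X m : ℂ) = sieveCoeff J (rhoState X) m := by
  rw [rho, Complex.ofReal_sub, Complex.ofReal_sum, psi_eq_psiN]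
  simp_rw [psi_eq_psiN]
  rw [sieveCoeff, Nat.sum_divisorsAntidiagonal
    (fun d n => ∑ s ∈ Finset.range (2 ^ J), rhoState X d s * psiN n s)]
  have h1 : (1 : ℕ) ∈ m.divisors := Nat.one_mem_divisors.2 hm
  rw [← Finset.add_sum_erase _ _ h1, sub_eq_add_neg]
  congr 1
  · have : ∀ s, rhoState X 1 s * psiN (m / 1) s =
        if s = ⌈X ^ ((5 : ℝ) / 42)⌉₊ then psiN m s else 0 := by
      intro s
      rw [rhoState, if_pos rfl, ite_mul, one_mul, zero_mul, Nat.div_one]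
    simp_rw [this]
    rw [Finset.sum_ite_eq', if_pos (Finset.mem_range.2 hc)]
  · set P : ℕ → Prop := fun p => p.Prime ∧ X ^ ((5 : ℝ) / 42) ≤ (p : ℝ) ∧ (p : ℝ) < X ^ ((1 : ℝ) / 4)
    have h2 : ∀ d ∈ m.divisors.erase 1, ∑ s ∈ Finset.range (2 ^ J), rhoState X d s * psiN (m / d) s =
        if P d then -psiN (m / d) ⌈zfun X d⌉₊ else 0 := by
      intro d hd
      have hd1 : d ≠ 1 := (Finset.mem_erase.1 hd).1
      have h3 : ∀ s, rhoState X d s * psiN (m / d) s =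
          if s = ⌈zfun X d⌉₊ then (if P d then -psiN (m / d) s else 0) else 0 := by
        intro s
        rw [rhoState, if_neg hd1]
        by_cases hP : P d <;> by_cases hs : s = ⌈zfun X d⌉₊
        · rw [if_pos ⟨hP, hs⟩, if_pos hs, if_pos hP]; ring
        · rw [if_neg fun h => hs h.2, if_neg hs, zero_mul]
        · rw [if_neg fun h => hP h.1, if_pos hs, if_neg hP, zero_mul]
        · rw [if_neg fun h => hs h.2, if_neg hs, zero_mul]
      simp_rw [h3]
      rw [Finset.sum_ite_eq']
      by_cases hP : P d
      · rw [if_pos (Finset.mem_range.2 (hz d hP.1 hP.2.2))]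
      · simp [hP]
    rw [Finset.sum_congr rfl h2, ← Finset.sum_filter, Finset.sum_neg_distrib]
    congr 1
    refine Finset.sum_congr ?_ fun _ _ => rfl
    ext p
    simp only [Finset.mem_filter, Finset.mem_range, Finset.mem_erase, Nat.mem_divisors]
    constructor
    · rintro ⟨-, h1, h2, h3, h4⟩
      exact ⟨⟨h1.one_lt.ne', h4, hm⟩, h1, h2, h3⟩
    · rintro ⟨⟨h1, h2, h3⟩, h4, h5, h6⟩
      refine ⟨?_, h4, h5, h6, h2⟩
      have : (p : ℝ) ≤ ⌈X ^ ((1 : ℝ) / 4)⌉₊ := h6.le.trans (Nat.le_ceil _)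
      have : p ≤ ⌈X ^ ((1 : ℝ) / 4)⌉₊ := by exact_mod_cast this
      omega

theorem resolvable_rhoState {t : ℝ} (ht : 1 ≤ t) {d s : ℕ} (h : rhoState (t ^ 14) d s ≠ 0) :
    Resolvable t 3 d s := by
  have ht0 : 0 < t := by linarith
  have hpow : ∀ r : ℝ, (t ^ 14 : ℝ) ^ r = t ^ (14 * r) := fun r => by
    rw [← Real.rpow_natCast, ← Real.rpow_mul ht0.le]; norm_num
  set c := (t ^ 14 : ℝ) ^ ((5 : ℝ) / 42) with hc
  have hc0 : 0 ≤ c := by positivity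
  have hc3 : c ^ 3 = t ^ 5 := by
    rw [hc, hpow, ← Real.rpow_natCast, ← Real.rpow_natCast, ← Real.rpow_mul ht0.le]; norm_num
  have htc : t ≤ c := by
    refine le_of_pow_le_pow_left₀ (n := 3) (by norm_num) hc0 ?_
    rw [hc3]; exact pow_le_pow_right₀ ht (by norm_num)
  rw [rhoState] at h
  split_ifs at h with h1 h2 h3
  · subst h1 h2
    exact resolvable_unit ht hc0 hc3
  · exact absurd rfl h
  · obtain ⟨⟨hp, hcp, hp4⟩, rfl⟩ := h3
    have hd0 : (0 : ℝ) < d := by exact_mod_cast hp.pos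
    have e7 : (t ^ 14 : ℝ) ^ ((1 : ℝ) / 7) = t ^ 2 := by
      rw [hpow, ← Real.rpow_natCast]; norm_num
    have e3 : (t ^ 14 : ℝ) ^ ((3 : ℝ) / 14) = t ^ 3 := by
      rw [hpow, ← Real.rpow_natCast]; norm_num
    have e5 : (t ^ 14 : ℝ) ^ ((5 : ℝ) / 14) = t ^ 5 := by
      rw [hpow, ← Real.rpow_natCast]; norm_num
    rw [zfun, e7, e3, e5]
    split_ifs with h4 h5
    · refine resolvable_small ht htc hcp h4 (by positivity) ?_
      rw [mul_pow, hpow, ← Real.rpow_natCast, ← Real.rpow_natCast, ← Real.rpow_mul ht0.le,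
        ← Real.rpow_mul hd0.le, mul_assoc]
      have e1 : (d : ℝ) ^ (-1 / 2 * ((2 : ℕ) : ℝ)) * (d : ℝ) = 1 := by
        rw [show (-1 / 2 * ((2 : ℕ) : ℝ)) = -1 by norm_num, Real.rpow_neg_one,
          inv_mul_cancel₀ hd0.ne']
      rw [e1, mul_one, ← Real.rpow_natCast]
      norm_num
    · exact resolvable_middle (not_lt.1 h4) h5
    · refine resolvable_large ht (not_le.1 h5) ?_ (by field_simp)
      refine hp4.le.trans ?_
      rw [hpow, ← Real.rpow_natCast]
      exact Real.rpow_le_rpow_of_exponent_le ht (by norm_num)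
  · exact absurd rfl h

theorem zfun_le {t : ℝ} (ht : 1 ≤ t) {p : ℕ} (hp : p.Prime) : zfun (t ^ 14) p ≤ t ^ 5 := by
  have ht0 : 0 < t := by linarith
  have hpow : ∀ r : ℝ, (t ^ 14 : ℝ) ^ r = t ^ (14 * r) := fun r => by
    rw [← Real.rpow_natCast, ← Real.rpow_mul ht0.le]; norm_num
  have hd1 : (1 : ℝ) ≤ p := by exact_mod_cast hp.one_le
  have h5 : (t : ℝ) ^ 5 = t ^ (5 : ℝ) := by rw [← Real.rpow_natCast]; norm_num
  rw [zfun, hpow, hpow, hpow, hpow, h5]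
  split_ifs with h1 h2
  · calc _ ≤ t ^ (5 : ℝ) * 1 := by
          refine mul_le_mul (Real.rpow_le_rpow_of_exponent_le ht (by norm_num))
            (Real.rpow_le_one_of_one_le_of_nonpos hd1 (by norm_num)) (by positivity) (by positivity)
      _ = _ := mul_one _
  · exact h2.trans (Real.rpow_le_rpow_of_exponent_le ht (by norm_num))
  · calc _ ≤ t ^ (5 : ℝ) * 1 := by
          refine mul_le_mul (Real.rpow_le_rpow_of_exponent_le ht (by norm_num))
            (inv_le_one_of_one_le₀ hd1) (by positivity) (by positivity)
      _ = _ := mul_one _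

/-- The bound for sums weighted by `rho` at a point without good rational approximations. -/
theorem MinorRegime.rho_bound {α t κ E : ℝ} {J A B : ℕ} (h : MinorRegime α t κ E J A B) :
    ‖∑ m ∈ Finset.Icc A B, (rho (t ^ 14) m : ℂ) * e (α * (m : ℝ) ^ 2)‖ ≤ κ ^ 11 * E := by
  have ht := h.one_le_t
  have ht0 : 0 < t := by linarith
  have hlt : ∀ z : ℝ, z ≤ t ^ 5 → ⌈z⌉₊ < 2 ^ J := by
    intro z hz
    have h1 : (⌈z⌉₊ : ℝ) < t ^ 5 + 1 :=
      lt_of_le_of_lt (Nat.cast_le.2 (Nat.ceil_le_ceil hz)) (Nat.ceil_lt_add_one (by positivity))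
    have h2 : t ^ 5 + 1 ≤ 2 ^ J := by
      refine le_trans ?_ h.le_two_pow
      have h3 : (1 : ℝ) ≤ t ^ 5 := one_le_pow₀ ht
      have h4 : (2 : ℝ) ≤ t ^ 9 := h.two_le.trans (le_self_pow₀ ht (by norm_num))
      calc t ^ 5 + 1 ≤ t ^ 5 * 2 := by linarith
        _ ≤ t ^ 5 * t ^ 9 := by gcongr
        _ = _ := by ring
    exact_mod_cast h1.trans_le h2
  have e1 : ∀ m ∈ Finset.Icc A B, (rho (t ^ 14) m : ℂ) * e (α * (m : ℝ) ^ 2) =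
      sieveCoeff J (rhoState (t ^ 14)) m * e (α * (m : ℝ) ^ 2) := by
    intro m hm
    have hm0 : m ≠ 0 := by have := h.one_le_A; rw [Finset.mem_Icc] at hm; omega
    rw [rho_eq_sieveCoeff hm0 (hlt _ ?_) (fun p hp _ => hlt _ (zfun_le ht hp))]
    rw [← Real.rpow_natCast, ← Real.rpow_natCast, ← Real.rpow_mul ht0.le]
    exact Real.rpow_le_rpow_of_exponent_le ht (by norm_num)
  rw [Finset.sum_congr rfl e1]
  refine (h.sieve_bound 3 one_pos (rhoState (t ^ 14)) (sum_norm_rhoState_le _ _)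
    fun d s h0 => resolvable_rhoState ht h0).trans ?_
  norm_num

theorem exists_card_divisors_le {ε : ℝ} (hε : 0 < ε) :
    ∃ C : ℝ, 1 ≤ C ∧ ∀ n : ℕ, 1 ≤ n → (n.divisors.card : ℝ) ≤ C * (n : ℝ) ^ ε := by
  set N : ℕ := ⌈(2 : ℝ) ^ (1 / ε)⌉₊ with hN
  set M : ℝ := max 1 (1 / (ε * Real.log 2)) with hM
  have hl2 : 0 < Real.log 2 := Real.log_pos (by norm_num)
  have hM1 : 1 ≤ M := le_max_left _ _
  refine ⟨M ^ N, one_le_pow₀ hM1, fun n hn => ?_⟩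
  have hn0 : n ≠ 0 := by omega
  have hlocal : ∀ p ∈ n.primeFactors, ((n.factorization p + 1 : ℕ) : ℝ) ≤
      (if p < N then M else 1) * ((p : ℝ) ^ (n.factorization p)) ^ ε := by
    intro p hp
    have hpp := Nat.prime_of_mem_primeFactors hp
    set k := n.factorization p
    have hp2 : (2 : ℝ) ≤ p := by exact_mod_cast hpp.two_le
    have hp0 : (0 : ℝ) < p := by linarith
    split_ifs with hpN
    · have h1 : 1 + k * (ε * Real.log 2) ≤ ((p : ℝ) ^ k) ^ ε := by
        calc 1 + k * (ε * Real.log 2) ≤ Real.exp (k * (ε * Real.log 2)) := by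
              linarith [Real.add_one_le_exp (k * (ε * Real.log 2))]
          _ = ((2 : ℝ) ^ k) ^ ε := by
              rw [Real.rpow_def_of_pos (by positivity), Real.log_pow]; congr 1; ring
          _ ≤ _ := by gcongr
      refine le_trans ?_ (mul_le_mul_of_nonneg_left h1 (by linarith))
      have h2 : 1 / (ε * Real.log 2) ≤ M := le_max_right _ _
      rw [div_le_iff₀ (by positivity)] at h2
      push_cast
      have hk : (0 : ℝ) ≤ k := Nat.cast_nonneg k
      nlinarith
    · rw [one_mul]
      have h1 : (2 : ℝ) ≤ (p : ℝ) ^ ε := by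
        have : (2 : ℝ) ^ (1 / ε) ≤ p := by
          refine (Nat.le_ceil _).trans ?_
          exact_mod_cast not_lt.1 hpN
        calc (2 : ℝ) = ((2 : ℝ) ^ (1 / ε)) ^ ε := by
              rw [← Real.rpow_mul (by norm_num), one_div_mul_cancel hε.ne', Real.rpow_one]
          _ ≤ _ := by gcongr
      rw [← Real.rpow_natCast, ← Real.rpow_mul hp0.le, mul_comm, Real.rpow_mul hp0.le,
        Real.rpow_natCast]
      have h2 : k + 1 ≤ 2 ^ k := Nat.lt_two_pow_self
      calc ((k + 1 : ℕ) : ℝ) ≤ ((2 ^ k : ℕ) : ℝ) := by exact_mod_cast h2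
        _ = 2 ^ k := by push_cast; rfl
        _ ≤ _ := by gcongr
  have hprod : ∏ p ∈ n.primeFactors, ((p : ℝ) ^ (n.factorization p)) ^ ε = (n : ℝ) ^ ε := by
    rw [Real.finsetProd_rpow _ _ fun p _ => by positivity]
    congr 1
    have := Nat.prod_factorization_pow_eq_self hn0
    rw [Finsupp.prod, Nat.support_factorization] at this
    exact_mod_cast this
  have hM2 : ∏ p ∈ n.primeFactors, (if p < N then M else 1) ≤ M ^ N := by
    rw [← Finset.prod_filter, Finset.prod_const]
    refine pow_le_pow_right₀ hM1 ?_
    calc _ ≤ (Finset.range N).card := Finset.card_le_card fun p hp => by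
          rw [Finset.mem_range]; exact (Finset.mem_filter.1 hp).2
      _ = N := Finset.card_range N
  rw [Nat.card_divisors hn0]
  push_cast
  calc _ ≤ ∏ p ∈ n.primeFactors, (if p < N then M else 1) * ((p : ℝ) ^ (n.factorization p)) ^ ε :=
        Finset.prod_le_prod (fun _ _ => by positivity) fun p hp => by exact_mod_cast hlocal p hp
    _ = (∏ p ∈ n.primeFactors, (if p < N then M else 1)) * (n : ℝ) ^ ε := by
        rw [Finset.prod_mul_distrib, hprod]
    _ ≤ _ := by gcongr

open Filter in
theorem exists_approx_of_large_Stilde {δ ε : ℝ} (hδ : 0 < δ) (hε : 0 < ε) :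
    ∀ᶠ X : ℝ in atTop, ∀ Z : ℝ, X ^ (3 / 7 + ε) ≤ Z → ∀ α : ℝ, Z < ‖Stilde δ X α‖ →
      ∃ q : ℕ, ∃ a : ℤ, 1 ≤ q ∧ q * Z ^ 4 ≤ X ^ ε * X ^ 2 ∧ |q * α - a| * Z ^ 4 ≤ X ^ ε * X := by
  set η := ε / 53 with hη
  have hη0 : 0 < η := by positivity
  obtain ⟨C, hC1, hC⟩ := exists_card_divisors_le (show 0 < η / 4 by positivity)
  have hη2 := tendsto_rpow_atTop (show 0 < η / 2 by positivity)
  have hη1 := tendsto_rpow_atTop hη0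
  have hlog := (isLittleO_log_rpow_atTop hη0).bound (show (0 : ℝ) < 1 / 4 by norm_num)
  have ht2 := tendsto_rpow_atTop (show (0 : ℝ) < 1 / 14 by norm_num)
  filter_upwards [eventually_ge_atTop 1, hη2.eventually_ge_atTop C,
    hη1.eventually_ge_atTop (2 ^ 60), hη1.eventually_ge_atTop (1 / √δ), hlog,
    ht2.eventually_ge_atTop 2] with X hX1 hXC hX60 hXδ hXlog hXt Z hZ α hZα
  have hX0 : 0 < X := by linarith
  set κ := X ^ η with hκ
  set t := X ^ ((1 : ℝ) / 14) with ht
  have ht0 : 0 < t := by positivity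
  have ht14 : t ^ 14 = X := by
    rw [ht, ← Real.rpow_natCast, ← Real.rpow_mul hX0.le]; norm_num
  have hκ0 : 0 < κ := by positivity
  have hκ1 : 1 ≤ κ := by linarith
  have hZ0 : 0 < Z := lt_of_lt_of_le (by positivity) hZ
  have hκε : κ ^ 53 = X ^ ε := by
    rw [hκ, ← Real.rpow_natCast, ← Real.rpow_mul hX0.le, hη]; congr 1; push_cast; ring
  set J : ℕ := ⌈2 * Real.log X⌉₊ + 1 with hJ
  set s := (Finset.range (⌈X⌉₊ + 1)).filter
      (fun m : ℕ => δ * X ≤ (m : ℝ) ^ 2 ∧ (m : ℝ) ^ 2 ≤ X) with hs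
  obtain ⟨A, B, hAB⟩ := exists_eq_Icc s (fun x hx z hz y hxy hyz => by
    rw [hs, Finset.mem_filter, Finset.mem_range] at hx hz ⊢
    have h1 : (x : ℝ) ≤ y := by exact_mod_cast hxy
    have h2 : (y : ℝ) ≤ z := by exact_mod_cast hyz
    refine ⟨by omega, hx.2.1.trans (by gcongr), le_trans (by gcongr) hz.2.2⟩)
  have hS : Stilde δ X α = ∑ m ∈ Finset.Icc A B, (rho (t ^ 14) m : ℂ) * e (α * (m : ℝ) ^ 2) := by
    rw [Stilde, ← hs, hAB, ht14]
    exact Finset.sum_congr rfl fun m _ => by rw [mul_comm α]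
  have hle : A ≤ B := by
    by_contra hlt
    rw [hS, Finset.Icc_eq_empty hlt, Finset.sum_empty, norm_zero] at hZα
    linarith
  have hAs : A ∈ s := by rw [hAB]; exact Finset.left_mem_Icc.2 hle
  have hBs : B ∈ s := by rw [hAB]; exact Finset.right_mem_Icc.2 hle
  have hA := (Finset.mem_filter.1 hAs).2.1
  have hB := (Finset.mem_filter.1 hBs).2.2
  have ht7 : (t ^ 7) ^ 2 = X := by rw [← pow_mul, ht14]
  by_contra hno
  have hreg : MinorRegime α t κ (Z / κ ^ 11) J A B := by
    refine ⟨hXt, by omega, ?_, ?_, hX60, ?_, ?_, ?_, ?_, ?_⟩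
    · have h1 := Nat.ceil_lt_add_one (show 0 ≤ 2 * Real.log X by
        have := Real.log_nonneg hX1; positivity)
      rw [Real.norm_of_nonneg (Real.log_nonneg hX1), Real.norm_of_nonneg (by positivity)] at hXlog
      rw [hJ]; push_cast
      linarith
    · rw [ht7]
      have h1 := Nat.le_ceil (2 * Real.log X)
      have h2 : (⌈2 * Real.log X⌉₊ : ℝ) ≤ J := by rw [hJ]; push_cast; linarith
      calc X = Real.exp (Real.log X) := (Real.exp_log hX0).symm
        _ ≤ Real.exp (Real.log 2 * J) := by
            rw [Real.exp_le_exp]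
            have := Real.log_two_gt_d9
            have := Real.log_nonneg hX1
            nlinarith
        _ = 2 ^ J := by rw [mul_comm, Real.exp_nat_mul, Real.exp_log (by norm_num)]
    · intro k hk hkX
      have h1 : (k : ℝ) ≤ X ^ (2 : ℝ) := by
        rw [Real.rpow_two, ← ht7, ← pow_mul]; exact hkX
      calc _ ≤ C * (k : ℝ) ^ (η / 4) := hC k hk
        _ ≤ X ^ (η / 2) * (X ^ (2 : ℝ)) ^ (η / 4) := by gcongr
        _ = κ := by
            rw [← Real.rpow_mul hX0.le, ← Real.rpow_add hX0, hκ]; congr 1; ring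
    · refine le_of_pow_le_pow_left₀ (n := 2) (by norm_num) (by positivity) ?_
      rw [ht7]
      have hsq : 0 < √δ := Real.sqrt_pos.2 hδ
      rw [div_le_iff₀ hsq] at hXδ
      calc X = 1 * X := by ring
        _ ≤ (κ * √δ) ^ 2 * X := by gcongr; exact one_le_pow₀ hXδ
        _ = κ ^ 2 * (δ * X) := by rw [mul_pow, Real.sq_sqrt hδ.le]; ring
        _ ≤ κ ^ 2 * (A : ℝ) ^ 2 := by gcongr
        _ = _ := by ring
    · refine le_of_pow_le_pow_left₀ (n := 2) (by norm_num) (by positivity) ?_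
      rw [ht7]; exact hB
    · rw [le_div_iff₀ (by positivity)]
      refine le_trans ?_ hZ
      calc κ ^ 4 * t ^ 6 * κ ^ 11 = κ ^ 15 * t ^ 6 := by ring
        _ ≤ κ ^ 53 * t ^ 6 := by gcongr; norm_num
        _ = X ^ (3 / 7 + ε) := by
            rw [hκε, ht, ← Real.rpow_natCast (X ^ ((1 : ℝ) / 14)), ← Real.rpow_mul hX0.le,
              ← Real.rpow_add hX0]
            congr 1; push_cast; ring
    · rintro ⟨q, a, hq, h1, h2⟩
      refine hno ⟨q, a, hq, ?_, ?_⟩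
      · rw [div_pow, ← mul_div_assoc, div_le_iff₀ (by positivity)] at h1
        rw [← hκε, ← ht7]
        calc _ ≤ _ := h1
          _ = _ := by ring
      · rw [div_pow, ← mul_div_assoc, div_le_iff₀ (by positivity)] at h2
        rw [← hκε]
        calc _ ≤ _ := h2
          _ = κ ^ 53 * (t ^ 7) ^ 2 := by ring
          _ = _ := by rw [ht7]
  have := hreg.rho_bound
  rw [← hS, mul_div_cancel₀ _ (by positivity)] at this
  linarith

open GenContFract in
theorem exists_int_contsAux_of (v : ℝ) (n : ℕ) :
    ∃ a b : ℤ, (GenContFract.of v).contsAux n = ⟨a, b⟩ := by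
  have key : ∀ n : ℕ, (∃ a b : ℤ, (GenContFract.of v).contsAux n = ⟨a, b⟩) ∧
      ∃ a b : ℤ, (GenContFract.of v).contsAux (n + 1) = ⟨a, b⟩ := by
    intro n
    induction n with
    | zero =>
      refine ⟨⟨1, 0, by simp [contsAux]⟩, ⟨⌊v⌋, 1, by simp [contsAux, of_h_eq_floor]⟩⟩
    | succ n ih =>
      refine ⟨ih.2, ?_⟩
      obtain ⟨⟨a, b, hab⟩, ⟨c, d, hcd⟩⟩ := ih
      cases hs : (GenContFract.of v).s.get? n with
      | none =>
        exact ⟨c, d, by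
          rw [contsAux_stable_step_of_terminated (g := GenContFract.of v) (n := n) hs, hcd]⟩
      | some gp =>
        obtain ⟨h1, z, hz⟩ := of_partNum_eq_one_and_exists_int_partDen_eq hs
        refine ⟨z * c + a, z * d + b, ?_⟩
        rw [contsAux_recurrence hs hab hcd, h1, hz]
        push_cast
        simp
  exact (key n).1

theorem exists_isCoprime_abs_sub_div_le {v : ℝ} (hv : Irrational v) {q n : ℕ} (hq : 1 ≤ q)
    (hqn : (q : ℝ) = (GenContFract.of v).dens n) :
    ∃ a : ℤ, IsCoprime a (q : ℤ) ∧ |v - a / q| ≤ 1 / (q : ℝ) ^ 2 := by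
  have hnt : ¬ (GenContFract.of v).TerminatedAt n := by
    intro h
    have : (GenContFract.of v).Terminates := ⟨n, h⟩
    rw [GenContFract.terminates_iff_rat] at this
    obtain ⟨r, hr⟩ := this
    exact hv ⟨r, hr.symm⟩
  obtain ⟨a, b, hab⟩ := exists_int_contsAux_of v (n + 1)
  obtain ⟨c, d, hcd⟩ := exists_int_contsAux_of v (n + 2)
  have hnum : (GenContFract.of v).nums n = a := by
    rw [GenContFract.num_eq_conts_a, GenContFract.nth_cont_eq_succ_nth_contAux, hab]
  have hden : (GenContFract.of v).dens n = b := by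
    rw [GenContFract.den_eq_conts_b, GenContFract.nth_cont_eq_succ_nth_contAux, hab]
  have hnum' : (GenContFract.of v).nums (n + 1) = c := by
    rw [GenContFract.num_eq_conts_a, GenContFract.nth_cont_eq_succ_nth_contAux, hcd]
  have hden' : (GenContFract.of v).dens (n + 1) = d := by
    rw [GenContFract.den_eq_conts_b, GenContFract.nth_cont_eq_succ_nth_contAux, hcd]
  have hbq : b = (q : ℤ) := by
    have : (b : ℝ) = q := by rw [hqn, hden]
    exact_mod_cast this
  have hdet := SimpContFract.determinant (s := SimpContFract.of v) (n := n) hnt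
  have hdet' : (a : ℝ) * d - b * c = (-1) ^ (n + 1) := by
    rw [← hnum, ← hden, ← hnum', ← hden']; exact hdet
  have hdetz : a * d - b * c = (-1) ^ (n + 1) := by exact_mod_cast hdet'
  refine ⟨a, ?_, ?_⟩
  · rw [← hbq]
    refine ⟨(-1) ^ (n + 1) * d, -(-1) ^ (n + 1) * c, ?_⟩
    have h1 : ((-1 : ℤ) ^ (n + 1)) * (-1) ^ (n + 1) = 1 := by
      rw [← mul_pow]; simp
    linear_combination (-1) ^ (n + 1) * hdetz + h1
  · have h1 := GenContFract.abs_sub_convs_le (v := v) (n := n) hnt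
    rw [GenContFract.conv_eq_num_div_den, hnum, ← hqn] at h1
    refine h1.trans ?_
    have h2 : (GenContFract.of v).dens n ≤ (GenContFract.of v).dens (n + 1) :=
      GenContFract.of_den_mono
    rw [← hqn] at h2
    have hq0 : (0 : ℝ) < q := by exact_mod_cast hq
    rw [sq]
    gcongr

/-- A denominator of a convergent repels small multiples of `v` from the integers. -/
theorem inv_le_abs_mul_sub_of_convergent {v : ℝ} (hv : Irrational v) {q n : ℕ} (hq : 1 ≤ q)
    (hqn : (q : ℝ) = (GenContFract.of v).dens n) {N : ℤ} (M : ℤ) (hN : N ≠ 0)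
    (hNq : 2 * |N| ≤ q) : 1 / (2 * q : ℝ) ≤ |N * v - M| := by
  obtain ⟨a, hco, ha⟩ := exists_isCoprime_abs_sub_div_le hv hq hqn
  have hq0 : (0 : ℝ) < q := by exact_mod_cast hq
  have hne : N * a - M * q ≠ 0 := by
    intro h
    have h1 : (q : ℤ) ∣ N * a := ⟨M, by linarith⟩
    have h2 : (q : ℤ) ∣ N := hco.symm.dvd_of_dvd_mul_right h1
    have h3 := Int.le_of_dvd (abs_pos.mpr hN) ((dvd_abs _ _).mpr h2)
    have := abs_pos.mpr hN
    omega
  have h1 : (1 : ℝ) ≤ |(N : ℝ) * a - M * q| := by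
    have := Int.one_le_abs hne
    exact_mod_cast this
  have h2 : 1 / (q : ℝ) ≤ |(N : ℝ) * (a / q) - M| := by
    have : (N : ℝ) * (a / q) - M = ((N : ℝ) * a - M * q) / q := by field_simp
    rw [this, abs_div, abs_of_pos hq0]
    gcongr
  have h3 : |(N : ℝ)| * |v - a / q| ≤ 1 / (2 * q) := by
    have hN' : 2 * |(N : ℝ)| ≤ q := by exact_mod_cast hNq
    calc |(N : ℝ)| * |v - a / q| ≤ (q / 2) * (1 / (q : ℝ) ^ 2) := by
          gcongr; linarith
      _ = 1 / (2 * q) := by field_simp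
  have h4 : |(N : ℝ) * (a / q) - M| ≤ |N * v - M| + |(N : ℝ)| * |v - a / q| := by
    rw [← abs_mul]
    calc |(N : ℝ) * (a / q) - M| = |(N * v - M) - N * (v - a / q)| := by ring_nf
      _ ≤ _ := abs_sub _ _
  have h5 : 1 / (q : ℝ) = 1 / (2 * q) + 1 / (2 * q) := by field_simp; norm_num
  linarith

theorem sum_inv_sqrt_le (K : ℕ) : ∑ k ∈ Finset.Icc 1 K, 1 / √(k : ℝ) ≤ 2 * √(K : ℝ) := by
  induction K with
  | zero => simp
  | succ K ih =>
    rw [Finset.sum_Icc_succ_top (by omega)]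
    have h0 : (0 : ℝ) ≤ K := Nat.cast_nonneg K
    set s := √(K : ℝ)
    set t := √((K + 1 : ℕ) : ℝ) with ht
    have hs : s ^ 2 = K := Real.sq_sqrt h0
    have ht2 : t ^ 2 = K + 1 := by rw [ht, Real.sq_sqrt (by positivity)]; push_cast; ring
    have htp : 0 < t := Real.sqrt_pos.mpr (by positivity)
    have : 1 / t ≤ 2 * t - 2 * s := by
      rw [div_le_iff₀ htp]
      nlinarith [sq_nonneg (t - s)]
    linarith

theorem sum_inv_sqrt_le_of_spaced_nat (F : Finset ℕ) {q : ℕ} {V : ℝ} (hq : 1 ≤ q) (hV : 0 ≤ V)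
    (hF : ∀ n ∈ F, (n : ℝ) ≤ V) (h0 : ∀ n ∈ F, q < 2 * n)
    (hsp : ∀ n ∈ F, ∀ m ∈ F, n < m → q < 2 * (m - n)) :
    ∑ n ∈ F, 1 / √(n : ℝ) ≤ 4 * √V / q := by
  have hq0 : (0 : ℝ) < q := by exact_mod_cast hq
  have hinj : ∀ n ∈ F, ∀ m ∈ F, 2 * n / q = 2 * m / q → n = m := by
    intro n hn m hm h
    have a1 := Nat.div_add_mod (2 * n) q
    have a2 := Nat.div_add_mod (2 * m) q
    have b1 := Nat.mod_lt (2 * n) hq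
    have b2 := Nat.mod_lt (2 * m) hq
    rw [h] at a1
    rcases lt_trichotomy n m with hlt | heq | hlt
    · have := hsp n hn m hm hlt; omega
    · exact heq
    · have := hsp m hm n hn hlt; omega
  have hpt : ∀ n ∈ F, 1 / √(n : ℝ) ≤ √(2 / q) * (1 / √((2 * n / q : ℕ) : ℝ)) := by
    intro n hn
    have hk : 1 ≤ 2 * n / q := (Nat.one_le_div_iff hq).mpr (h0 n hn).le
    have hk0 : (0 : ℝ) < ((2 * n / q : ℕ) : ℝ) := by exact_mod_cast hk
    have hle : ((2 * n / q : ℕ) : ℝ) * q ≤ 2 * n := by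
      exact_mod_cast Nat.div_mul_le_self (2 * n) q
    have hn0 : (0 : ℝ) < n := by
      have := h0 n hn
      have : 0 < n := by omega
      exact_mod_cast this
    rw [← Real.sqrt_one, ← Real.sqrt_div zero_le_one, ← Real.sqrt_div zero_le_one,
      ← Real.sqrt_mul (by positivity)]
    apply Real.sqrt_le_sqrt
    rw [div_mul_div_comm, div_le_div_iff₀ hn0 (by positivity)]
    linarith
  calc ∑ n ∈ F, 1 / √(n : ℝ) ≤ ∑ n ∈ F, √(2 / q) * (1 / √((2 * n / q : ℕ) : ℝ)) :=
        Finset.sum_le_sum hpt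
    _ = √(2 / q) * ∑ k ∈ F.image (fun n => 2 * n / q), 1 / √(k : ℝ) := by
        rw [Finset.sum_image (fun n hn m hm h => hinj n hn m hm h), Finset.mul_sum]
    _ ≤ √(2 / q) * ∑ k ∈ Finset.Icc 1 ⌊2 * V / q⌋₊, 1 / √(k : ℝ) := by
        refine mul_le_mul_of_nonneg_left (Finset.sum_le_sum_of_subset_of_nonneg ?_
          (fun k _ _ => by positivity)) (Real.sqrt_nonneg _)
        intro k hk
        rw [Finset.mem_image] at hk
        obtain ⟨n, hn, rfl⟩ := hk
        rw [Finset.mem_Icc]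
        refine ⟨(Nat.one_le_div_iff hq).mpr (h0 n hn).le, Nat.le_floor ?_⟩
        refine Nat.cast_div_le.trans ?_
        push_cast
        have := hF n hn
        gcongr
    _ ≤ √(2 / q) * (2 * √(2 * V / q)) := by
        refine mul_le_mul_of_nonneg_left ((sum_inv_sqrt_le _).trans ?_) (Real.sqrt_nonneg _)
        gcongr
        exact Nat.floor_le (by positivity)
    _ = 4 * √V / q := by
        rw [mul_left_comm, ← Real.sqrt_mul (by positivity)]
        have : 2 / (q : ℝ) * (2 * V / q) = (2 / q) ^ 2 * V := by field_simp
        rw [this, Real.sqrt_mul (by positivity), Real.sqrt_sq (by positivity)]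
        ring

theorem sum_inv_sqrt_le_of_spaced (F : Finset ℤ) {q : ℕ} {V : ℝ} (hq : 1 ≤ q) (hV : 0 ≤ V)
    (hF : ∀ n ∈ F, |(n : ℝ)| ≤ V) (h0 : ∀ n ∈ F, (q : ℤ) < 2 * |n|)
    (hsp : ∀ n ∈ F, ∀ m ∈ F, n ≠ m → (q : ℤ) < 2 * |n - m|) :
    ∑ n ∈ F, 1 / √|(n : ℝ)| ≤ 8 * √V / q := by
  have key : ∀ G ⊆ F, (∀ n ∈ G, ∀ m ∈ G, |n - m| = |(n.natAbs : ℤ) - m.natAbs|) →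
      ∑ n ∈ G, 1 / √|(n : ℝ)| ≤ 4 * √V / q := by
    intro G hG habs
    have hinj : Set.InjOn Int.natAbs (G : Set ℤ) := by
      intro n hn m hm h
      have := habs n hn m hm
      rw [h, sub_self, abs_zero, abs_eq_zero, sub_eq_zero] at this
      exact this
    have hcast : ∀ n : ℤ, |(n : ℝ)| = (n.natAbs : ℝ) := fun n => by
      rw [Nat.cast_natAbs, Int.cast_abs]
    have : ∑ n ∈ G, 1 / √|(n : ℝ)| = ∑ k ∈ G.image Int.natAbs, 1 / √(k : ℝ) := by
      rw [Finset.sum_image hinj]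
      exact Finset.sum_congr rfl fun n _ => by rw [hcast]
    rw [this]
    refine sum_inv_sqrt_le_of_spaced_nat _ hq hV ?_ ?_ ?_
    · intro k hk
      obtain ⟨n, hn, rfl⟩ := Finset.mem_image.mp hk
      rw [← hcast]; exact hF n (hG hn)
    · intro k hk
      obtain ⟨n, hn, rfl⟩ := Finset.mem_image.mp hk
      have := h0 n (hG hn)
      rw [Int.abs_eq_natAbs] at this
      omega
    · intro k hk l hl hkl
      obtain ⟨n, hn, rfl⟩ := Finset.mem_image.mp hk
      obtain ⟨m, hm, rfl⟩ := Finset.mem_image.mp hl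
      have h1 := hsp n (hG hn) m (hG hm) (by rintro rfl; omega)
      rw [habs n hn m hm, Int.abs_eq_natAbs] at h1
      omega
  rw [← Finset.sum_filter_add_sum_filter_not F (fun n => 0 < n)]
  have e1 := key (F.filter (fun n => 0 < n)) (Finset.filter_subset _ _) (by
    intro n hn m hm
    have a := (Finset.mem_filter.mp hn).2
    have b := (Finset.mem_filter.mp hm).2
    rw [Int.natAbs_of_nonneg a.le, Int.natAbs_of_nonneg b.le])
  have e2 := key (F.filter (fun n => ¬ 0 < n)) (Finset.filter_subset _ _) (by
    intro n hn m hm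
    have a := (Finset.mem_filter.mp hn).2
    have b := (Finset.mem_filter.mp hm).2
    rw [Int.abs_eq_natAbs, Int.abs_eq_natAbs]
    omega)
  have : 8 * √V / (q : ℝ) = 4 * √V / q + 4 * √V / q := by ring
  linarith

theorem volume_affine_le {a : ℝ} (ha : a ≠ 0) (β b D : ℝ) :
    volume {α : ℝ | |a * (α - β) - b| ≤ D} = ENNReal.ofReal (2 * (D / |a|)) := by
  have : {α : ℝ | |a * (α - β) - b| ≤ D} = Metric.closedBall (β + b / a) (D / |a|) := by
    ext α
    rw [Set.mem_ofPred_eq, Metric.mem_closedBall, Real.dist_eq, le_div_iff₀ (abs_pos.mpr ha),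
      ← abs_mul]
    have : (α - (β + b / a)) * a = a * (α - β) - b := by field_simp; ring
    rw [this]
  rw [this, Real.volume_closedBall]

theorem volume_affine_inter_le {a1 a2 : ℝ} (h1 : a1 ≠ 0) (h2 : a2 ≠ 0) (β b1 b2 : ℝ) {D1 D2 : ℝ}
    (hD1 : 0 ≤ D1) (hD2 : 0 ≤ D2) :
    volume {α : ℝ | |a1 * (α - β) - b1| ≤ D1 ∧ |a2 * (α - β) - b2| ≤ D2} ≤
      ENNReal.ofReal (2 * √(D1 * D2 / (|a1| * |a2|))) := by
  set x := D1 / |a1|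
  set y := D2 / |a2|
  have hx : 0 ≤ x := by positivity
  have hy : 0 ≤ y := by positivity
  have hxy : D1 * D2 / (|a1| * |a2|) = x * y := by rw [div_mul_div_comm]
  rw [hxy]
  rcases le_total x y with h | h
  · refine (measure_mono (fun α hα => hα.1)).trans ((volume_affine_le h1 β b1 D1).le.trans ?_)
    refine ENNReal.ofReal_le_ofReal (mul_le_mul_of_nonneg_left ?_ zero_le_two)
    exact Real.le_sqrt_of_sq_le (by rw [sq]; gcongr)
  · refine (measure_mono (fun α hα => hα.2)).trans ((volume_affine_le h2 β b2 D2).le.trans ?_)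
    refine ENNReal.ofReal_le_ofReal (mul_le_mul_of_nonneg_left ?_ zero_le_two)
    exact Real.le_sqrt_of_sq_le (by rw [sq]; gcongr)

theorem volume_diagonal_le {l1 l2 : ℝ} (h1 : l1 ≠ 0) (h2 : l2 ≠ 0) (K1 K2 : ℕ) {D1 D2 : ℝ}
    (hD1 : 0 ≤ D1) (hD2 : 0 ≤ D2) (β : ℕ → ℕ → ℝ) :
    volume {α : ℝ | ∃ q1 q2 : ℕ, 1 ≤ q1 ∧ q1 ≤ K1 ∧ 1 ≤ q2 ∧ q2 ≤ K2 ∧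
        |q1 * l1 * (α - β q1 q2)| ≤ D1 ∧ |q2 * l2 * (α - β q1 q2)| ≤ D2} ≤
      ENNReal.ofReal (8 * √(D1 * D2 * K1 * K2 / (|l1| * |l2|))) := by
  set s := Finset.Icc 1 K1 ×ˢ Finset.Icc 1 K2 with hs
  have hsub : {α : ℝ | ∃ q1 q2 : ℕ, 1 ≤ q1 ∧ q1 ≤ K1 ∧ 1 ≤ q2 ∧ q2 ≤ K2 ∧
        |q1 * l1 * (α - β q1 q2)| ≤ D1 ∧ |q2 * l2 * (α - β q1 q2)| ≤ D2} ⊆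
      ⋃ x ∈ s, {α : ℝ | |(x.1 * l1) * (α - β x.1 x.2) - 0| ≤ D1 ∧
        |(x.2 * l2) * (α - β x.1 x.2) - 0| ≤ D2} := by
    rintro α ⟨q1, q2, a, b, c, d, ha, hb⟩
    refine Set.mem_biUnion (x := (q1, q2)) ?_ ?_
    · simp [hs, a, b, c, d]
    · rw [Set.mem_ofPred_eq, sub_zero, sub_zero]
      exact ⟨ha, hb⟩
  refine (measure_mono hsub).trans ((measure_biUnion_finset_le _ _).trans ?_)
  have hpt : ∀ x ∈ s, volume {α : ℝ | |(x.1 * l1) * (α - β x.1 x.2) - 0| ≤ D1 ∧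
        |(x.2 * l2) * (α - β x.1 x.2) - 0| ≤ D2} ≤
      ENNReal.ofReal (2 * √(D1 * D2 / (|l1| * |l2|)) *
        (1 / √(x.1 : ℝ) * (1 / √(x.2 : ℝ)))) := by
    intro x hx
    rw [hs, Finset.mem_product, Finset.mem_Icc, Finset.mem_Icc] at hx
    have p1 : (0 : ℝ) < x.1 := by exact_mod_cast hx.1.1
    have p2 : (0 : ℝ) < x.2 := by exact_mod_cast hx.2.1
    refine (volume_affine_inter_le (mul_ne_zero p1.ne' h1) (mul_ne_zero p2.ne' h2) _ _ _
      hD1 hD2).trans (le_of_eq ?_)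
    congr 1
    rw [abs_mul, abs_mul, abs_of_pos p1, abs_of_pos p2, one_div, one_div,
      ← Real.sqrt_inv, ← Real.sqrt_inv, ← Real.sqrt_mul (inv_nonneg.mpr p1.le), mul_assoc 2,
      ← Real.sqrt_mul (by positivity)]
    congr 2
    field_simp
  refine (Finset.sum_le_sum hpt).trans ?_
  rw [← ENNReal.ofReal_sum_of_nonneg (fun x _ => by positivity)]
  refine ENNReal.ofReal_le_ofReal ?_
  rw [← Finset.mul_sum, hs, Finset.sum_product]
  simp only
  rw [← Finset.sum_mul_sum]
  calc 2 * √(D1 * D2 / (|l1| * |l2|)) * ((∑ i ∈ Finset.Icc 1 K1, 1 / √(i : ℝ)) *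
        ∑ j ∈ Finset.Icc 1 K2, 1 / √(j : ℝ))
      ≤ 2 * √(D1 * D2 / (|l1| * |l2|)) * ((2 * √(K1 : ℝ)) * (2 * √(K2 : ℝ))) := by
        gcongr
        · exact sum_inv_sqrt_le _
        · exact sum_inv_sqrt_le _
    _ = 8 * √(D1 * D2 * K1 * K2 / (|l1| * |l2|)) := by
        have : D1 * D2 * K1 * K2 / (|l1| * |l2|) = D1 * D2 / (|l1| * |l2|) * (K1 * K2) := by ring
        rw [this, Real.sqrt_mul (by positivity), Real.sqrt_mul (by positivity)]
        ring

theorem abs_mul_sub_lt_of_simultaneous {l1 l2 : ℝ} (h2 : l2 ≠ 0) {q K1 K2 q1 q2 : ℕ} {D1 D2 t : ℝ}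
    (hq : 1 ≤ q) (hql : 1 / (4 * q : ℝ) ≤ |l1 / l2|)
    (hsm : K1 * |l1| * D2 + K2 * |l2| * D1 < |l2| / (4 * q))
    (hq1 : 1 ≤ q1) (hq1' : q1 ≤ K1) (hq2 : 1 ≤ q2) (hq2' : q2 ≤ K2) {b1 b2 : ℤ}
    (hb : b1 ≠ 0 ∨ b2 ≠ 0) (hb1 : |q1 * l1 * t - b1| ≤ D1) (hb2 : |q2 * l2 * t - b2| ≤ D2) :
    |((b2 * q1 : ℤ) : ℝ) * (l1 / l2) - (b1 * q2 : ℤ)| < 1 / (4 * q) ∧ b1 ≠ 0 ∧ b2 ≠ 0 := by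
  have hq0 : (1 : ℝ) ≤ q := by exact_mod_cast hq
  have hl2 : 0 < |l2| := abs_pos.mpr h2
  have main : |((b2 * q1 : ℤ) : ℝ) * (l1 / l2) - (b1 * q2 : ℤ)| < 1 / (4 * q) := by
    have e : l2 * (((b2 * q1 : ℤ) : ℝ) * (l1 / l2) - (b1 * q2 : ℤ)) =
        q2 * l2 * (q1 * l1 * t - b1) - q1 * l1 * (q2 * l2 * t - b2) := by
      push_cast; field_simp; ring
    have h3 : |l2| * |((b2 * q1 : ℤ) : ℝ) * (l1 / l2) - (b1 * q2 : ℤ)| < |l2| / (4 * q) := by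
      rw [← abs_mul, e]
      refine ((abs_sub _ _).trans ?_).trans_lt hsm
      rw [abs_mul, abs_mul, abs_mul, abs_mul (q1 : ℝ), Nat.abs_cast, Nat.abs_cast, add_comm]
      gcongr
    have h4 : |l2| / (4 * q) = |l2| * (1 / (4 * q)) := by ring
    rw [h4] at h3
    exact lt_of_mul_lt_mul_left h3 hl2.le
  have hlt1 : 1 / (4 * q : ℝ) < 1 := by
    rw [div_lt_one (by positivity)]; linarith
  have hone : ∀ z : ℤ, z ≠ 0 → (1 : ℝ) ≤ |(z : ℝ)| := fun z hz => by
    exact_mod_cast Int.one_le_abs hz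
  refine ⟨main, ?_, ?_⟩
  · rintro rfl
    have hb2' : b2 ≠ 0 := by simpa using hb
    have : (1 : ℝ) ≤ |((b2 * q1 : ℤ) : ℝ)| := hone _ (mul_ne_zero hb2' (by omega))
    rw [zero_mul, Int.cast_zero, sub_zero, abs_mul] at main
    nlinarith [abs_nonneg (l1 / l2)]
  · rintro rfl
    have hb1' : b1 ≠ 0 := by simpa using hb
    have : (1 : ℝ) ≤ |((b1 * q2 : ℤ) : ℝ)| := hone _ (mul_ne_zero hb1' (by omega))
    rw [zero_mul, Int.cast_zero, zero_mul, zero_sub, abs_neg] at main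
    linarith

theorem abs_le_of_near_integer {a t W D : ℝ} {b : ℤ} (hb : b ≠ 0) (hD : D ≤ 1 / 2)
    (ht : |t| ≤ W) (h : |a * t - b| ≤ D) : |(b : ℝ)| ≤ 2 * (|a| * W) := by
  have h1 : (1 : ℝ) ≤ |(b : ℝ)| := by exact_mod_cast Int.one_le_abs hb
  have h2 : |(b : ℝ)| ≤ |a * t| + |a * t - b| := by
    calc |(b : ℝ)| = |a * t - (a * t - b)| := by ring_nf
      _ ≤ _ := abs_sub _ _
  rw [abs_mul] at h2
  have h3 : |a| * |t| ≤ |a| * W := by gcongr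
  linarith

/-- The finite set of data `(q₁, q₂, b₁, b₂)` with `(b₁, b₂) ≠ 0` realised by a shift of size at
most `W`. -/
def shiftSet (l1 l2 D1 D2 W : ℝ) (K1 K2 : ℕ) : Set ((ℕ × ℕ) × (ℤ × ℤ)) :=
  {x | (1 ≤ x.1.1 ∧ x.1.1 ≤ K1) ∧ (1 ≤ x.1.2 ∧ x.1.2 ≤ K2) ∧ (x.2.1 ≠ 0 ∨ x.2.2 ≠ 0) ∧
    ∃ t : ℝ, |t| ≤ W ∧ |x.1.1 * l1 * t - x.2.1| ≤ D1 ∧ |x.1.2 * l2 * t - x.2.2| ≤ D2}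

/-- Hypotheses under which the data in `shiftSet` are sparse. -/
structure ShiftHyp (l1 l2 D1 D2 W : ℝ) (K1 K2 q : ℕ) : Prop where
  h1 : l1 ≠ 0
  h2 : l2 ≠ 0
  hq : 1 ≤ q
  hql : 1 / (4 * q : ℝ) ≤ |l1 / l2|
  hrep : ∀ N M : ℤ, N ≠ 0 → |N * (l1 / l2) - M| < 1 / (2 * q : ℝ) → (q : ℤ) < 2 * |N|
  hD1 : 0 ≤ D1
  hD1' : D1 ≤ 1 / 2
  hD2 : 0 ≤ D2
  hD2' : D2 ≤ 1 / 2
  hsm : K1 * |l1| * D2 + K2 * |l2| * D1 < |l2| / (4 * q)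

namespace ShiftHyp

variable {l1 l2 D1 D2 W : ℝ} {K1 K2 q : ℕ}

theorem approx (H : ShiftHyp l1 l2 D1 D2 W K1 K2 q) {x : (ℕ × ℕ) × (ℤ × ℤ)}
    (hx : x ∈ shiftSet l1 l2 D1 D2 W K1 K2) :
    |((x.2.2 * x.1.1 : ℤ) : ℝ) * (l1 / l2) - (x.2.1 * x.1.2 : ℤ)| < 1 / (4 * q) ∧
      x.2.1 ≠ 0 ∧ x.2.2 ≠ 0 := by
  obtain ⟨⟨a, b⟩, ⟨c, d⟩, hb, t, -, e1, e2⟩ := hx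
  exact abs_mul_sub_lt_of_simultaneous H.h2 H.hq H.hql H.hsm a b c d hb e1 e2

theorem bounds (H : ShiftHyp l1 l2 D1 D2 W K1 K2 q) {x : (ℕ × ℕ) × (ℤ × ℤ)}
    (hx : x ∈ shiftSet l1 l2 D1 D2 W K1 K2) :
    |(x.2.1 : ℝ)| ≤ 2 * (x.1.1 * |l1| * W) ∧ |(x.2.2 : ℝ)| ≤ 2 * (x.1.2 * |l2| * W) := by
  have hnz := (H.approx hx).2
  obtain ⟨-, -, -, t, ht, e1, e2⟩ := hx
  have b1 := abs_le_of_near_integer hnz.1 H.hD1' ht e1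
  have b2 := abs_le_of_near_integer hnz.2 H.hD2' ht e2
  rw [abs_mul, Nat.abs_cast] at b1 b2
  exact ⟨b1, b2⟩

theorem bounds_mul (H : ShiftHyp l1 l2 D1 D2 W K1 K2 q) (hW : 0 ≤ W) {x : (ℕ × ℕ) × (ℤ × ℤ)}
    (hx : x ∈ shiftSet l1 l2 D1 D2 W K1 K2) :
    |((x.2.2 * x.1.1 : ℤ) : ℝ)| ≤ 2 * |l2| * W * K1 * K2 ∧
      |((x.2.1 * x.1.2 : ℤ) : ℝ)| ≤ 2 * |l1| * W * K1 * K2 := by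
  obtain ⟨b1, b2⟩ := H.bounds hx
  have k1 : (x.1.1 : ℝ) ≤ K1 := by exact_mod_cast hx.1.2
  have k2 : (x.1.2 : ℝ) ≤ K2 := by exact_mod_cast hx.2.1.2
  push_cast
  rw [abs_mul, abs_mul, Nat.abs_cast, Nat.abs_cast]
  constructor
  · calc |(x.2.2 : ℝ)| * x.1.1 ≤ 2 * (K2 * |l2| * W) * K1 := by
          gcongr; exact b2.trans (by gcongr)
      _ = _ := by ring
  · calc |(x.2.1 : ℝ)| * x.1.2 ≤ 2 * (K1 * |l1| * W) * K2 := by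
          gcongr; exact b1.trans (by gcongr)
      _ = _ := by ring

theorem finite (H : ShiftHyp l1 l2 D1 D2 W K1 K2 q) (hW : 0 ≤ W) :
    (shiftSet l1 l2 D1 D2 W K1 K2).Finite := by
  set B1 : ℤ := ⌈2 * (K1 * |l1| * W)⌉
  set B2 : ℤ := ⌈2 * (K2 * |l2| * W)⌉
  refine ((((Set.finite_Icc 1 K1).prod (Set.finite_Icc 1 K2)).prod
    ((Set.finite_Icc (-B1) B1).prod (Set.finite_Icc (-B2) B2)))).subset ?_
  intro x hx
  obtain ⟨b1, b2⟩ := H.bounds hx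
  have k1 : (x.1.1 : ℝ) ≤ K1 := by exact_mod_cast hx.1.2
  have k2 : (x.1.2 : ℝ) ≤ K2 := by exact_mod_cast hx.2.1.2
  have c1 : |(x.2.1 : ℝ)| ≤ B1 :=
    (b1.trans (by gcongr)).trans (Int.le_ceil (2 * (K1 * |l1| * W)))
  have c2 : |(x.2.2 : ℝ)| ≤ B2 :=
    (b2.trans (by gcongr)).trans (Int.le_ceil (2 * (K2 * |l2| * W)))
  exact ⟨⟨hx.1, hx.2.1⟩, abs_le.mp (by exact_mod_cast c1), abs_le.mp (by exact_mod_cast c2)⟩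

theorem eq_of_eq (H : ShiftHyp l1 l2 D1 D2 W K1 K2 q) {x y : (ℕ × ℕ) × (ℤ × ℤ)}
    (hx : x ∈ shiftSet l1 l2 D1 D2 W K1 K2) (hy : y ∈ shiftSet l1 l2 D1 D2 W K1 K2)
    (hxy : x.2.2 * (x.1.1 : ℤ) = y.2.2 * y.1.1) : x.2.1 * (x.1.2 : ℤ) = y.2.1 * y.1.2 := by
  have a := (H.approx hx).1
  have b := (H.approx hy).1
  rw [← hxy] at b
  have hq0 : (1 : ℝ) ≤ q := by exact_mod_cast H.hq
  have hlt1 : 1 / (4 * q : ℝ) ≤ 1 / 4 := by gcongr; linarith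
  set m := x.2.1 * (x.1.2 : ℤ)
  set m' := y.2.1 * (y.1.2 : ℤ)
  have : |((m - m' : ℤ) : ℝ)| < 1 := by
    push_cast
    rw [abs_lt] at *
    constructor <;> linarith
  have h := Int.abs_lt_one_iff.mp (by exact_mod_cast this : |m - m'| < 1)
  omega

theorem spaced (H : ShiftHyp l1 l2 D1 D2 W K1 K2 q) {x y : (ℕ × ℕ) × (ℤ × ℤ)}
    (hx : x ∈ shiftSet l1 l2 D1 D2 W K1 K2) (hy : y ∈ shiftSet l1 l2 D1 D2 W K1 K2)
    (hxy : x.2.2 * (x.1.1 : ℤ) ≠ y.2.2 * y.1.1) :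
    (q : ℤ) < 2 * |x.2.2 * (x.1.1 : ℤ) - y.2.2 * y.1.1| := by
  have a := (H.approx hx).1
  have b := (H.approx hy).1
  have hq0 : (1 : ℝ) ≤ q := by exact_mod_cast H.hq
  have e : 1 / (2 * q : ℝ) = 1 / (4 * q) + 1 / (4 * q) := by field_simp; norm_num
  refine H.hrep _ (x.2.1 * (x.1.2 : ℤ) - y.2.1 * y.1.2) (sub_ne_zero.mpr hxy) ?_
  set m := x.2.1 * (x.1.2 : ℤ)
  set m' := y.2.1 * (y.1.2 : ℤ)
  set n := x.2.2 * (x.1.1 : ℤ)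
  set n' := y.2.2 * (y.1.1 : ℤ)
  rw [e, Int.cast_sub, Int.cast_sub]
  rw [abs_lt] at *
  constructor <;> nlinarith

theorem spaced_zero (H : ShiftHyp l1 l2 D1 D2 W K1 K2 q) {x : (ℕ × ℕ) × (ℤ × ℤ)}
    (hx : x ∈ shiftSet l1 l2 D1 D2 W K1 K2) : (q : ℤ) < 2 * |x.2.2 * (x.1.1 : ℤ)| := by
  obtain ⟨a, -, hb⟩ := H.approx hx
  have hx1 := hx.1.1
  have hq0 : (1 : ℝ) ≤ q := by exact_mod_cast H.hq
  refine H.hrep _ _ (mul_ne_zero hb (by omega)) (a.trans ?_)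
  exact one_div_lt_one_div_of_lt (by positivity) (by linarith)

theorem card_fiber_le (H : ShiftHyp l1 l2 D1 D2 W K1 K2 q) (hW : 0 ≤ W) {T : ℝ}
    (hT : ∀ k : ℕ, 1 ≤ k → (k : ℝ) ≤ 2 * (|l1| + |l2|) * W * K1 * K2 →
      (k.divisors.card : ℝ) ≤ T) (P : Finset ((ℕ × ℕ) × (ℤ × ℤ)))
    (hP : ∀ x ∈ P, x ∈ shiftSet l1 l2 D1 D2 W K1 K2) (n : ℤ) :
    ((P.filter (fun x => x.2.2 * (x.1.1 : ℤ) = n)).card : ℝ) ≤ T ^ 2 := by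
  rcases (P.filter (fun x => x.2.2 * (x.1.1 : ℤ) = n)).eq_empty_or_nonempty with he | ⟨x0, hx0⟩
  · rw [he]; simp only [Finset.card_empty, Nat.cast_zero]; positivity
  rw [Finset.mem_filter] at hx0
  have hs0 := hP x0 hx0.1
  set m := x0.2.1 * (x0.1.2 : ℤ) with hm
  have hnz := (H.approx hs0).2
  have hq1 := hs0.1.1
  have hq2 := hs0.2.1.1
  have hn0 : n ≠ 0 := by rw [← hx0.2]; exact mul_ne_zero hnz.2 (by omega)
  have hm0 : m ≠ 0 := mul_ne_zero hnz.1 (by omega)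
  have hmem : ∀ x ∈ P.filter (fun x => x.2.2 * (x.1.1 : ℤ) = n),
      x.2.2 * (x.1.1 : ℤ) = n ∧ x.2.1 * (x.1.2 : ℤ) = m := by
    intro x hx
    rw [Finset.mem_filter] at hx
    exact ⟨hx.2, H.eq_of_eq (hP x hx.1) hs0 (by rw [hx.2, hx0.2])⟩
  have hcard : (P.filter (fun x => x.2.2 * (x.1.1 : ℤ) = n)).card ≤
      (n.natAbs.divisors ×ˢ m.natAbs.divisors).card := by
    refine Finset.card_le_card_of_injOn (fun x => x.1) ?_ ?_
    · intro x hx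
      obtain ⟨e1, e2⟩ := hmem x hx
      simp only [Finset.coe_product, Set.mem_prod, Finset.mem_coe, Nat.mem_divisors]
      refine ⟨⟨?_, by omega⟩, ?_, by omega⟩
      · exact Int.natCast_dvd.mp ⟨x.2.2, by rw [← e1, mul_comm]⟩
      · exact Int.natCast_dvd.mp ⟨x.2.1, by rw [← e2, mul_comm]⟩
    · intro x hx y hy hxy
      obtain ⟨e1, e2⟩ := hmem x hx
      obtain ⟨f1, f2⟩ := hmem y hy
      have hxy' : x.1 = y.1 := hxy
      have hxs := hP x (Finset.mem_filter.mp hx).1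
      have g1 : (x.1.1 : ℤ) ≠ 0 := by have := hxs.1.1; omega
      have g2 : (x.1.2 : ℤ) ≠ 0 := by have := hxs.2.1.1; omega
      rw [← hxy', ← e1] at f1
      rw [← hxy', ← e2] at f2
      exact Prod.ext hxy' (Prod.ext (mul_right_cancel₀ g2 f2.symm) (mul_right_cancel₀ g1 f1.symm))
  have hV := H.bounds_mul hW hs0
  rw [hx0.2, ← hm] at hV
  have hbd : ∀ z : ℤ, z ≠ 0 → |(z : ℝ)| ≤ 2 * (|l1| + |l2|) * W * K1 * K2 →
      ((z.natAbs.divisors.card : ℕ) : ℝ) ≤ T := by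
    intro z hz hzV
    refine hT _ (by omega) ?_
    rwa [Nat.cast_natAbs, Int.cast_abs]
  have hTn := hbd n hn0 (hV.1.trans (by
    gcongr; exact le_add_of_nonneg_left (abs_nonneg _)))
  have hTm := hbd m hm0 (hV.2.trans (by
    gcongr; exact le_add_of_nonneg_right (abs_nonneg _)))
  calc ((P.filter (fun x => x.2.2 * (x.1.1 : ℤ) = n)).card : ℝ)
      ≤ (n.natAbs.divisors.card : ℝ) * m.natAbs.divisors.card := by
        rw [Finset.card_product] at hcard
        exact_mod_cast hcard
    _ ≤ T * T := by gcongr; exact le_trans (Nat.cast_nonneg _) hTn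
    _ = T ^ 2 := by ring

end ShiftHyp

theorem ShiftHyp.volume_le {l1 l2 D1 D2 W : ℝ} {K1 K2 q : ℕ}
    (H : ShiftHyp l1 l2 D1 D2 W K1 K2 q) (hW : 0 ≤ W) {T : ℝ}
    (hT : ∀ k : ℕ, 1 ≤ k → (k : ℝ) ≤ 2 * (|l1| + |l2|) * W * K1 * K2 →
      (k.divisors.card : ℝ) ≤ T) (β : ℕ → ℕ → ℝ) :
    volume {α : ℝ | ∃ q1 q2 : ℕ, ∃ b1 b2 : ℤ, (1 ≤ q1 ∧ q1 ≤ K1) ∧ (1 ≤ q2 ∧ q2 ≤ K2) ∧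
        (b1 ≠ 0 ∨ b2 ≠ 0) ∧ |α - β q1 q2| ≤ W ∧
        |q1 * l1 * (α - β q1 q2) - b1| ≤ D1 ∧ |q2 * l2 * (α - β q1 q2) - b2| ≤ D2} ≤
      ENNReal.ofReal (32 * T ^ 2 * W * √(|l2| / |l1|) * √(D1 * D2 * K1 * K2) / q) := by
  have hl1 : 0 < |l1| := abs_pos.mpr H.h1
  have hl2 : 0 < |l2| := abs_pos.mpr H.h2
  have hD1 := H.hD1
  have hD2 := H.hD2
  set P := (H.finite hW).toFinset with hPdef
  have hP : ∀ x ∈ P, x ∈ shiftSet l1 l2 D1 D2 W K1 K2 := fun x hx => by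
    simpa [hPdef] using hx
  set E : (ℕ × ℕ) × (ℤ × ℤ) → Set ℝ := fun x =>
    {α : ℝ | |(x.1.1 * l1) * (α - β x.1.1 x.1.2) - x.2.1| ≤ D1 ∧
      |(x.1.2 * l2) * (α - β x.1.1 x.1.2) - x.2.2| ≤ D2} with hE
  have hsub : {α : ℝ | ∃ q1 q2 : ℕ, ∃ b1 b2 : ℤ, (1 ≤ q1 ∧ q1 ≤ K1) ∧ (1 ≤ q2 ∧ q2 ≤ K2) ∧
        (b1 ≠ 0 ∨ b2 ≠ 0) ∧ |α - β q1 q2| ≤ W ∧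
        |q1 * l1 * (α - β q1 q2) - b1| ≤ D1 ∧ |q2 * l2 * (α - β q1 q2) - b2| ≤ D2} ⊆
      ⋃ x ∈ P, E x := by
    rintro α ⟨q1, q2, b1, b2, h1, h2, hb, hw, e1, e2⟩
    refine Set.mem_biUnion (x := ((q1, q2), (b1, b2))) ?_ ⟨e1, e2⟩
    rw [hPdef, Set.Finite.coe_toFinset]
    exact ⟨h1, h2, hb, α - β q1 q2, hw, e1, e2⟩
  set c : ℝ := 2 * √(2 * (D1 * D2 * W / |l1|)) with hc
  set f : ℤ → ℝ := fun n => 1 / √|(n : ℝ)| with hf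
  have hpt : ∀ x ∈ P, volume (E x) ≤ ENNReal.ofReal (c * f (x.2.2 * (x.1.1 : ℤ))) := by
    intro x hx
    have hxs := hP x hx
    have hnz := (H.approx hxs).2
    have p1 : (0 : ℝ) < x.1.1 := by exact_mod_cast hxs.1.1
    have p2 : (0 : ℝ) < x.1.2 := by exact_mod_cast hxs.2.1.1
    have pb : 0 < |(x.2.2 : ℝ)| := abs_pos.mpr (by exact_mod_cast hnz.2)
    refine (volume_affine_inter_le (mul_ne_zero p1.ne' H.h1) (mul_ne_zero p2.ne' H.h2) _ _ _
      hD1 hD2).trans (ENNReal.ofReal_le_ofReal ?_)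
    rw [hc, hf, mul_assoc]
    simp only
    rw [one_div, ← Real.sqrt_inv, ← Real.sqrt_mul (by positivity)]
    refine mul_le_mul_of_nonneg_left (Real.sqrt_le_sqrt ?_) zero_le_two
    push_cast
    rw [abs_mul, abs_mul, abs_mul, abs_of_pos p1, abs_of_pos p2, ← div_eq_mul_inv,
      div_le_div_iff₀ (by positivity) (by positivity)]
    have hb2 := (H.bounds hxs).2
    calc D1 * D2 * (|(x.2.2 : ℝ)| * x.1.1) ≤ D1 * D2 * ((2 * (x.1.2 * |l2| * W)) * x.1.1) := by
          gcongr
      _ = _ := by field_simp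
  refine (measure_mono hsub).trans ((measure_biUnion_finset_le _ _).trans
    ((Finset.sum_le_sum hpt).trans ?_))
  rw [← ENNReal.ofReal_sum_of_nonneg (fun x _ => by positivity)]
  refine ENNReal.ofReal_le_ofReal ?_
  rw [← Finset.mul_sum, Finset.sum_comp f (fun x : (ℕ × ℕ) × (ℤ × ℤ) => x.2.2 * (x.1.1 : ℤ))]
  set F := P.image (fun x : (ℕ × ℕ) × (ℤ × ℤ) => x.2.2 * (x.1.1 : ℤ)) with hF
  have hsum : ∑ n ∈ F, f n ≤ 8 * √(2 * |l2| * W * K1 * K2) / q := by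
    refine sum_inv_sqrt_le_of_spaced F H.hq (by positivity) ?_ ?_ ?_
    · intro n hn
      obtain ⟨x, hx, rfl⟩ := Finset.mem_image.mp hn
      exact (H.bounds_mul hW (hP x hx)).1
    · intro n hn
      obtain ⟨x, hx, rfl⟩ := Finset.mem_image.mp hn
      exact H.spaced_zero (hP x hx)
    · intro n hn m hm hnm
      obtain ⟨x, hx, rfl⟩ := Finset.mem_image.mp hn
      obtain ⟨y, hy, rfl⟩ := Finset.mem_image.mp hm
      exact H.spaced (hP x hx) (hP y hy) hnm
  have hc0 : 0 ≤ c := by positivity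
  calc c * ∑ n ∈ F, (P.filter (fun x => x.2.2 * (x.1.1 : ℤ) = n)).card • f n
      ≤ c * ∑ n ∈ F, T ^ 2 * f n := by
        refine mul_le_mul_of_nonneg_left (Finset.sum_le_sum fun n _ => ?_) hc0
        rw [nsmul_eq_mul]
        exact mul_le_mul_of_nonneg_right (H.card_fiber_le hW hT P hP n) (by positivity)
    _ ≤ c * (T ^ 2 * (8 * √(2 * |l2| * W * K1 * K2) / q)) := by
        rw [← Finset.mul_sum]; gcongr
    _ = 16 * T ^ 2 * (√(2 * (D1 * D2 * W / |l1|)) * √(2 * |l2| * W * K1 * K2)) / q := by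
        rw [hc]; ring
    _ = 32 * T ^ 2 * W * √(|l2| / |l1|) * √(D1 * D2 * K1 * K2) / q := by
        rw [← Real.sqrt_mul (by positivity)]
        have : 2 * (D1 * D2 * W / |l1|) * (2 * |l2| * W * K1 * K2) =
            (2 * W) ^ 2 * (|l2| / |l1| * (D1 * D2 * K1 * K2)) := by field_simp
        rw [this, Real.sqrt_mul (by positivity), Real.sqrt_sq (by positivity),
          Real.sqrt_mul (by positivity)]
        ring

/-- Reals `α` such that `l₁α` and `l₂α` are both close to rationals with small denominators. -/
def majorArcSet (l1 l2 d1 d2 : ℝ) (K1 K2 : ℕ) : Set ℝ :=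
  {α | ∃ q1 q2 : ℕ, ∃ a1 a2 : ℤ, (1 ≤ q1 ∧ q1 ≤ K1) ∧ (1 ≤ q2 ∧ q2 ≤ K2) ∧
    |q1 * l1 * α - a1| ≤ d1 ∧ |q2 * l2 * α - a2| ≤ d2}

/-- The bound of `ShiftHyp.volume_le` for the tolerances `2d₁, 2d₂`. -/
def shiftBound (l1 l2 d1 d2 W T : ℝ) (K1 K2 q : ℕ) : ℝ :=
  32 * T ^ 2 * W * √(|l2| / |l1|) * √((2 * d1) * (2 * d2) * K1 * K2) / q

section

variable {l1 l2 d1 d2 W T : ℝ} {K1 K2 q : ℕ}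

theorem shiftBound_nonneg (hW : 0 ≤ W) : 0 ≤ shiftBound l1 l2 d1 d2 W T K1 K2 q := by
  rw [shiftBound]; positivity

theorem ShiftHyp.volume_annulus_le {y : ℝ} (H : ShiftHyp l1 l2 (2 * d1) (2 * d2) (2 * y) K1 K2 q)
    (hy : 0 ≤ y) (hyd : d1 < |l1| * y)
    (hT : ∀ k : ℕ, 1 ≤ k → (k : ℝ) ≤ 2 * (|l1| + |l2|) * (2 * y) * K1 * K2 →
      (k.divisors.card : ℝ) ≤ T) :
    volume (majorArcSet l1 l2 d1 d2 K1 K2 ∩ {α | y < |α| ∧ |α| ≤ 2 * y}) ≤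
      ENNReal.ofReal (shiftBound l1 l2 d1 d2 (2 * y) T K1 K2 q) := by
  refine (measure_mono ?_).trans (H.volume_le (by positivity) hT (fun _ _ => 0))
  rintro α ⟨⟨q1, q2, a1, a2, h1, h2, e1, e2⟩, hy1, hy2⟩
  have hd1 := H.hD1
  have hd2 := H.hD2
  refine ⟨q1, q2, a1, a2, h1, h2, Or.inl ?_, ?_, ?_, ?_⟩
  · rintro rfl
    have hq1 : (1 : ℝ) ≤ q1 := by exact_mod_cast h1.1
    rw [Int.cast_zero, sub_zero, abs_mul, abs_mul, Nat.abs_cast] at e1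
    have : |l1| * y ≤ q1 * |l1| * |α| := by
      calc |l1| * y = 1 * |l1| * y := by ring
        _ ≤ _ := by gcongr
    linarith
  · rwa [sub_zero]
  · rw [sub_zero]; linarith
  · rw [sub_zero]; linarith

theorem ShiftHyp.volume_window_le (H : ShiftHyp l1 l2 (2 * d1) (2 * d2) W K1 K2 q) (hW : 0 ≤ W)
    (hT : ∀ k : ℕ, 1 ≤ k → (k : ℝ) ≤ 2 * (|l1| + |l2|) * W * K1 * K2 →
      (k.divisors.card : ℝ) ≤ T) (c : ℝ) :
    volume (majorArcSet l1 l2 d1 d2 K1 K2 ∩ Set.Icc c (c + W)) ≤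
      ENNReal.ofReal (shiftBound l1 l2 d1 d2 W T K1 K2 q +
        8 * √((2 * d1) * (2 * d2) * K1 * K2 / (|l1| * |l2|))) := by
  set Q : ℕ → ℕ → ℝ → Prop := fun q1 q2 α => α ∈ Set.Icc c (c + W) ∧
    ∃ a1 a2 : ℤ, |q1 * l1 * α - a1| ≤ d1 ∧ |q2 * l2 * α - a2| ≤ d2 with hQ
  set β : ℕ → ℕ → ℝ := fun q1 q2 => if h : ∃ α, Q q1 q2 α then h.choose else 0 with hβ
  have hβQ : ∀ q1 q2 α, Q q1 q2 α → Q q1 q2 (β q1 q2) := by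
    intro q1 q2 α h
    have h' : ∃ α, Q q1 q2 α := ⟨α, h⟩
    rw [hβ]
    simp only [dif_pos h']
    exact h'.choose_spec
  rw [ENNReal.ofReal_add (shiftBound_nonneg hW) (by positivity)]
  refine (measure_mono ?_).trans ((measure_union_le _ _).trans
    (add_le_add (H.volume_le hW hT β) (volume_diagonal_le H.h1 H.h2 K1 K2 H.hD1 H.hD2 β)))
  rintro α ⟨⟨q1, q2, a1, a2, h1, h2, e1, e2⟩, hI⟩
  obtain ⟨hJ, m1, m2, f1, f2⟩ := hβQ q1 q2 α ⟨hI, a1, a2, e1, e2⟩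
  have g1 : |q1 * l1 * (α - β q1 q2) - (a1 - m1 : ℤ)| ≤ 2 * d1 := by
    push_cast
    rw [abs_le] at *
    constructor <;> linarith
  have g2 : |q2 * l2 * (α - β q1 q2) - (a2 - m2 : ℤ)| ≤ 2 * d2 := by
    push_cast
    rw [abs_le] at *
    constructor <;> linarith
  have gw : |α - β q1 q2| ≤ W := by
    rw [abs_le]
    constructor <;> linarith [hI.1, hI.2, hJ.1, hJ.2]
  by_cases hb : a1 - m1 ≠ 0 ∨ a2 - m2 ≠ 0
  · exact Or.inl ⟨q1, q2, a1 - m1, a2 - m2, h1, h2, hb, gw, g1, g2⟩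
  · push Not at hb
    rw [hb.1, Int.cast_zero, sub_zero] at g1
    rw [hb.2, Int.cast_zero, sub_zero] at g2
    exact Or.inr ⟨q1, q2, h1.1, h1.2, h2.1, h2.2, g1, g2⟩

end

theorem exists_window_of_mem {W c α : ℝ} {N : ℕ} (hW : 0 < W) (h1 : c ≤ α) (h2 : α < c + N * W) :
    ∃ j ∈ Finset.range N, α ∈ Set.Icc (c + j * W) (c + j * W + W) := by
  have h0 : 0 ≤ (α - c) / W := div_nonneg (by linarith) hW.le
  refine ⟨⌊(α - c) / W⌋₊, ?_, ?_, ?_⟩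
  · rw [Finset.mem_range, Nat.floor_lt h0, div_lt_iff₀ hW]; linarith
  · have := Nat.floor_le h0
    rw [le_div_iff₀ hW] at this; linarith
  · have := Nat.lt_floor_add_one ((α - c) / W)
    rw [div_lt_iff₀ hW] at this; linarith

theorem volume_inter_annulus_le_of_windows {E : Set ℝ} {W y : ℝ} {B : ENNReal} {N : ℕ} (hW : 0 < W)
    (hN : y < N * W) (hB : ∀ c : ℝ, volume (E ∩ Set.Icc c (c + W)) ≤ B) :
    volume (E ∩ {α | y < |α| ∧ |α| ≤ 2 * y}) ≤ 2 * N * B := by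
  set G : ℝ → Set ℝ := fun c => ⋃ j ∈ Finset.range N, (E ∩ Set.Icc (c + j * W) (c + j * W + W))
  have hG : ∀ c, volume (G c) ≤ N * B := by
    intro c
    refine (measure_biUnion_finset_le _ _).trans ((Finset.sum_le_sum fun j _ => hB _).trans ?_)
    rw [Finset.sum_const, Finset.card_range, nsmul_eq_mul]
  have hmem : ∀ c, ∀ α ∈ E, c ≤ α → α < c + N * W → α ∈ G c := by
    intro c α hE h1 h2
    obtain ⟨j, hj, hα⟩ := exists_window_of_mem hW h1 h2
    exact Set.mem_biUnion hj ⟨hE, hα⟩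
  have hsub : E ∩ {α | y < |α| ∧ |α| ≤ 2 * y} ⊆ G y ∪ G (-(2 * y)) := by
    rintro α ⟨hE, h1, h2⟩
    rcases le_total 0 α with h | h
    · rw [abs_of_nonneg h] at h1 h2
      exact Or.inl (hmem _ _ hE h1.le (by linarith))
    · rw [abs_of_nonpos h] at h1 h2
      exact Or.inr (hmem _ _ hE (by linarith) (by linarith))
  refine (measure_mono hsub).trans ((measure_union_le _ _).trans
    ((add_le_add (hG _) (hG _)).trans (le_of_eq ?_)))
  ring

set_option maxHeartbeats 800000 in
theorem volume_majorArcSet_annulus_le {l1 l2 X A1 A2 T y : ℝ} {q : ℕ} (h1 : l1 ≠ 0) (h2 : l2 ≠ 0)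
    (hq : 1 ≤ q) (hqX : (q : ℝ) ≤ X) (hql : 1 / (4 * q : ℝ) ≤ |l1 / l2|)
    (hrep : ∀ N M : ℤ, N ≠ 0 → |N * (l1 / l2) - M| < 1 / (2 * q : ℝ) → (q : ℤ) < 2 * |N|)
    (hA1 : 0 ≤ A1) (hA2 : 0 ≤ A2) (hd1 : 4 * A1 ≤ X) (hd2 : 4 * A2 ≤ X)
    (hsm : 2 * (|l1| + |l2|) * (A1 * A2 / X) < |l2| / (4 * q)) (hT1 : 1 ≤ T)
    (hT : ∀ k : ℕ, 1 ≤ k → (k : ℝ) ≤ 4 * (|l1| + |l2|) * X * (A1 * A2) →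
      (k.divisors.card : ℝ) ≤ T) (hy : 0 ≤ y) (hyd : A1 / X < |l1| * y) :
    volume (majorArcSet l1 l2 (A1 / X) (A2 / X) ⌊A1⌋₊ ⌊A2⌋₊ ∩ {α | y < |α| ∧ |α| ≤ 2 * y}) ≤
      ENNReal.ofReal ((256 * √(|l2| / |l1|) + 64 * (1 / √(|l1| * |l2|))) *
        (y * T ^ 2 * (A1 * A2) / (X * q))) := by
  have hl1 : 0 < |l1| := abs_pos.mpr h1
  have hl2 : 0 < |l2| := abs_pos.mpr h2
  have hq0 : (0 : ℝ) < q := by exact_mod_cast hq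
  have hX : 0 < X := hq0.trans_le hqX
  have hK1 : (⌊A1⌋₊ : ℝ) ≤ A1 := Nat.floor_le hA1
  have hK2 : (⌊A2⌋₊ : ℝ) ≤ A2 := Nat.floor_le hA2
  set K1 := ⌊A1⌋₊
  set K2 := ⌊A2⌋₊
  set s := √(|l2| / |l1|)
  have hs : 0 ≤ s := Real.sqrt_nonneg _
  have hD : ∀ A : ℝ, 4 * A ≤ X → 2 * (A / X) ≤ 1 / 2 := fun A hA => by
    rw [← mul_div_assoc, div_le_div_iff₀ hX two_pos]; linarith
  have H : ∀ W, ShiftHyp l1 l2 (2 * (A1 / X)) (2 * (A2 / X)) W K1 K2 q := fun W =>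
    { h1 := h1, h2 := h2, hq := hq, hql := hql, hrep := hrep
      hD1 := by positivity
      hD1' := hD A1 hd1
      hD2 := by positivity
      hD2' := hD A2 hd2
      hsm := by
        refine lt_of_le_of_lt ?_ hsm
        calc K1 * |l1| * (2 * (A2 / X)) + K2 * |l2| * (2 * (A1 / X))
            ≤ A1 * |l1| * (2 * (A2 / X)) + A2 * |l2| * (2 * (A1 / X)) := by gcongr
          _ = _ := by ring }
  have hR : √(2 * (A1 / X) * (2 * (A2 / X)) * K1 * K2) ≤ 2 * (A1 * A2 / X) := by
    apply Real.sqrt_le_iff.mpr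
    refine ⟨by positivity, ?_⟩
    calc 2 * (A1 / X) * (2 * (A2 / X)) * K1 * K2
        ≤ 2 * (A1 / X) * (2 * (A2 / X)) * A1 * A2 := by gcongr
      _ = _ := by ring
  have hB : ∀ W, 0 ≤ W → shiftBound l1 l2 (A1 / X) (A2 / X) W T K1 K2 q ≤
      64 * s * (W * T ^ 2 * (A1 * A2) / (X * q)) := by
    intro W hW
    rw [shiftBound]
    calc 32 * T ^ 2 * W * s * √(2 * (A1 / X) * (2 * (A2 / X)) * K1 * K2) / q
        ≤ 32 * T ^ 2 * W * s * (2 * (A1 * A2 / X)) / q := by gcongr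
      _ = _ := by field_simp; ring
  have hTW : ∀ W, 0 ≤ W → W ≤ 2 * X → ∀ k : ℕ, 1 ≤ k →
      (k : ℝ) ≤ 2 * (|l1| + |l2|) * W * K1 * K2 → (k.divisors.card : ℝ) ≤ T := by
    intro W hW hWX k hk hkV
    refine hT k hk (hkV.trans ?_)
    calc 2 * (|l1| + |l2|) * W * K1 * K2 ≤ 2 * (|l1| + |l2|) * (2 * X) * A1 * A2 := by gcongr
      _ = _ := by ring
  rcases le_total y X with hyX | hyX
  · refine ((H (2 * y)).volume_annulus_le hy hyd (hTW _ (by positivity) (by linarith))).trans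
      (ENNReal.ofReal_le_ofReal ((hB _ (by positivity)).trans ?_))
    have e : 64 * s * (2 * y * T ^ 2 * (A1 * A2) / (X * q)) =
        (128 * s) * (y * T ^ 2 * (A1 * A2) / (X * q)) := by ring
    rw [e]
    have : 0 ≤ 64 * (1 / √(|l1| * |l2|)) := by positivity
    gcongr
    linarith
  · set N := ⌊y / X⌋₊ + 1 with hN
    have hyN : y < N * X := by
      rw [← div_lt_iff₀ hX, hN]; push_cast; exact Nat.lt_floor_add_one _
    have hN2 : (N : ℝ) ≤ 2 * (y / X) := by
      have a1 := Nat.floor_le (div_nonneg hy hX.le)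
      have a2 : 1 ≤ y / X := (one_le_div hX).mpr hyX
      rw [hN]; push_cast; linarith
    refine (volume_inter_annulus_le_of_windows hX hyN
      (fun c => (H X).volume_window_le hX.le (hTW X hX.le (by linarith)) c)).trans ?_
    rw [← Nat.cast_ofNat, ← Nat.cast_mul, ← ENNReal.ofReal_natCast,
      ← ENNReal.ofReal_mul (Nat.cast_nonneg _)]
    refine ENNReal.ofReal_le_ofReal ?_
    have hdiag : 8 * √(2 * (A1 / X) * (2 * (A2 / X)) * K1 * K2 / (|l1| * |l2|)) ≤
        16 * (1 / √(|l1| * |l2|)) * (X * T ^ 2 * (A1 * A2) / (X * q)) := by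
      rw [Real.sqrt_div (by positivity)]
      calc 8 * (√(2 * (A1 / X) * (2 * (A2 / X)) * K1 * K2) / √(|l1| * |l2|))
          ≤ 8 * (2 * (A1 * A2 / X) / √(|l1| * |l2|)) := by gcongr
        _ = 16 * (1 / √(|l1| * |l2|)) * (1 * 1 ^ 2 * (A1 * A2) / X) := by ring
        _ ≤ 16 * (1 / √(|l1| * |l2|)) * (1 * T ^ 2 * (A1 * A2) / q) := by gcongr
        _ = _ := by field_simp
    have hcX := hB X hX.le
    set P := X * T ^ 2 * (A1 * A2) / (X * q) with hP
    have hP0 : 0 ≤ P := by positivity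
    set s' := 1 / √(|l1| * |l2|)
    have hs' : 0 ≤ s' := by positivity
    calc ((2 * N : ℕ) : ℝ) * (shiftBound l1 l2 (A1 / X) (A2 / X) X T K1 K2 q +
          8 * √(2 * (A1 / X) * (2 * (A2 / X)) * K1 * K2 / (|l1| * |l2|)))
        ≤ (4 * (y / X)) * (64 * s * P + 16 * s' * P) := by
          have hn : ((2 * N : ℕ) : ℝ) ≤ 4 * (y / X) := by push_cast; linarith
          have := shiftBound_nonneg (l1 := l1) (l2 := l2) (d1 := A1 / X) (d2 := A2 / X) (T := T)
            (K1 := K1) (K2 := K2) (q := q) hX.le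
          gcongr
      _ = _ := by rw [hP]; field_simp; ring

theorem eventually_mul_rpow_lt {a b : ℝ} (hab : a < b) (c : ℝ) :
    ∀ᶠ X : ℝ in Filter.atTop, c * X ^ a < X ^ b := by
  have h := (tendsto_rpow_atTop (sub_pos.mpr hab)).eventually_gt_atTop c
  filter_upwards [h, Filter.eventually_gt_atTop 0] with X hX h0
  have : X ^ b = X ^ (b - a) * X ^ a := by rw [← Real.rpow_add h0]; ring_nf
  rw [this]
  have := Real.rpow_pos_of_pos h0 a
  gcongr

theorem rpow_div_pow_four_le {X Z u ε : ℝ} (hX : 0 < X)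
    (hZ : X ^ ((1 : ℝ) / 2 - u + ε) ≤ Z) :
    X ^ (ε / 2) * X ^ 2 / Z ^ 4 ≤ X ^ (4 * u - 7 / 2 * ε) := by
  have hZ0 : 0 < Z := (Real.rpow_pos_of_pos hX _).trans_le hZ
  rw [div_le_iff₀ (by positivity)]
  calc X ^ (ε / 2) * X ^ 2 = X ^ (4 * u - 7 / 2 * ε) * (X ^ ((1 : ℝ) / 2 - u + ε)) ^ 4 := by
        rw [← Real.rpow_natCast, ← Real.rpow_natCast, ← Real.rpow_mul hX.le, ← Real.rpow_add hX,
          ← Real.rpow_add hX]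
        congr 1
        push_cast
        ring
    _ ≤ _ := by
        have := Real.rpow_nonneg hX.le ((1 : ℝ) / 2 - u + ε)
        gcongr

theorem mem_majorArcSet_of_approx {l1 l2 X B Z1 Z2 α : ℝ} (hX : 0 < X) (hZ1 : 0 < Z1)
    (hZ2 : 0 < Z2)
    (h1 : ∃ q : ℕ, ∃ a : ℤ, 1 ≤ q ∧ q * Z1 ^ 4 ≤ B * X ^ 2 ∧ |q * (l1 * α) - a| * Z1 ^ 4 ≤ B * X)
    (h2 : ∃ q : ℕ, ∃ a : ℤ, 1 ≤ q ∧ q * Z2 ^ 4 ≤ B * X ^ 2 ∧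
      |q * (l2 * α) - a| * Z2 ^ 4 ≤ B * X) :
    α ∈ majorArcSet l1 l2 (B * X ^ 2 / Z1 ^ 4 / X) (B * X ^ 2 / Z2 ^ 4 / X)
      ⌊B * X ^ 2 / Z1 ^ 4⌋₊ ⌊B * X ^ 2 / Z2 ^ 4⌋₊ := by
  have key : ∀ l Z : ℝ, 0 < Z → ∀ (q : ℕ) (a : ℤ), q * Z ^ 4 ≤ B * X ^ 2 →
      |q * (l * α) - a| * Z ^ 4 ≤ B * X →
      q ≤ ⌊B * X ^ 2 / Z ^ 4⌋₊ ∧ |q * l * α - a| ≤ B * X ^ 2 / Z ^ 4 / X := by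
    intro l Z hZ q a e1 e2
    refine ⟨Nat.le_floor ((le_div_iff₀ (by positivity)).mpr e1), ?_⟩
    have : B * X ^ 2 / Z ^ 4 / X = B * X / Z ^ 4 := by field_simp
    rw [this, le_div_iff₀ (by positivity), mul_assoc (q : ℝ)]
    exact e2
  obtain ⟨q1, a1, p1, e1, f1⟩ := h1
  obtain ⟨q2, a2, p2, e2, f2⟩ := h2
  obtain ⟨k1, g1⟩ := key l1 Z1 hZ1 q1 a1 e1 f1
  obtain ⟨k2, g2⟩ := key l2 Z2 hZ2 q2 a2 e2 f2
  exact ⟨q1, q2, a1, a2, ⟨p1, k1⟩, ⟨p2, k2⟩, g1, g2⟩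

set_option maxHeartbeats 1000000 in
theorem statement12 (δ l1 l2 : ℝ) (hδ0 : 0 < δ) (hδ1 : δ < 1)
    (h1 : l1 ≠ 0) (h2 : l2 ≠ 0) (hirr : Irrational (l1 / l2))
    (u : ℝ) (hu0 : 0 < u) (hu : u ≤ 1 / 14) :
    ∃ ε0 > (0 : ℝ), ∀ ε : ℝ, 0 < ε → ε < ε0 →
    ∃ C > (0 : ℝ), ∃ q0 : ℕ, ∀ q : ℕ, q0 ≤ q →
      (∃ n : ℕ, (q : ℝ) = (GenContFract.of (l1 / l2)).dens n) →
      ∀ X : ℝ, X = (q : ℝ) ^ (1 / (1 - 8 * u)) →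
      ∀ Z1 Z2 : ℝ,
        X ^ ((1 : ℝ) / 2 - u + ε) ≤ Z1 → Z1 ≤ X ^ ((1 : ℝ) / 2) →
        X ^ ((1 : ℝ) / 2 - u + ε) ≤ Z2 → Z2 ≤ X ^ ((1 : ℝ) / 2) →
      ∀ y : ℝ, X ^ (-(2 : ℝ) / 3) ≤ y →
      MeasureTheory.volume {α : ℝ | (y < |α| ∧ |α| ≤ 2 * y) ∧
          (Z1 < ‖Stilde δ X (l1 * α)‖ ∧ ‖Stilde δ X (l1 * α)‖ ≤ 2 * Z1) ∧
          (Z2 < ‖Stilde δ X (l2 * α)‖ ∧ ‖Stilde δ X (l2 * α)‖ ≤ 2 * Z2)} ≤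
        ENNReal.ofReal (C * y * X ^ (2 + 8 * u + 3 * ε) * (Z1 ^ 4)⁻¹ * (Z2 ^ 4)⁻¹) := by
  refine ⟨1, one_pos, fun ε hε _ => ?_⟩
  have hl1 : 0 < |l1| := abs_pos.mpr h1
  have hl2 : 0 < |l2| := abs_pos.mpr h2
  have hlq : 0 < |l1 / l2| := abs_pos.mpr (div_ne_zero h1 h2)
  obtain ⟨C1, hC1, hdiv⟩ := exists_card_divisors_le (ε := ε / 4) (by positivity)
  set C0 : ℝ := 256 * √(|l2| / |l1|) + 64 * (1 / √(|l1| * |l2|)) with hC0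
  have hC0pos : 0 < C0 := by
    have : 0 < √(|l1| * |l2|) := Real.sqrt_pos.mpr (by positivity)
    positivity
  have hev : ∀ᶠ X : ℝ in Filter.atTop,
      (∀ Z : ℝ, X ^ (3 / 7 + ε / 2) ≤ Z → ∀ α : ℝ, Z < ‖Stilde δ X α‖ →
        ∃ q : ℕ, ∃ a : ℤ, 1 ≤ q ∧ q * Z ^ 4 ≤ X ^ (ε / 2) * X ^ 2 ∧
          |q * α - a| * Z ^ 4 ≤ X ^ (ε / 2) * X) ∧
      4 * X ^ ((2 : ℝ) / 7) < X ^ (1 : ℝ) ∧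
      (8 * (|l1| + |l2|) / |l2|) * X ^ (-(7 * ε)) < X ^ (0 : ℝ) ∧
      4 * (|l1| + |l2|) * X ^ ((11 : ℝ) / 7) < X ^ (2 : ℝ) ∧
      |l1|⁻¹ * X ^ (-(5 : ℝ) / 7) < X ^ (-(2 : ℝ) / 3) ∧
      (4 * |l1 / l2|)⁻¹ * X ^ (8 * u - 1) < X ^ (0 : ℝ) :=
    (exists_approx_of_large_Stilde hδ0 (by positivity)).and
      ((eventually_mul_rpow_lt (by norm_num) _).and ((eventually_mul_rpow_lt (by linarith) _).and
      ((eventually_mul_rpow_lt (by norm_num) _).and ((eventually_mul_rpow_lt (by norm_num) _).and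
      (eventually_mul_rpow_lt (by linarith) _)))))
  obtain ⟨X0, hX0⟩ := Filter.eventually_atTop.mp hev
  refine ⟨C0 * C1 ^ 2, by positivity, ⌈max X0 1⌉₊, ?_⟩
  rintro q hq ⟨n, hn⟩ X rfl Z1 Z2 hZ1 - hZ2 - y hy
  have hqR : max X0 1 ≤ (q : ℝ) := (Nat.le_ceil _).trans (by exact_mod_cast hq)
  have hq1R : (1 : ℝ) ≤ q := (le_max_right _ _).trans hqR
  have hq1 : 1 ≤ q := by exact_mod_cast hq1R
  have hu' : 0 < 1 - 8 * u := by linarith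
  set X : ℝ := (q : ℝ) ^ (1 / (1 - 8 * u)) with hX
  have hqX' : (q : ℝ) ≤ X := by
    rw [hX]
    refine Real.self_le_rpow_of_one_le hq1R ?_
    rw [le_div_iff₀ hu']
    linarith
  have hX1 : 1 ≤ X := hq1R.trans hqX'
  have hXpos : 0 < X := by linarith
  have hXq : X ^ (1 - 8 * u) = q := by
    rw [hX, ← Real.rpow_mul (by linarith), one_div_mul_cancel hu'.ne', Real.rpow_one]
  obtain ⟨hap, v1, v2, v3, v4, v5⟩ := hX0 X ((le_max_left _ _).trans (hqR.trans hqX'))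
  rw [Real.rpow_one] at v1
  rw [Real.rpow_zero] at v2 v5
  have hZ1' : X ^ (3 / 7 + ε / 2) ≤ Z1 :=
    (Real.rpow_le_rpow_of_exponent_le hX1 (by linarith)).trans hZ1
  have hZ2' : X ^ (3 / 7 + ε / 2) ≤ Z2 :=
    (Real.rpow_le_rpow_of_exponent_le hX1 (by linarith)).trans hZ2
  have hZ1p : 0 < Z1 := (Real.rpow_pos_of_pos hXpos _).trans_le hZ1
  have hZ2p : 0 < Z2 := (Real.rpow_pos_of_pos hXpos _).trans_le hZ2
  have hA1u := rpow_div_pow_four_le hXpos hZ1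
  have hA2u := rpow_div_pow_four_le hXpos hZ2
  have hmaj := fun α (ha : Z1 < ‖Stilde δ X (l1 * α)‖) (hb : Z2 < ‖Stilde δ X (l2 * α)‖) =>
    mem_majorArcSet_of_approx hXpos hZ1p hZ2p (hap Z1 hZ1' _ ha) (hap Z2 hZ2' _ hb)
  set A1 := X ^ (ε / 2) * X ^ 2 / Z1 ^ 4 with hA1
  set A2 := X ^ (ε / 2) * X ^ 2 / Z2 ^ 4 with hA2
  have hXε : 0 < X ^ (ε / 2) := Real.rpow_pos_of_pos hXpos _
  have hA10 : 0 ≤ A1 := by positivity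
  have hA20 : 0 ≤ A2 := by positivity
  have hexp : X ^ (4 * u - 7 / 2 * ε) ≤ X ^ ((2 : ℝ) / 7) :=
    Real.rpow_le_rpow_of_exponent_le hX1 (by linarith)
  have hAA : A1 * A2 ≤ X ^ (8 * u - 7 * ε) := by
    calc A1 * A2 ≤ X ^ (4 * u - 7 / 2 * ε) * X ^ (4 * u - 7 / 2 * ε) := by gcongr
      _ = _ := by rw [← Real.rpow_add hXpos]; ring_nf
  have hAA' : A1 * A2 ≤ X ^ ((4 : ℝ) / 7) :=
    hAA.trans (Real.rpow_le_rpow_of_exponent_le hX1 (by linarith))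
  have hy0 : 0 ≤ y := (Real.rpow_nonneg hXpos.le _).trans hy
  set T : ℝ := C1 * X ^ (ε / 2) with hTdef
  have hT1 : 1 ≤ T := one_le_mul_of_one_le_of_one_le hC1
    (Real.one_le_rpow hX1 (by positivity))
  have hT : ∀ k : ℕ, 1 ≤ k → (k : ℝ) ≤ 4 * (|l1| + |l2|) * X * (A1 * A2) →
      (k.divisors.card : ℝ) ≤ T := by
    intro k hk hkV
    refine (hdiv k hk).trans ?_
    have hkX : (k : ℝ) ≤ X ^ (2 : ℝ) := by
      refine hkV.trans (le_trans ?_ v3.le)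
      have e : X ^ ((11 : ℝ) / 7) = X * X ^ ((4 : ℝ) / 7) := by
        rw [← Real.rpow_one_add' hXpos.le (by norm_num)]; norm_num
      rw [e, mul_assoc _ X]
      gcongr
    have e : X ^ (ε / 2) = (X ^ (2 : ℝ)) ^ (ε / 4) := by
      rw [← Real.rpow_mul hXpos.le]; ring_nf
    rw [hTdef, e]
    gcongr
  have hinvq : X ^ (8 * u - 1) = (q : ℝ)⁻¹ := by
    rw [← hXq, ← Real.rpow_neg hXpos.le]; ring_nf
  have hql : 1 / (4 * q : ℝ) ≤ |l1 / l2| := by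
    rw [hinvq, ← mul_inv, inv_lt_one₀ (by positivity)] at v5
    rw [div_le_iff₀ (by positivity)]
    linarith
  have hsm : 2 * (|l1| + |l2|) * (A1 * A2 / X) < |l2| / (4 * q) := by
    have e : X ^ (8 * u - 7 * ε) / X = X ^ (-(7 * ε)) * (q : ℝ)⁻¹ := by
      rw [← hinvq, ← Real.rpow_add hXpos, ← Real.rpow_sub_one hXpos.ne']; ring_nf
    have h3 : A1 * A2 / X ≤ X ^ (-(7 * ε)) * (q : ℝ)⁻¹ := by rw [← e]; gcongr
    have hqi : 0 < (q : ℝ)⁻¹ := by positivity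
    calc 2 * (|l1| + |l2|) * (A1 * A2 / X)
        ≤ 2 * (|l1| + |l2|) * (X ^ (-(7 * ε)) * (q : ℝ)⁻¹) := by gcongr
      _ = (8 * (|l1| + |l2|) / |l2|) * X ^ (-(7 * ε)) * (|l2| / 4 * (q : ℝ)⁻¹) := by
          field_simp; norm_num
      _ < 1 * (|l2| / 4 * (q : ℝ)⁻¹) := by gcongr
      _ = _ := by field_simp
  have hyd : A1 / X < |l1| * y := by
    have e : X ^ (-(5 : ℝ) / 7) = X ^ ((2 : ℝ) / 7) / X := by
      rw [← Real.rpow_sub_one hXpos.ne']; norm_num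
    rw [inv_mul_lt_iff₀ hl1, e] at v4
    calc A1 / X ≤ X ^ ((2 : ℝ) / 7) / X := by gcongr; exact hA1u.trans hexp
      _ < |l1| * X ^ (-(2 : ℝ) / 3) := v4
      _ ≤ |l1| * y := by gcongr
  have hrep : ∀ N M : ℤ, N ≠ 0 → |N * (l1 / l2) - M| < 1 / (2 * q : ℝ) → (q : ℤ) < 2 * |N| := by
    intro N M hN hlt
    by_contra! hle
    exact absurd (inv_le_abs_mul_sub_of_convergent hirr hq1 hn M hN hle) (not_le.mpr hlt)
  have hfin := volume_majorArcSet_annulus_le h1 h2 hq1 hqX' hql hrep hA10 hA20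
    (by linarith [hA1u.trans hexp]) (by linarith [hA2u.trans hexp]) hsm hT1 hT hy0 hyd
  refine (measure_mono ?_).trans (hfin.trans (ENNReal.ofReal_le_ofReal ?_))
  · rintro α ⟨hα, ⟨ha, -⟩, ⟨hb, -⟩⟩
    exact ⟨hmaj α ha hb, hα⟩
  · have e1 : X ^ (2 + 8 * u + 2 * ε) = X ^ 2 * X ^ (8 * u - 1) * X * (X ^ (ε / 2)) ^ 4 := by
      rw [← Real.rpow_natCast, ← Real.rpow_natCast, ← Real.rpow_mul hXpos.le,
        ← Real.rpow_add hXpos, ← Real.rpow_add_one hXpos.ne', ← Real.rpow_add hXpos]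
      congr 1
      push_cast
      ring
    have e2 : C0 * (y * T ^ 2 * (A1 * A2) / (X * q)) =
        C0 * C1 ^ 2 * y * X ^ (2 + 8 * u + 2 * ε) * (Z1 ^ 4)⁻¹ * (Z2 ^ 4)⁻¹ := by
      rw [e1, hinvq, hTdef, hA1, hA2]
      field_simp
    rw [e2]
    gcongr
    norm_num

end
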